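/- Suppose d ∈ {1, 2} and α = d/3. Then the percolation probability is mean-field to within a polylogarithmic factor near criticality: there are constants C₁ < ∞ and ε₀ > 0 (depending only on d, α, c, C) such that C₁^{−1} (log(1/ε))^{−2} ε ≤ ℙ_{β_c+ε}(|K| = ∞) ≤ C₁ (log(1/ε))^{2} ε for every 0 < ε < ε₀. -/

import Mathlib

open MeasureTheory ENNReal

namespace LRP

/-- The vertex set `ℤ^d`. -/
abbrev V (d : ℕ) : Type := Fin d → ℤ

/-- The `ℓ^∞` norm of a lattice point, as a natural number. -/
def normInf {d : ℕ} (x : V d) : ℕ := Finset.univ.sup fun i => (x i).natAbs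

/-- A percolation configuration: each (unordered) pair of vertices is open or closed. -/
abbrev Config (d : ℕ) : Type := Sym2 (V d) → Bool

/-- The probability `1 - exp (-β J(x,y))` that the edge `e = {x,y}` is open
(the symmetrization `(J x y + J y x)/2` equals `J x y` for symmetric `J`). -/
noncomputable def edgeProb {d : ℕ} (J : V d → V d → ℝ) (β : ℝ) (e : Sym2 (V d)) : ℝ≥0∞ :=
  ENNReal.ofReal (1 - Real.exp (-β *
    Sym2.lift ⟨fun x y => (J x y + J y x) / 2, fun x y => by dsimp only; rw [add_comm]⟩ e))

/-- `IsLRP J P` asserts that for each `β`, `P β` is the law of long-range percolation on `ℤ^d`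
with kernel `J` at inverse temperature `β`: distinct edges are open independently, edge `{x,y}`
being open with probability `1 - exp (-β J(x,y))`.  This is expressed by prescribing the
probability of every finite cylinder event, which characterizes the measure uniquely. -/
def IsLRP {d : ℕ} (J : V d → V d → ℝ) (P : ℝ → Measure (Config d)) : Prop :=
  ∀ (β : ℝ) (s : Finset (Sym2 (V d))) (f : Sym2 (V d) → Bool),
    P β {ω | ∀ e ∈ s, ω e = f e} =
      ∏ e ∈ s, (if f e then edgeProb J β e else 1 - edgeProb J β e)

/-- Two vertices are adjacent if they are distinct and the edge between them is open. -/
def adj {d : ℕ} (ω : Config d) (x y : V d) : Prop := x ≠ y ∧ ω s(x, y) = true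

/-- `x ↔ y`: the vertices are connected by a path of open edges. -/
def conn {d : ℕ} (ω : Config d) (x y : V d) : Prop := Relation.ReflTransGen (adj ω) x y

/-- `x ↔ y` inside `A`: connected by an open path all of whose vertices lie in `A`. -/
def connIn {d : ℕ} (ω : Config d) (A : Set (V d)) (x y : V d) : Prop :=
  x ∈ A ∧ y ∈ A ∧ Relation.ReflTransGen (fun a b => a ∈ A ∧ b ∈ A ∧ adj ω a b) x y

/-- The cluster of `x`. -/
def cluster {d : ℕ} (ω : Config d) (x : V d) : Set (V d) := {y | conn ω x y}

/-- The critical point `β_c`. -/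
noncomputable def betaC {d : ℕ} (P : ℝ → Measure (Config d)) : ℝ :=
  sInf {β : ℝ | 0 ≤ β ∧ 0 < P β {ω | ∃ x, (cluster ω x).Infinite}}

/-- The two-point function `ℙ_β(x ↔ y)`. -/
noncomputable def twoPoint {d : ℕ} (P : ℝ → Measure (Config d)) (β : ℝ) (x y : V d) : ℝ≥0∞ :=
  P β {ω | conn ω x y}

/-- The susceptibility `χ(β) = Σ_x ℙ_β(0 ↔ x)`. -/
noncomputable def chi {d : ℕ} (P : ℝ → Measure (Config d)) (β : ℝ) : ℝ≥0∞ :=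
  ∑' x : V d, twoPoint P β 0 x

/-- `Σ_{x ∈ [-n,n]^d} ℙ_β(0 ↔ x)`. -/
noncomputable def boxSum {d : ℕ} (P : ℝ → Measure (Config d)) (β : ℝ) (n : ℕ) : ℝ≥0∞ :=
  ∑' x : V d, if normInf x ≤ n then twoPoint P β 0 x else 0

/-- The correlation length `ξ(β) = inf {r ≥ 1 : Σ_{x ∈ [-r,r]^d} ℙ_β(0↔x) ≥ χ(β)/2}`
(`= ∞` if no such `r` exists). -/
noncomputable def xi {d : ℕ} (P : ℝ → Measure (Config d)) (β : ℝ) : ℝ≥0∞ :=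
  sInf {r : ℝ≥0∞ | ∃ n : ℕ, r = (n : ℝ≥0∞) ∧ 1 ≤ n ∧ chi P β ≤ 2 * boxSum P β n}

/-- The triangle diagram `∇_β`. -/
noncomputable def triangle {d : ℕ} (P : ℝ → Measure (Config d)) (β : ℝ) : ℝ≥0∞ :=
  ∑' x : V d, ∑' y : V d, twoPoint P β 0 x * twoPoint P β x y * twoPoint P β y 0

/-- The standing assumptions on the kernel `J`: symmetric, integrable, translation-invariant,
with `c ‖x-y‖^{-d-α} ≤ J(x,y) ≤ C ‖x-y‖^{-d-α}` for distinct `x, y`, where `0 < α < d`. -/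
structure KernelHyp (d : ℕ) (J : V d → V d → ℝ) (α c C : ℝ) : Prop where
  d_pos : 1 ≤ d
  symm : ∀ x y, J x y = J y x
  transInv : ∀ x y z : V d, J (x + z) (y + z) = J x y
  nonneg : ∀ x y, 0 ≤ J x y
  integrable : Summable fun x : V d => J 0 x
  alpha_pos : 0 < α
  alpha_lt_d : α < (d : ℝ)
  c_pos : 0 < c
  c_le_C : c ≤ C
  lower : ∀ x y : V d, x ≠ y → c * (normInf (x - y) : ℝ) ^ (-(d : ℝ) - α) ≤ J x y
  upper : ∀ x y : V d, x ≠ y → J x y ≤ C * (normInf (x - y) : ℝ) ^ (-(d : ℝ) - α)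


end LRP

open Finset (sum_le_sum sum_congr mem_filter mul_sum sum_nonneg mem_sdiff sum_le_sum_of_subset_of_nonneg sum_comm card_le_card mk_mem_sym2_iff mem_powerset sum_mul sum_const sym2_mono sum_add_distrib filter_subset prod_nonneg sum_eq_zero erase_subset mem_product notMem_erase sum_filter_add_sum_filter_not)
open MeasureTheory ENNReal
namespace LRP

section exsec
variable {ε : Type*} [DecidableEq ε]

noncomputable def ex (p : ε → ℝ) (E : Finset ε) (f : Finset ε → ℝ) : ℝ :=
  ∑ S ∈ E.powerset, (∏ e ∈ S, p e) * (∏ e ∈ E \ S, (1 - p e)) * f S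

open Classical in
noncomputable def ind (P : Prop) : ℝ := if P then 1 else 0

lemma ind_t {P : Prop} (h : P) : ind P = 1 := by simp [ind, h]
lemma ind_f {P : Prop} (h : ¬P) : ind P = 0 := by simp [ind, h]
lemma ind_nn (P : Prop) : 0 ≤ ind P := by unfold ind; split_ifs <;> norm_num
lemma ind_le1 (P : Prop) : ind P ≤ 1 := by unfold ind; split_ifs <;> norm_num
lemma ind_mono {P Q : Prop} (h : P → Q) : ind P ≤ ind Q := by
  by_cases hp : P
  · rw [ind_t hp, ind_t (h hp)]
  · rw [ind_f hp]; exact ind_nn _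
lemma ind_and (P Q : Prop) : ind (P ∧ Q) = ind P * ind Q := by
  by_cases hp : P <;> by_cases hq : Q <;> simp [ind, hp, hq]
lemma ind_not (P : Prop) : ind (¬ P) = 1 - ind P := by
  by_cases hp : P <;> simp [ind, hp]
lemma ind_congr {P Q : Prop} (h : P ↔ Q) : ind P = ind Q := by rw [propext h]
lemma ind_or (P Q : Prop) : ind (P ∨ Q) ≤ ind P + ind Q := by
  by_cases hp : P <;> by_cases hq : Q <;> simp [ind, hp, hq]

noncomputable def Pr (p : ε → ℝ) (E : Finset ε) (A : Finset ε → Prop) : ℝ :=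
  ex p E (fun S => ind (A S))

@[simp] lemma ex_empty (p : ε → ℝ) (f : Finset ε → ℝ) : ex p ∅ f = f ∅ := by simp [ex]

lemma ex_insert (p : ε → ℝ) {e : ε} {E : Finset ε} (he : e ∉ E) (f : Finset ε → ℝ) :
    ex p (insert e E) f = (1 - p e) * ex p E f + p e * ex p E (fun S => f (insert e S)) := by
  unfold ex
  rw [Finset.sum_powerset_insert he, mul_sum, mul_sum]
  congr 1
  · refine sum_congr rfl fun S hS => ?_
    have hS' := Finset.mem_powerset.1 hS
    have h1 : e ∉ S := fun h => he (hS' h)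
    rw [Finset.insert_sdiff_of_notMem _ h1, Finset.prod_insert (by simp [he])]
    ring
  · refine sum_congr rfl fun S hS => ?_
    have hS' := Finset.mem_powerset.1 hS
    have h1 : e ∉ S := fun h => he (hS' h)
    rw [Finset.prod_insert h1]
    have : insert e E \ insert e S = E \ S := by
      ext a; simp only [mem_sdiff, Finset.mem_insert]
      constructor
      · rintro ⟨rfl | h, h2⟩ <;> simp_all
      · rintro ⟨h, h2⟩; refine ⟨Or.inr h, ?_⟩
        rintro (rfl | h3) <;> simp_all
    rw [this]; ring

lemma ex_congr {p : ε → ℝ} {E : Finset ε} {f g : Finset ε → ℝ} (h : ∀ S ⊆ E, f S = g S) :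
    ex p E f = ex p E g := by
  unfold ex
  refine sum_congr rfl fun S hS => by rw [h S (Finset.mem_powerset.1 hS)]

lemma ex_add (p : ε → ℝ) (E : Finset ε) (f g : Finset ε → ℝ) :
    ex p E (fun S => f S + g S) = ex p E f + ex p E g := by
  simp only [ex, mul_add, sum_add_distrib]

lemma ex_mul (p : ε → ℝ) (E : Finset ε) (c : ℝ) (f : Finset ε → ℝ) :
    ex p E (fun S => c * f S) = c * ex p E f := by
  simp only [ex, mul_sum]
  exact sum_congr rfl fun S _ => by ring

lemma ex_mul' (p : ε → ℝ) (E : Finset ε) (c : ℝ) (f : Finset ε → ℝ) :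
    ex p E (fun S => f S * c) = ex p E f * c := by
  simp only [mul_comm _ c, ex_mul]

lemma ex_sub (p : ε → ℝ) (E : Finset ε) (f g : Finset ε → ℝ) :
    ex p E (fun S => f S - g S) = ex p E f - ex p E g := by
  simp only [ex, mul_sub, Finset.sum_sub_distrib]

lemma ex_sum {ι : Type*} (p : ε → ℝ) (E : Finset ε) (s : Finset ι) (f : ι → Finset ε → ℝ) :
    ex p E (fun S => ∑ i ∈ s, f i S) = ∑ i ∈ s, ex p E (f i) := by
  simp only [ex, mul_sum]
  exact sum_comm

lemma ex_const (p : ε → ℝ) (E : Finset ε) (c : ℝ) : ex p E (fun _ => c) = c := by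
  induction E using Finset.induction_on with
  | empty => simp
  | insert e E he ih => rw [ex_insert p he, ih]; ring

def IsP (p : ε → ℝ) : Prop := ∀ e, 0 ≤ p e ∧ p e ≤ 1

lemma ex_mono {p : ε → ℝ} (hp : IsP p) {E : Finset ε} {f g : Finset ε → ℝ}
    (h : ∀ S ⊆ E, f S ≤ g S) : ex p E f ≤ ex p E g := by
  unfold ex
  refine sum_le_sum fun S hS => mul_le_mul_of_nonneg_left (h S (Finset.mem_powerset.1 hS)) ?_
  exact mul_nonneg (prod_nonneg fun e _ => (hp e).1)
    (prod_nonneg fun e _ => by linarith [(hp e).2])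

lemma ex_nn {p : ε → ℝ} (hp : IsP p) {E : Finset ε} {f : Finset ε → ℝ}
    (h : ∀ S ⊆ E, 0 ≤ f S) : 0 ≤ ex p E f := by
  rw [← ex_const p E 0]; exact ex_mono hp h

lemma ex_union (p : ε → ℝ) {E₁ E₂ : Finset ε} (h : Disjoint E₁ E₂) (f : Finset ε → ℝ) :
    ex p (E₁ ∪ E₂) f = ex p E₁ (fun S₁ => ex p E₂ (fun S₂ => f (S₁ ∪ S₂))) := by
  induction E₁ using Finset.induction_on generalizing f with
  | empty => simp
  | insert e E he ih =>
    rw [Finset.disjoint_insert_left] at h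
    rw [Finset.insert_union, ex_insert p (by simp [he, h.1]), ex_insert p he, ih h.2, ih h.2]
    simp only [Finset.insert_union]

lemma ex_inter (p : ε → ℝ) {E₁ E : Finset ε} (h : E₁ ⊆ E) (f : Finset ε → ℝ) :
    ex p E (fun S => f (S ∩ E₁)) = ex p E₁ f := by
  have h1 : E = E₁ ∪ (E \ E₁) := (Finset.union_sdiff_of_subset h).symm
  rw [h1, ex_union p Finset.disjoint_sdiff]
  refine ex_congr fun S hS => ?_
  rw [← ex_const p (E \ E₁) (f S)]
  refine ex_congr fun S' hS' => ?_
  congr 1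
  ext a
  have h2 := @hS a
  have h3 := @hS' a
  simp only [Finset.mem_inter, Finset.mem_union, mem_sdiff] at *
  tauto

lemma ex_indep (p : ε → ℝ) {E₁ E₂ E : Finset ε} (h1 : E₁ ⊆ E) (h2 : E₂ ⊆ E) (h : Disjoint E₁ E₂)
    (f g : Finset ε → ℝ) :
    ex p E (fun S => f (S ∩ E₁) * g (S ∩ E₂)) = ex p E₁ f * ex p E₂ g := by
  have h3 : ex p E (fun S => f (S ∩ E₁) * g (S ∩ E₂)) =
      ex p (E₁ ∪ E₂) (fun S => f (S ∩ E₁) * g (S ∩ E₂)) := by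
    rw [← ex_inter p (Finset.union_subset h1 h2) (fun S => f (S ∩ E₁) * g (S ∩ E₂))]
    refine ex_congr fun S _ => ?_
    rw [Finset.inter_assoc, Finset.inter_assoc, Finset.inter_eq_right.2 Finset.subset_union_left,
      Finset.inter_eq_right.2 Finset.subset_union_right]
  rw [h3, ex_union p h, ← ex_mul']
  refine ex_congr fun S hS => ?_
  rw [← ex_mul]
  refine ex_congr fun S' hS' => ?_
  have e1 : (S ∪ S') ∩ E₁ = S := by
    rw [Finset.union_inter_distrib_right, Finset.inter_eq_left.2 hS,
      Finset.disjoint_iff_inter_eq_empty.1 (Finset.disjoint_of_subset_left hS' h.symm),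
      Finset.union_empty]
  have e2 : (S ∪ S') ∩ E₂ = S' := by
    rw [Finset.union_inter_distrib_right, Finset.inter_eq_left.2 hS',
      Finset.disjoint_iff_inter_eq_empty.1 (Finset.disjoint_of_subset_left hS h),
      Finset.empty_union]
  rw [e1, e2]

lemma ex_mono_set {p : ε → ℝ} (hp : IsP p) {E₁ E : Finset ε} (h : E₁ ⊆ E) {f : Finset ε → ℝ}
    (hf : ∀ S S', S ⊆ S' → f S ≤ f S') : ex p E₁ f ≤ ex p E f := by
  rw [← ex_inter p h]
  exact ex_mono hp fun S _ => hf _ _ Finset.inter_subset_left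

lemma Pr_mono {p : ε → ℝ} (hp : IsP p) {E : Finset ε} {A B : Finset ε → Prop}
    (h : ∀ S ⊆ E, A S → B S) : Pr p E A ≤ Pr p E B :=
  ex_mono hp fun S hS => ind_mono (h S hS)

lemma Pr_nn {p : ε → ℝ} (hp : IsP p) {E : Finset ε} {A : Finset ε → Prop} : 0 ≤ Pr p E A :=
  ex_nn hp fun _ _ => ind_nn _

lemma Pr_le1 {p : ε → ℝ} (hp : IsP p) {E : Finset ε} {A : Finset ε → Prop} : Pr p E A ≤ 1 := by
  rw [← ex_const p E 1]; exact ex_mono hp fun _ _ => ind_le1 _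

lemma ind_exists_le {ι : Type*} (s : Finset ι) (A : ι → Prop) (P : Prop)
    (h : P → ∃ i ∈ s, A i) : ind P ≤ ∑ i ∈ s, ind (A i) := by
  by_cases hp : P
  · obtain ⟨i, hi, hA⟩ := h hp
    rw [ind_t hp, ← ind_t hA]
    exact Finset.single_le_sum (f := fun i => ind (A i)) (fun i _ => ind_nn _) hi
  · rw [ind_f hp]; exact sum_nonneg fun i _ => ind_nn _

lemma Pr_union_le {p : ε → ℝ} (hp : IsP p) {E : Finset ε} {ι : Type*} (s : Finset ι)
    (A : ι → Finset ε → Prop) (B : Finset ε → Prop) (h : ∀ S ⊆ E, B S → ∃ i ∈ s, A i S) :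
    Pr p E B ≤ ∑ i ∈ s, Pr p E (A i) := by
  unfold Pr
  rw [← ex_sum]
  exact ex_mono hp fun S hS => ind_exists_le s _ _ (h S hS)

def dj (A B : Finset ε → Prop) (S : Finset ε) : Prop :=
  ∃ S₁ ⊆ S, A S₁ ∧ B (S \ S₁)

def Inc (A : Finset ε → Prop) : Prop := ∀ ⦃S S'⦄, S ⊆ S' → A S → A S'

lemma dj_inc {A B : Finset ε → Prop} (hB : Inc B) : Inc (dj A B) := by
  rintro S S' h ⟨S₁, h1, hA, hb⟩
  exact ⟨S₁, h1.trans h, hA, hB (Finset.sdiff_subset_sdiff h (le_refl _)) hb⟩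

lemma dj_of {A B : Finset ε → Prop} (hB : Inc B) {S S₁ S₂ : Finset ε} (h1 : S₁ ⊆ S)
    (h2 : S₂ ⊆ S) (h : Disjoint S₁ S₂) (ha : A S₁) (hb : B S₂) : dj A B S :=
  ⟨S₁, h1, ha, hB (Finset.subset_sdiff.2 ⟨h2, h.symm⟩) hb⟩

lemma bk_arith {p a0 a1 b0 b1 x00 x01 x10 u : ℝ} (hp0 : 0 ≤ p) (hp1 : p ≤ 1)
    (ha : a0 ≤ a1) (hb : b0 ≤ b1)
    (h00 : x00 ≤ a0 * b0) (h01 : x01 ≤ a0 * b1) (h10 : x10 ≤ a1 * b0)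
    (hu : u ≤ x10 + x01 - x00) (hu' : u ≤ a1 * b1) :
    (1 - p) * x00 + p * u ≤ ((1 - p) * a0 + p * a1) * ((1 - p) * b0 + p * b1) := by
  have hab : 0 ≤ (a1 - a0) * (b1 - b0) := mul_nonneg (by linarith) (by linarith)
  rcases le_total p (1/2) with h | h
  · have h1 : (1 - p) * x00 + p * u ≤ (1 - 2*p) * (a0*b0) + p * (a1*b0 + a0*b1) := by
      have e1 := mul_le_mul_of_nonneg_left hu hp0
      have e2 := mul_le_mul_of_nonneg_left h00 (by linarith : 0 ≤ 1 - 2*p)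
      have e3 := mul_le_mul_of_nonneg_left h01 hp0
      have e4 := mul_le_mul_of_nonneg_left h10 hp0
      linarith
    have h2 := mul_nonneg (mul_nonneg hp0 hp0) hab
    nlinarith
  · have h1 : (1 - p) * x00 + p * u ≤ (1 - p) * (a1*b0 + a0*b1) + (2*p - 1) * (a1*b1) := by
      have q : 0 ≤ 1 - p := by linarith
      have e1 := mul_le_mul_of_nonneg_left hu q
      have e2 := mul_le_mul_of_nonneg_left hu' (by linarith : 0 ≤ 2*p - 1)
      have e3 := mul_le_mul_of_nonneg_left h01 q
      have e4 := mul_le_mul_of_nonneg_left h10 q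
      linarith
    have h2 := mul_nonneg (mul_nonneg (by linarith : 0 ≤ 1 - p) (by linarith : 0 ≤ 1 - p)) hab
    nlinarith

lemma Pr_insert (p : ε → ℝ) {e : ε} {E : Finset ε} (he : e ∉ E) (A : Finset ε → Prop) :
    Pr p (insert e E) A = (1 - p e) * Pr p E A + p e * Pr p E (fun S => A (insert e S)) :=
  ex_insert p he _

theorem BK {p : ε → ℝ} (hp : IsP p) (E : Finset ε) {A B : Finset ε → Prop}
    (hA : Inc A) (hB : Inc B) : Pr p E (dj A B) ≤ Pr p E A * Pr p E B := by
  induction E using Finset.induction_on generalizing A B with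
  | empty =>
    simp only [Pr, ex_empty]
    rw [← ind_and]
    refine ind_mono ?_
    rintro ⟨S₁, h1, ha, hb⟩
    exact ⟨hA h1 ha, hB Finset.sdiff_subset hb⟩
  | insert e E he ih =>
    have hA1 : Inc (fun S => A (insert e S)) := fun S S' h => hA (Finset.insert_subset_insert e h)
    have hB1 : Inc (fun S => B (insert e S)) := fun S S' h => hB (Finset.insert_subset_insert e h)
    rw [Pr_insert p he, Pr_insert p he, Pr_insert p he]
    have hsub : ∀ S ⊆ E, e ∉ S := fun S hS h => he (hS h)
    have key : ∀ S ⊆ E, dj A B (insert e S) →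
        dj (fun S => A (insert e S)) B S ∨ dj A (fun S => B (insert e S)) S := by
      rintro S hS ⟨S₁, h1, ha, hb⟩
      by_cases h : e ∈ S₁
      · left
        refine ⟨S₁.erase e, ?_, ?_, ?_⟩
        · intro x hx
          have := h1 (Finset.mem_of_mem_erase hx)
          simpa [Finset.ne_of_mem_erase hx] using this
        · show A (insert e (S₁.erase e))
          rwa [Finset.insert_erase h]
        · refine hB ?_ hb
          intro x hx
          simp only [mem_sdiff, Finset.mem_insert, Finset.mem_erase] at hx ⊢
          have : x ≠ e := fun hh => hx.2 (hh ▸ h)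
          tauto
      · right
        refine ⟨S₁, ?_, ha, ?_⟩
        · intro x hx
          have := h1 hx
          have h3 : x ≠ e := fun hh => h (hh ▸ hx)
          simpa [h3] using this
        · refine hB ?_ hb
          intro x hx
          simp only [mem_sdiff, Finset.mem_insert] at hx ⊢
          tauto
    refine bk_arith (a0 := Pr p E A) (b0 := Pr p E B) (x01 := Pr p E (dj A (fun S => B (insert e S))))
      (x10 := Pr p E (dj (fun S => A (insert e S)) B)) (hp e).1 (hp e).2
      (Pr_mono hp fun S _ => hA (Finset.subset_insert _ _))
      (Pr_mono hp fun S _ => hB (Finset.subset_insert _ _)) (ih hA hB) (ih hA hB1) (ih hA1 hB) ?_ ?_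
    · have : Pr p E (fun S => dj A B (insert e S)) + Pr p E (dj A B) ≤
        Pr p E (dj (fun S => A (insert e S)) B) + Pr p E (dj A (fun S => B (insert e S))) := by
        unfold Pr
        rw [← ex_add, ← ex_add]
        refine ex_mono hp fun S hS => ?_
        by_cases h0 : dj A B S
        · obtain ⟨S₁, h1, ha, hb⟩ := h0
          have t1 : dj (fun S => A (insert e S)) B S := ⟨S₁, h1, hA (Finset.subset_insert _ _) ha, hb⟩
          have t2 : dj A (fun S => B (insert e S)) S := ⟨S₁, h1, ha, hB (Finset.subset_insert _ _) hb⟩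
          rw [ind_t t1, ind_t t2]
          linarith [ind_le1 (dj A B (insert e S)), ind_le1 (dj A B S)]
        · rw [ind_f h0, add_zero]
          exact (ind_mono (key S hS)).trans (ind_or _ _)
      linarith
    · refine le_trans (Pr_mono hp fun S hS h => ?_) (ih hA1 hB1)
      rcases key S hS h with ⟨S₁, h1, ha, hb⟩ | ⟨S₁, h1, ha, hb⟩
      · exact ⟨S₁, h1, ha, hB (Finset.subset_insert _ _) hb⟩
      · exact ⟨S₁, h1, hA (Finset.subset_insert _ _) ha, hb⟩

noncomputable def pb (J : ε → ℝ) (β : ℝ) (e : ε) : ℝ := 1 - Real.exp (-β * J e)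

lemma pb_isP {J : ε → ℝ} (hJ : ∀ e, 0 ≤ J e) {β : ℝ} (hβ : 0 ≤ β) : IsP (pb J β) := fun e => by
  have h1 : Real.exp (-β * J e) ≤ 1 := by
    rw [Real.exp_le_one_iff]; nlinarith [mul_nonneg hβ (hJ e)]
  have := Real.exp_pos (-β * J e)
  unfold pb; constructor <;> linarith

lemma pb_le {J : ε → ℝ} {β : ℝ} (e : ε) : pb J β e ≤ β * J e := by
  have := Real.add_one_le_exp (-β * J e)
  unfold pb; linarith

lemma pb_deriv (J : ε → ℝ) (β : ℝ) (e : ε) :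
    HasDerivAt (fun β => pb J β e) (J e * (1 - pb J β e)) β := by
  unfold pb
  have h : HasDerivAt (fun β : ℝ => -β * J e) (-1 * J e) β := (hasDerivAt_id β).neg.mul_const _
  exact (h.exp.const_sub 1).congr_deriv (by ring)

theorem russo (J : ε → ℝ) (E : Finset ε) (f : Finset ε → ℝ) (β : ℝ) :
    HasDerivAt (fun β => ex (pb J β) E f)
      (∑ e ∈ E, J e * ex (pb J β) E (fun S => f (insert e S) - f S)) β := by
  induction E using Finset.induction_on generalizing f with
  | empty => simp only [ex_empty, Finset.sum_empty]; exact hasDerivAt_const _ _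
  | insert e E he ih =>
    have h1 := (((pb_deriv J β e).const_sub 1).mul (ih f)).add
      ((pb_deriv J β e).mul (ih (fun S => f (insert e S))))
    have h2 : (fun β => ex (pb J β) (insert e E) f) = (fun β => (1 - pb J β e) * ex (pb J β) E f +
      pb J β e * ex (pb J β) E (fun S => f (insert e S))) := by
      funext β; exact ex_insert _ he f
    rw [h2]
    refine h1.congr_deriv ?_
    rw [Finset.sum_insert he, ex_insert _ he]
    have h3 : ∀ e' ∈ E, J e' * ex (pb J β) (insert e E) (fun S => f (insert e' S) - f S) =
      (1 - pb J β e) * (J e' * ex (pb J β) E (fun S => f (insert e' S) - f S)) +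
      pb J β e * (J e' * ex (pb J β) E (fun S => f (insert e (insert e' S)) - f (insert e S))) := by
      intro e' _
      rw [ex_insert _ he]
      simp only [Finset.insert_comm e' e]
      ring
    rw [sum_congr rfl h3, sum_add_distrib, ← mul_sum, ← mul_sum]
    simp only [Finset.insert_idem, sub_self, ex_const, ex_sub]
    ring

lemma ex_mono_beta {J : ε → ℝ} (hJ : ∀ e, 0 ≤ J e) (E : Finset ε) {f : Finset ε → ℝ}
    (hf : ∀ S S', S ⊆ S' → f S ≤ f S') {β β' : ℝ} (h0 : 0 ≤ β) (h : β ≤ β') :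
    ex (pb J β) E f ≤ ex (pb J β') E f := by
  have : MonotoneOn (fun β => ex (pb J β) E f) (Set.Ici 0) := by
    refine monotoneOn_of_deriv_nonneg (convex_Ici 0) ?_ ?_ ?_
    · exact fun x _ => (russo J E f x).continuousAt.continuousWithinAt
    · exact fun x _ => (russo J E f x).differentiableAt.differentiableWithinAt
    · intro x hx
      rw [(russo J E f x).deriv]
      rw [interior_Ici] at hx
      exact sum_nonneg fun e _ => mul_nonneg (hJ e) (ex_nn (pb_isP hJ (le_of_lt hx))
        fun S _ => by linarith [hf S _ (Finset.subset_insert e S)])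
  exact this h0 (h0.trans h) h

lemma ex_map {ε' : Type*} [DecidableEq ε'] (φ : ε ↪ ε') (p : ε' → ℝ) (E : Finset ε)
    (f : Finset ε' → ℝ) : ex p (E.map φ) f = ex (fun e => p (φ e)) E (fun S => f (S.map φ)) := by
  induction E using Finset.induction_on generalizing f with
  | empty => simp
  | insert e E he ih =>
    rw [Finset.map_insert, ex_insert p (by simpa using he), ex_insert _ he, ih, ih]
    simp only [Finset.map_insert]

end exsec

section grsec
variable {X : Type*} [DecidableEq X]

def cn (S : Finset (Sym2 X)) (x y : X) : Prop :=
  Relation.ReflTransGen (fun a b => a ≠ b ∧ s(a, b) ∈ S) x y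

lemma cn_refl (S : Finset (Sym2 X)) (x : X) : cn S x x := Relation.ReflTransGen.refl
lemma cn_trans {S : Finset (Sym2 X)} {x y z : X} (h : cn S x y) (h' : cn S y z) : cn S x z :=
  Relation.ReflTransGen.trans h h'
lemma cn_symm {S : Finset (Sym2 X)} {x y : X} (h : cn S x y) : cn S y x := by
  induction h with
  | refl => exact Relation.ReflTransGen.refl
  | tail _ hbc ih =>
    exact Relation.ReflTransGen.head ⟨hbc.1.symm, by rw [Sym2.eq_swap]; exact hbc.2⟩ ih
lemma cn_comm {S : Finset (Sym2 X)} {x y : X} : cn S x y ↔ cn S y x := ⟨cn_symm, cn_symm⟩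
lemma cn_mono {S S' : Finset (Sym2 X)} (h : S ⊆ S') {x y : X} (h' : cn S x y) : cn S' x y :=
  Relation.ReflTransGen.mono (fun _ _ hab => ⟨hab.1, h hab.2⟩) _ _ h'
lemma cn_inc (x y : X) : Inc (fun S : Finset (Sym2 X) => cn S x y) := fun _ _ h h' => cn_mono h h'
lemma cn_edge {S : Finset (Sym2 X)} {x y : X} (h : s(x, y) ∈ S) : cn S x y := by
  by_cases hxy : x = y
  · rw [hxy]; exact cn_refl _ _
  · exact Relation.ReflTransGen.single ⟨hxy, h⟩

inductive Tr : Finset (Sym2 X) → X → X → Prop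
  | nil (S : Finset (Sym2 X)) (x : X) : Tr S x x
  | cons (S : Finset (Sym2 X)) (x z y : X) : x ≠ z → s(x, z) ∈ S → Tr (S.erase s(x, z)) z y → Tr S x y

lemma Tr.mono {S S' : Finset (Sym2 X)} {x y : X} (h : Tr S x y) (hs : S ⊆ S') : Tr S' x y := by
  induction h generalizing S' with
  | nil S x => exact Tr.nil _ _
  | cons S x z y h1 h2 h3 ih =>
    exact Tr.cons _ _ z _ h1 (hs h2) (ih (Finset.erase_subset_erase _ hs))

lemma Tr.cn {S : Finset (Sym2 X)} {x y : X} (h : Tr S x y) : cn S x y := by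
  induction h with
  | nil S x => exact cn_refl _ _
  | cons S x z y h1 h2 h3 ih => exact cn_trans (cn_edge h2) (cn_mono (erase_subset _ _) ih)

def tch (S : Finset (Sym2 X)) (v : X) : Prop := ∃ e ∈ S, v ∈ e

lemma cn_first {S : Finset (Sym2 X)} {x y : X} (h : cn S x y) :
    x = y ∨ ∃ z, x ≠ z ∧ s(x, z) ∈ S ∧ cn (S.filter (fun e => x ∉ e)) z y := by
  induction h with
  | refl => exact Or.inl rfl
  | @tail b c hb hbc ih =>
    by_cases hc : x = c
    · exact Or.inl hc
    right
    rcases ih with rfl | ⟨z, h1, h2, h3⟩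
    · exact ⟨c, hc, hbc.2, cn_refl _ _⟩
    · by_cases hbx : x = b
      · subst hbx; exact ⟨c, hc, hbc.2, cn_refl _ _⟩
      · refine ⟨z, h1, h2, cn_trans h3 (cn_edge ?_)⟩
        simp [hbc.2, hbx, hc]

lemma cn_tr {S : Finset (Sym2 X)} {x y : X} (h : cn S x y) : Tr S x y := by
  induction hn : S.card using Nat.strong_induction_on generalizing S x with
  | _ n ih =>
    rcases cn_first h with rfl | ⟨z, h1, h2, h3⟩
    · exact Tr.nil _ _
    · have hsub : S.filter (fun e => x ∉ e) ⊆ S.erase s(x, z) := by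
        intro e he
        rw [mem_filter] at he
        refine Finset.mem_erase.2 ⟨?_, he.1⟩
        rintro rfl
        exact he.2 (Sym2.mem_mk_left _ _)
      have h4 := cn_mono hsub h3
      exact Tr.cons _ _ z _ h1 h2 (ih _ (by rw [← hn]; exact Finset.card_erase_lt_of_mem h2) h4 rfl)

lemma exit_split {S : Finset (Sym2 X)} {x y : X} (h : Tr S x y) {U : X → Prop} (hx : U x)
    : (∃ S₁ ⊆ S, (∀ e ∈ S₁, ∀ v ∈ e, U v) ∧ cn S₁ x y) ∨ ∃ a b, U a ∧ ¬ U b ∧ s(a, b) ∈ S ∧ ∃ S₁ S₂, S₁ ⊆ S.erase s(a, b) ∧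
      S₂ ⊆ S.erase s(a, b) ∧ Disjoint S₁ S₂ ∧ (∀ e ∈ S₁, ∀ v ∈ e, U v) ∧ cn S₁ x a ∧ cn S₂ b y := by
  induction h with
  | nil S x => exact Or.inl ⟨∅, by simp, by simp, cn_refl _ _⟩
  | cons S x z y h1 h2 h3 ih =>
    by_cases hz : U z
    · rcases ih hz with ⟨S₁, k1, k2, k3⟩ | ⟨a, b, ha, hb, hab, S₁, S₂, k1, k2, k3, k4, k5, k6⟩
      · refine Or.inl ⟨insert s(x, z) S₁, Finset.insert_subset h2 (k1.trans (erase_subset _ _)), ?_,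
          cn_trans (cn_edge (Finset.mem_insert_self _ _)) (cn_mono (Finset.subset_insert _ _) k3)⟩
        intro e he v hv
        rcases Finset.mem_insert.1 he with rfl | he
        · rcases Sym2.mem_iff.1 hv with rfl | rfl <;> assumption
        · exact k2 e he v hv
      right
      have hne : s(x, z) ≠ s(a, b) := fun h => by
        rw [h] at hab; exact absurd hab (notMem_erase _ _)
      refine ⟨a, b, ha, hb, Finset.mem_of_mem_erase hab, insert s(x, z) S₁, S₂, ?_, ?_, ?_, ?_, ?_, k6⟩
      · refine Finset.insert_subset (Finset.mem_erase.2 ⟨hne, h2⟩) ?_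
        exact k1.trans (Finset.erase_subset_erase _ (erase_subset _ _))
      · exact k2.trans (Finset.erase_subset_erase _ (erase_subset _ _))
      · rw [Finset.disjoint_insert_left]
        refine ⟨fun h => ?_, k3⟩
        have := Finset.mem_of_mem_erase (k2 h)
        exact absurd this (notMem_erase _ _)
      · intro e he v hv
        rcases Finset.mem_insert.1 he with rfl | he
        · rcases Sym2.mem_iff.1 hv with rfl | rfl <;> assumption
        · exact k4 e he v hv
      · exact cn_trans (cn_edge (Finset.mem_insert_self _ _)) (cn_mono (Finset.subset_insert _ _) k5)
    · exact Or.inr ⟨x, z, hx, hz, h2, ∅, S.erase s(x, z), by simp, le_refl _, by simp, by simp,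
        cn_refl _ _, h3.cn⟩

noncomputable def ta (p : Sym2 X → ℝ) (W : Finset X) (x y : X) : ℝ :=
  Pr p W.sym2 (fun S => cn S x y)

variable {p : Sym2 X → ℝ}
lemma ta_nn (hp : IsP p) (W : Finset X) (x y : X) : 0 ≤ ta p W x y := Pr_nn hp
lemma ta_le1 (hp : IsP p) (W : Finset X) (x y : X) : ta p W x y ≤ 1 := Pr_le1 hp
lemma ta_comm (W : Finset X) (x y : X) : ta p W x y = ta p W y x := by
  unfold ta Pr; congr 1; funext S; exact ind_congr cn_comm
lemma ta_self (W : Finset X) (x : X) : ta p W x x = 1 := by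
  unfold ta Pr
  rw [← ex_const p W.sym2 1]
  exact ex_congr fun S _ => ind_t (cn_refl _ _)
lemma ta_mono (hp : IsP p) {W W' : Finset X} (h : W ⊆ W') (x y : X) : ta p W x y ≤ ta p W' x y :=
  ex_mono_set hp (sym2_mono h) fun _ _ h => ind_mono (cn_mono h)
lemma cn_mem {W : Finset X} {S : Finset (Sym2 X)} (hS : S ⊆ W.sym2) {x y : X} (h : cn S x y)
    (hx : x ∈ W) : y ∈ W := by
  induction h with
  | refl => exact hx
  | tail _ hbc _ => exact (Finset.mk_mem_sym2_iff.1 (hS hbc.2)).2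
lemma ta_zero (W : Finset X) {x y : X} (hy : y ∈ W) (hx : x ∉ W) : ta p W x y = 0 := by
  unfold ta Pr
  rw [← ex_const p W.sym2 0]
  refine ex_congr fun S hS => ind_f fun h => hx (cn_mem hS (cn_symm h) hy)

lemma ta_eq_Pr (W : Finset X) {E : Finset (Sym2 X)} (h : W.sym2 ⊆ E) (x y : X) :
    ta p W x y = Pr p E (fun S => cn (S ∩ W.sym2) x y) := by
  unfold ta Pr
  rw [← ex_inter p h]

lemma Pr_mem (E : Finset (Sym2 X)) {e : Sym2 X} (he : e ∈ E) : Pr p E (fun S => e ∈ S) = p e := by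
  unfold Pr
  rw [← Finset.insert_erase he, ex_insert _ (notMem_erase _ _)]
  have h1 : ex p (E.erase e) (fun S => ind (e ∈ S)) = 0 := by
    rw [← ex_const p (E.erase e) 0]
    exact ex_congr fun S hS => ind_f fun h => notMem_erase e E (hS h)
  have h2 : ex p (E.erase e) (fun S => ind (e ∈ insert e S)) = 1 := by
    rw [← ex_const p (E.erase e) 1]
    exact ex_congr fun S hS => ind_t (Finset.mem_insert_self _ _)
  rw [h1, h2]; ring

lemma Pr_or_le (hp : IsP p) {E : Finset (Sym2 X)} {A B C : Finset (Sym2 X) → Prop}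
    (h : ∀ S ⊆ E, A S → B S ∨ C S) : Pr p E A ≤ Pr p E B + Pr p E C := by
  unfold Pr
  rw [← ex_add]
  exact ex_mono hp fun S hS => (ind_mono (h S hS)).trans (ind_or _ _)

theorem SL_in (hp : IsP p) (W U : Finset X) {x y : X} (hx : x ∈ U) :
    ta p W x y ≤ ta p (W ∩ U) x y +
      ∑ a ∈ W ∩ U, ∑ b ∈ W \ U, ta p (W ∩ U) x a * p s(a, b) * ta p W b y := by
  rw [← Finset.sum_product' (f := fun a b => ta p (W ∩ U) x a * p s(a, b) * ta p W b y)]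
  have hU : ∀ {S S₁ : Finset (Sym2 X)}, S ⊆ W.sym2 → S₁ ⊆ S → (∀ e ∈ S₁, ∀ v ∈ e, v ∈ U) →
      S₁ ⊆ S₁ ∩ (W ∩ U).sym2 := by
    intro S S₁ hS k1 k4 e he
    have h1 := Finset.mem_sym2_iff.1 (hS (k1 he))
    simp only [Finset.mem_inter, Finset.mem_sym2_iff]
    exact ⟨he, fun v hv => ⟨h1 v hv, k4 e he v hv⟩⟩
  refine (Pr_or_le hp (B := fun S => cn (S ∩ (W ∩ U).sym2) x y) (C := fun S =>
    ∃ q ∈ (W ∩ U) ×ˢ (W \ U), dj (fun S => s(q.1, q.2) ∈ S)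
    (dj (fun S => cn (S ∩ (W ∩ U).sym2) x q.1) (fun S => cn S q.2 y)) S) ?_).trans ?_
  · intro S hS h
    rcases exit_split (cn_tr h) (U := (· ∈ U)) hx with ⟨S₁, k1, k2, k3⟩ |
      ⟨a, b, ha, hb, hab, S₁, S₂, k1, k2, k3, k4, k5, k6⟩
    · exact Or.inl (cn_mono ((hU hS k1 k2).trans (Finset.inter_subset_inter k1 (le_refl _))) k3)
    right
    have hW := Finset.mk_mem_sym2_iff.1 (hS hab)
    refine ⟨(a, b), by simp [hW.1, hW.2, ha, hb], {s(a, b)}, by simpa using hab, by simp, ?_⟩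
    rw [← Finset.erase_eq]
    refine dj_of (cn_inc _ _) k1 k2 k3 ?_ k6
    exact cn_mono (hU hS (k1.trans (erase_subset _ _)) k4) k5
  · rw [← ta_eq_Pr (W ∩ U) (sym2_mono Finset.inter_subset_left)]
    refine add_le_add (le_refl _) ?_
    refine (Pr_union_le hp _ _ _ (fun S _ h => h)).trans (sum_le_sum fun q hq => ?_)
    rw [mem_product, Finset.mem_inter, mem_sdiff] at hq
    have i1 : Inc (fun S : Finset (Sym2 X) => cn (S ∩ (W ∩ U).sym2) x q.1) := fun S S' h h' =>
      cn_mono (Finset.inter_subset_inter h (le_refl _)) h'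
    have i0 : Inc (fun S : Finset (Sym2 X) => s(q.1, q.2) ∈ S) := fun S S' h h' => h h'
    have e1 := BK hp W.sym2 i0 (dj_inc (A := (fun S => cn (S ∩ (W ∩ U).sym2) x q.1)) (cn_inc q.2 y))
    have e2 := BK hp W.sym2 i1 (cn_inc q.2 y)
    rw [Pr_mem (p := p) W.sym2 (e := s(q.1, q.2)) (Finset.mk_mem_sym2_iff.2 ⟨hq.1.1, hq.2.1⟩)] at e1
    rw [← ta_eq_Pr (W ∩ U) (sym2_mono Finset.inter_subset_left)] at e2
    change _ ≤ _ * ta p W q.2 y at e2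
    calc _ ≤ _ := e1
      _ ≤ p s(q.1, q.2) * (ta p (W ∩ U) x q.1 * ta p W q.2 y) :=
        mul_le_mul_of_nonneg_left e2 (hp _).1
      _ = _ := by ring

theorem SL (hp : IsP p) (W U : Finset X) {x y : X} (hx : x ∈ U) (hy : y ∉ U) (hxW : x ∈ W) :
    ta p W x y ≤ ∑ a ∈ W ∩ U, ∑ b ∈ W \ U, ta p (W ∩ U) x a * p s(a, b) * ta p W b y := by
  have h := SL_in hp W U (y := y) hx
  rwa [ta_comm (W ∩ U) x y, ta_zero (W ∩ U) (by simp [hx, hxW]) (by simp [hy]), zero_add] at h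

def Pth (S : Finset (Sym2 X)) (a b : X) : Prop :=
  cn S a b ∧ ∀ v, (v = a ∨ v = b ∨ tch S v) → ∃ S₁ ⊆ S, cn S₁ a v ∧ cn (S \ S₁) v b

lemma exists_pth {S : Finset (Sym2 X)} {x y : X} (h : Tr S x y) : ∃ S₁ ⊆ S, Pth S₁ x y := by
  induction h with
  | nil S x =>
    refine ⟨∅, by simp, cn_refl _ _, ?_⟩
    rintro v (rfl | rfl | ⟨e, he, -⟩)
    · exact ⟨∅, by simp, cn_refl _ _, cn_refl _ _⟩
    · exact ⟨∅, by simp, cn_refl _ _, cn_refl _ _⟩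
    · simp at he
  | cons S x z y h1 h2 h3 ih =>
    obtain ⟨S₁, k1, k2, k3⟩ := ih
    have hn : s(x, z) ∉ S₁ := fun h => notMem_erase _ _ (k1 h)
    have hc : cn (insert s(x, z) S₁) x y :=
      cn_trans (cn_edge (Finset.mem_insert_self _ _)) (cn_mono (Finset.subset_insert _ _) k2)
    refine ⟨insert s(x, z) S₁, Finset.insert_subset h2 (k1.trans (erase_subset _ _)), hc, ?_⟩
    have hx : ∃ S' ⊆ insert s(x, z) S₁, cn S' x x ∧ cn (insert s(x, z) S₁ \ S') x y :=
      ⟨∅, by simp, cn_refl _ _, by simpa using hc⟩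
    have main : ∀ v, (v = z ∨ v = y ∨ tch S₁ v) →
        ∃ S' ⊆ insert s(x, z) S₁, cn S' x v ∧ cn (insert s(x, z) S₁ \ S') v y := by
      intro v hv
      obtain ⟨S', j1, j2, j3⟩ := k3 v hv
      refine ⟨insert s(x, z) S', Finset.insert_subset_insert _ j1,
        cn_trans (cn_edge (Finset.mem_insert_self _ _)) (cn_mono (Finset.subset_insert _ _) j2), ?_⟩
      refine cn_mono ?_ j3
      intro e he
      simp only [mem_sdiff, Finset.mem_insert] at he ⊢
      refine ⟨Or.inr he.1, ?_⟩
      rintro (rfl | h)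
      · exact hn he.1
      · exact he.2 h
    rintro v (rfl | rfl | ⟨e, he, hv⟩)
    · exact hx
    · exact main _ (Or.inr (Or.inl rfl))
    · rcases Finset.mem_insert.1 he with rfl | he
      · rcases Sym2.mem_iff.1 hv with rfl | rfl
        · exact hx
        · exact main _ (Or.inl rfl)
      · exact main _ (Or.inr (Or.inr ⟨e, he, hv⟩))

lemma attach {S S₀ : Finset (Sym2 X)} {o x : X} (h : Tr S o x) {Wv : X → Prop} (hx : Wv x)
    (hW : ∀ v, tch S₀ v → Wv v) :
    ∃ v, Wv v ∧ ∃ S₃ ⊆ S, Disjoint S₀ S₃ ∧ cn S₃ o v := by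
  induction h with
  | nil S x => exact ⟨x, hx, ∅, by simp, by simp, cn_refl _ _⟩
  | cons S o z y h1 h2 h3 ih =>
    by_cases ho : Wv o
    · exact ⟨o, ho, ∅, by simp, by simp, cn_refl _ _⟩
    · obtain ⟨v, hv, S₃, k1, k2, k3⟩ := ih hx
      refine ⟨v, hv, insert s(o, z) S₃, Finset.insert_subset h2 (k1.trans (erase_subset _ _)), ?_,
        cn_trans (cn_edge (Finset.mem_insert_self _ _)) (cn_mono (Finset.subset_insert _ _) k3)⟩
      rw [Finset.disjoint_insert_right]
      exact ⟨fun h => ho (hW o ⟨_, h, Sym2.mem_mk_left _ _⟩), k2⟩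

def DL : List (X × X) → Finset (Sym2 X) → Prop
  | [] => fun _ => True
  | (a :: L) => dj (fun S => cn S a.1 a.2) (DL L)

lemma DL_inc (L : List (X × X)) : Inc (DL L) := by
  cases L with
  | nil => exact fun _ _ _ _ => trivial
  | cons a L =>
    induction L generalizing a with
    | nil => exact dj_inc (fun _ _ _ _ => trivial)
    | cons b L ih => exact dj_inc (ih b)

lemma DL_bound (hp : IsP p) (W : Finset X) (L : List (X × X)) :
    Pr p W.sym2 (DL L) ≤ (L.map fun a => ta p W a.1 a.2).prod := by
  induction L with
  | nil => simpa using Pr_le1 hp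
  | cons a L ih =>
    rw [List.map_cons, List.prod_cons]
    exact (BK hp _ (cn_inc _ _) (DL_inc L)).trans (mul_le_mul_of_nonneg_left ih (ta_nn hp _ _ _))

lemma DL_cons {S S₁ S₂ : Finset (Sym2 X)} {L : List (X × X)} {a b : X} (h1 : S₁ ⊆ S) (h2 : S₂ ⊆ S)
    (h : Disjoint S₁ S₂) (h3 : cn S₁ a b) (h4 : DL L S₂) : DL ((a, b) :: L) S :=
  dj_of (DL_inc L) h1 h2 h h3 h4

lemma cn_pth {S : Finset (Sym2 X)} {x y : X} (h : cn S x y) : ∃ S₁ ⊆ S, Pth S₁ x y :=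
  exists_pth (cn_tr h)

lemma tripod {S : Finset (Sym2 X)} {z u o : X} (h1 : cn S z u) (h2 : cn S z o) :
    ∃ v S₁ S₂ S₃, S₁ ⊆ S ∧ S₂ ⊆ S ∧ S₃ ⊆ S ∧ Disjoint S₁ S₂ ∧ Disjoint S₁ S₃ ∧ Disjoint S₂ S₃ ∧
      Pth S₁ z v ∧ Pth S₂ v u ∧ Pth S₃ v o := by
  obtain ⟨S₀, k1, k2, k3⟩ := cn_pth h1
  obtain ⟨v, hv, S₃, j1, j2, j3⟩ := attach (S₀ := S₀) (Wv := fun v => v = z ∨ v = u ∨ tch S₀ v)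
    (cn_tr (cn_symm h2)) (Or.inl rfl) (fun v hv => Or.inr (Or.inr hv))
  obtain ⟨S₁, i1, i2, i3⟩ := k3 v hv
  obtain ⟨P1, a1, b1⟩ := cn_pth i2
  obtain ⟨P2, a2, b2⟩ := cn_pth i3
  obtain ⟨P3, a3, b3⟩ := cn_pth (cn_symm j3)
  have d12 : Disjoint S₁ (S₀ \ S₁) := Finset.disjoint_sdiff
  have d13 : Disjoint S₁ S₃ := Finset.disjoint_of_subset_left i1 j2
  have d23 : Disjoint (S₀ \ S₁) S₃ := Finset.disjoint_of_subset_left Finset.sdiff_subset j2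
  exact ⟨v, P1, P2, P3, a1.trans (i1.trans k1), a2.trans (Finset.sdiff_subset.trans k1), a3.trans j1,
    d12.mono a1 a2, d13.mono a1 a3, d23.mono a2 a3, b1, b2, b3⟩

lemma tree4 {S : Finset (Sym2 X)} {z u o o' : X} (h1 : cn S z u) (h2 : cn S z o) (h3 : cn S z o') :
    ∃ v w, cn S z v ∧ cn S z w ∧ (DL [(z, w), (w, v), (w, o'), (v, u), (v, o)] S ∨
      DL [(z, v), (v, w), (w, u), (w, o'), (v, o)] S ∨
      DL [(z, v), (v, u), (v, w), (w, o), (w, o')] S) := by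
  obtain ⟨v, S₁, S₂, S₃, a1, a2, a3, d12, d13, d23, b1, b2, b3⟩ := tripod h1 h2
  obtain ⟨w, hw, S₄, c1, c2, c3⟩ := attach (S₀ := S₁ ∪ S₂ ∪ S₃) (Wv := fun w =>
    (w = z ∨ w = v ∨ tch S₁ w) ∨ tch S₂ w ∨ tch S₃ w) (cn_tr (cn_symm h3)) (Or.inl (Or.inl rfl)) (by
      rintro w ⟨e, he, hw⟩
      simp only [Finset.mem_union] at he
      rcases he with (he | he) | he
      · exact Or.inl (Or.inr (Or.inr ⟨e, he, hw⟩))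
      · exact Or.inr (Or.inl ⟨e, he, hw⟩)
      · exact Or.inr (Or.inr ⟨e, he, hw⟩))
  have c3 := cn_symm c3
  simp only [Finset.disjoint_union_left] at c2
  obtain ⟨⟨c21, c22⟩, c23⟩ := c2
  have five : ∀ {p1 p2 p3 p4 p5 : X × X} (T1 T2 T3 T4 T5 : Finset (Sym2 X)), T1 ⊆ S → T2 ⊆ S →
      T3 ⊆ S → T4 ⊆ S → T5 ⊆ S → Disjoint T1 (T2 ∪ (T3 ∪ (T4 ∪ T5))) → Disjoint T2 (T3 ∪ (T4 ∪ T5)) →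
      Disjoint T3 (T4 ∪ T5) → Disjoint T4 T5 → cn T1 p1.1 p1.2 → cn T2 p2.1 p2.2 → cn T3 p3.1 p3.2 →
      cn T4 p4.1 p4.2 → cn T5 p5.1 p5.2 → DL [p1, p2, p3, p4, p5] S := by
    intro p1 p2 p3 p4 p5 T1 T2 T3 T4 T5 s1 s2 s3 s4 s5 e1 e2 e3 e4 n1 n2 n3 n4 n5
    refine DL_cons s1 ?_ e1 n1 (DL_cons Finset.subset_union_left Finset.subset_union_right e2 n2
      (DL_cons Finset.subset_union_left Finset.subset_union_right e3 n3
      (DL_cons Finset.subset_union_left Finset.subset_union_right e4 n4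
      (DL_cons (le_refl _) (Finset.empty_subset _) (Finset.disjoint_empty_right _) n5 trivial))))
    simp only [Finset.union_subset_iff]
    exact ⟨s2, s3, s4, s5⟩
  have sp : ∀ {T T' R : Finset (Sym2 X)}, T' ⊆ T → Disjoint T R → Disjoint T' R ∧ Disjoint (T \ T') R :=
    fun h1 h2 => ⟨Finset.disjoint_of_subset_left h1 h2, Finset.disjoint_of_subset_left Finset.sdiff_subset h2⟩
  refine ⟨v, w, cn_mono a1 b1.1, cn_trans h3 (cn_symm (cn_mono c1 c3)), ?_⟩
  rcases hw with hw | hw | hw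
  · left
    obtain ⟨T, t1, t2, t3⟩ := b1.2 w hw
    refine five T (S₁ \ T) S₄ S₂ S₃ (t1.trans a1) (Finset.sdiff_subset.trans a1) c1 a2 a3 ?_ ?_ ?_ d23
      t2 t3 c3 b2.1 b3.1
    · simp only [Finset.disjoint_union_right]
      exact ⟨Finset.disjoint_sdiff, (sp t1 c21).1, (sp t1 d12).1, (sp t1 d13).1⟩
    · simp only [Finset.disjoint_union_right]
      exact ⟨(sp t1 c21).2, (sp t1 d12).2, (sp t1 d13).2⟩
    · simp only [Finset.disjoint_union_right]
      exact ⟨c22.symm, c23.symm⟩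
  · right; left
    obtain ⟨T, t1, t2, t3⟩ := b2.2 w (Or.inr (Or.inr hw))
    refine five S₁ T (S₂ \ T) S₄ S₃ a1 (t1.trans a2) (Finset.sdiff_subset.trans a2) c1 a3 ?_ ?_ ?_ c23.symm
      b1.1 t2 t3 c3 b3.1
    · simp only [Finset.disjoint_union_right]
      exact ⟨(sp t1 d12.symm).1.symm, (sp t1 d12.symm).2.symm, c21, d13⟩
    · simp only [Finset.disjoint_union_right]
      exact ⟨Finset.disjoint_sdiff, (sp t1 c22).1, (sp t1 d23).1⟩
    · simp only [Finset.disjoint_union_right]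
      exact ⟨(sp t1 c22).2, (sp t1 d23).2⟩
  · right; right
    obtain ⟨T, t1, t2, t3⟩ := b3.2 w (Or.inr (Or.inr hw))
    refine five S₁ S₂ T (S₃ \ T) S₄ a1 a2 (t1.trans a3) (Finset.sdiff_subset.trans a3) c1 ?_ ?_ ?_
      (sp t1 c23).2 b1.1 b2.1 t2 t3 c3
    · simp only [Finset.disjoint_union_right]
      exact ⟨d12, (sp t1 d13.symm).1.symm, (sp t1 d13.symm).2.symm, c21⟩
    · simp only [Finset.disjoint_union_right]
      exact ⟨(sp t1 d23.symm).1.symm, (sp t1 d23.symm).2.symm, c22⟩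
    · simp only [Finset.disjoint_union_right]
      exact ⟨Finset.disjoint_sdiff, (sp t1 c23).1⟩

end grsec

section clsec
open Classical
variable {X : Type*} [DecidableEq X]

noncomputable def cl (S : Finset (Sym2 X)) (W : Finset X) (x : X) : Finset X := W.filter (fun y => cn S x y)

lemma mem_cl {S : Finset (Sym2 X)} {W : Finset X} {x y : X} : y ∈ cl S W x ↔ y ∈ W ∧ cn S x y := by
  simp [cl]
lemma cl_sub (S : Finset (Sym2 X)) (W : Finset X) (x : X) : cl S W x ⊆ W := filter_subset _ _
lemma cl_mono {S S' : Finset (Sym2 X)} (h : S ⊆ S') (W : Finset X) (x : X) : cl S W x ⊆ cl S' W x :=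
  fun y hy => mem_cl.2 ⟨(mem_cl.1 hy).1, cn_mono h (mem_cl.1 hy).2⟩
lemma cl_eq {S : Finset (Sym2 X)} (W : Finset X) {x y : X} (h : cn S x y) : cl S W x = cl S W y := by
  ext u; simp only [mem_cl]
  exact ⟨fun h' => ⟨h'.1, cn_trans (cn_symm h) h'.2⟩, fun h' => ⟨h'.1, cn_trans h h'.2⟩⟩
lemma cl_card (S : Finset (Sym2 X)) (W : Finset X) (x : X) :
    ((cl S W x).card : ℝ) = ∑ y ∈ W, ind (cn S x y) := by
  unfold cl ind
  rw [Finset.sum_boole]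

lemma comp_in {H : Finset (Sym2 X)} {w u : X} (h : cn H w u) :
    cn (H.filter (fun e => ∀ v ∈ e, cn H w v)) w u := by
  induction h with
  | refl => exact cn_refl _ _
  | @tail b c hb hbc ih =>
    refine cn_trans ih (cn_edge ?_)
    rw [mem_filter]
    refine ⟨hbc.2, fun v hv => ?_⟩
    rcases Sym2.mem_iff.1 hv with rfl | rfl
    · exact hb
    · exact cn_trans hb (cn_edge hbc.2)

lemma comp_out {H : Finset (Sym2 X)} {w v u : X} (hn : ¬ cn H w v) (h : cn H v u) :
    cn (H \ H.filter (fun e => ∀ v ∈ e, cn H w v)) v u := by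
  induction h with
  | refl => exact cn_refl _ _
  | @tail b c hb hbc ih =>
    refine cn_trans ih (cn_edge ?_)
    rw [mem_sdiff, mem_filter]
    refine ⟨hbc.2, fun h => hn (cn_trans (h.2 b (Sym2.mem_mk_left _ _)) (cn_symm hb))⟩

lemma erase_cover {H : Finset (Sym2 X)} {v w u : X} (h : cn H v u) :
    cn (H.erase s(v, w)) v u ∨ cn (H.erase s(v, w)) w u := by
  induction h with
  | refl => exact Or.inl (cn_refl _ _)
  | @tail b c hb hbc ih =>
    by_cases he : s(b, c) = s(v, w)
    · rcases Sym2.eq_iff.1 he with ⟨rfl, rfl⟩ | ⟨rfl, rfl⟩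
      · exact Or.inr (cn_refl _ _)
      · exact Or.inl (cn_refl _ _)
    · have h1 : cn (H.erase s(v, w)) b c := cn_edge (Finset.mem_erase.2 ⟨he, hbc.2⟩)
      rcases ih with ih | ih
      · exact Or.inl (cn_trans ih h1)
      · exact Or.inr (cn_trans ih h1)

lemma tree_split_aux {W : Finset X} {x : X} {n : ℕ} (hn : 1 ≤ n) :
    ∀ (k : ℕ) (H R : Finset (Sym2 X)) (v : X), H.card = k → Disjoint H R → cn R x v →
      n ≤ (cl H W v).card → ∃ H' R' v', H' ⊆ H ∪ R ∧ R' ⊆ H ∪ R ∧ Disjoint H' R' ∧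
        n ≤ (cl H' W v').card ∧ (cl H' W v').card ≤ 2 * n ∧
        cl R W x ∪ cl H W v ⊆ cl R' W x ∪ cl H' W v' := by
  intro k
  induction k using Nat.strong_induction_on with
  | _ k ih =>
  intro H R v hk hd hv hcard
  by_cases hle : (cl H W v).card ≤ 2 * n
  · exact ⟨H, R, v, Finset.subset_union_left, Finset.subset_union_right, hd, hcard, hle, le_refl _⟩
  push Not at hle

  have hex : ∃ u ∈ cl H W v, u ≠ v := by
    by_contra hcon
    push Not at hcon
    have : (cl H W v).card ≤ 1 := Finset.card_le_one.2 fun a ha b hb => by rw [hcon a ha, hcon b hb]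
    omega
  obtain ⟨u, hu, huv⟩ := hex
  rcases cn_first (mem_cl.1 hu).2 with h | ⟨w, hvw, he, -⟩
  · exact absurd h.symm huv
  set H0 := H.erase s(v, w) with hH0
  have hlt : H0.card < k := by rw [← hk]; exact Finset.card_erase_lt_of_mem he
  have hH0s : H0 ⊆ H := erase_subset _ _
  have hcov : cl H W v ⊆ cl H0 W v ∪ cl H0 W w := by
    intro y hy
    rw [Finset.mem_union, mem_cl, mem_cl]
    have := mem_cl.1 hy
    rcases erase_cover (w := w) this.2 with h | h
    · exact Or.inl ⟨this.1, h⟩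
    · exact Or.inr ⟨this.1, h⟩
  by_cases hconn : cn H0 w v
  · have e1 : cl H0 W w = cl H0 W v := cl_eq W hconn
    rw [e1, Finset.union_self] at hcov
    obtain ⟨H', R', v', g1, g2, g3, g4, g5, g6⟩ := ih _ hlt H0 R v rfl
      (Finset.disjoint_of_subset_left hH0s hd) hv (hcard.trans (card_le_card hcov))
    exact ⟨H', R', v', g1.trans (Finset.union_subset_union_left hH0s),
      g2.trans (Finset.union_subset_union_left hH0s), g3, g4, g5,
      (Finset.union_subset_union_right hcov).trans g6⟩
  set HB := H0.filter (fun e => ∀ v ∈ e, cn H0 w v) with hHB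
  have hHBs : HB ⊆ H0 := filter_subset _ _
  have cB : cl H0 W w ⊆ cl HB W w := fun y hy =>
    mem_cl.2 ⟨(mem_cl.1 hy).1, comp_in (mem_cl.1 hy).2⟩
  have cA : cl H0 W v ⊆ cl (H0 \ HB) W v := fun y hy =>
    mem_cl.2 ⟨(mem_cl.1 hy).1, comp_out hconn (mem_cl.1 hy).2⟩
  have hene : s(v, w) ∉ H0 := notMem_erase _ _
  have heR : s(v, w) ∉ R := Finset.disjoint_left.1 hd he
  have hdR : Disjoint H0 R := Finset.disjoint_of_subset_left hH0s hd
  have stepR : ∀ Q : Finset (Sym2 X), Q ⊆ H0 → insert s(v, w) (R ∪ Q) ⊆ H ∪ R := by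
    intro Q hQ
    refine Finset.insert_subset (Finset.mem_union_left _ he) (Finset.union_subset Finset.subset_union_right ?_)
    exact (hQ.trans hH0s).trans Finset.subset_union_left
  by_cases hB : n ≤ (cl H0 W w).card
  · obtain ⟨H', R', v', g1, g2, g3, g4, g5, g6⟩ := ih HB.card
      (lt_of_le_of_lt (card_le_card hHBs) hlt) HB (insert s(v, w) (R ∪ (H0 \ HB))) w rfl (by
        rw [Finset.disjoint_insert_right, Finset.disjoint_union_right]
        exact ⟨fun h => hene (hHBs h), Finset.disjoint_of_subset_left hHBs hdR, Finset.disjoint_sdiff⟩)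
      (cn_trans (cn_mono (Finset.subset_union_left.trans (Finset.subset_insert _ _)) hv)
        (cn_edge (Finset.mem_insert_self _ _))) (hB.trans (card_le_card cB))
    have hs : HB ∪ insert s(v, w) (R ∪ (H0 \ HB)) ⊆ H ∪ R :=
      Finset.union_subset ((hHBs.trans hH0s).trans Finset.subset_union_left)
        (stepR _ Finset.sdiff_subset)
    refine ⟨H', R', v', g1.trans hs, g2.trans hs, g3, g4, g5, subset_trans ?_ g6⟩
    refine Finset.union_subset ((cl_mono (Finset.subset_union_left.trans (Finset.subset_insert _ _)) W x).trans
      Finset.subset_union_left) (hcov.trans (Finset.union_subset ?_ (cB.trans Finset.subset_union_right)))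
    refine subset_trans ?_ Finset.subset_union_left
    intro y hy
    have := mem_cl.1 (cA hy)
    exact mem_cl.2 ⟨this.1, cn_trans (cn_mono (Finset.subset_union_left.trans (Finset.subset_insert _ _)) hv)
      (cn_mono (Finset.subset_union_right.trans (Finset.subset_insert _ _)) this.2)⟩
  · have hcA : n ≤ (cl (H0 \ HB) W v).card := by
      have := (card_le_card hcov).trans (Finset.card_union_le _ _)
      have := card_le_card cA
      omega
    obtain ⟨H', R', v', g1, g2, g3, g4, g5, g6⟩ := ih (H0 \ HB).card
      (lt_of_le_of_lt (card_le_card Finset.sdiff_subset) hlt) (H0 \ HB) (insert s(v, w) (R ∪ HB)) v rfl (by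
        rw [Finset.disjoint_insert_right, Finset.disjoint_union_right]
        exact ⟨fun h => hene (Finset.sdiff_subset h), Finset.disjoint_of_subset_left Finset.sdiff_subset hdR,
          Finset.sdiff_disjoint⟩)
      (cn_mono (Finset.subset_union_left.trans (Finset.subset_insert _ _)) hv) hcA
    have hs : (H0 \ HB) ∪ insert s(v, w) (R ∪ HB) ⊆ H ∪ R :=
      Finset.union_subset ((Finset.sdiff_subset.trans hH0s).trans Finset.subset_union_left)
        (stepR _ hHBs)
    refine ⟨H', R', v', g1.trans hs, g2.trans hs, g3, g4, g5, subset_trans ?_ g6⟩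
    refine Finset.union_subset ((cl_mono (Finset.subset_union_left.trans (Finset.subset_insert _ _)) W x).trans
      Finset.subset_union_left) (hcov.trans (Finset.union_subset (cA.trans Finset.subset_union_right) ?_))
    refine subset_trans ?_ Finset.subset_union_left
    intro y hy
    have := mem_cl.1 (cB hy)
    exact mem_cl.2 ⟨this.1, cn_trans (cn_trans (cn_mono (Finset.subset_union_left.trans (Finset.subset_insert _ _)) hv)
      (cn_edge (Finset.mem_insert_self _ _)))
      (cn_mono (Finset.subset_union_right.trans (Finset.subset_insert _ _)) this.2)⟩

def big (W : Finset X) (n : ℕ) (S : Finset (Sym2 X)) : Prop := ∃ y ∈ W, n ≤ (cl S W y).card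

lemma big_inc (W : Finset X) (n : ℕ) : Inc (big W n) := by
  rintro S S' h ⟨y, hy, hn⟩
  exact ⟨y, hy, hn.trans (card_le_card (cl_mono h W y))⟩

lemma split_bound {p : Sym2 X → ℝ} (hp : IsP p) (W : Finset X) (x : X) {n N : ℕ} (hn : 1 ≤ n) (hN : n ≤ N) :
    Pr p W.sym2 (fun S => N ≤ (cl S W x).card) ≤
      Pr p W.sym2 (fun S => N - 2 * n ≤ (cl S W x).card) * Pr p W.sym2 (big W n) := by
  refine (Pr_mono hp ?_).trans (BK hp _ ?_ (big_inc W n))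
  · intro S hS h
    obtain ⟨H', R', v', g1, g2, g3, g4, g5, g6⟩ := tree_split_aux (W := W) (x := x) hn S.card S ∅ x rfl
      (by simp) (cn_refl _ _) (hN.trans h)
    rw [Finset.union_empty] at g1 g2
    refine dj_of (big_inc W n) g2 g1 g3.symm ?_ ?_
    · have := (card_le_card (Finset.subset_union_right.trans g6)).trans (Finset.card_union_le _ _)
      show N - 2 * n ≤ _
      omega
    · have hne : (cl H' W v').Nonempty := Finset.card_pos.1 (by omega)
      obtain ⟨y, hy⟩ := hne
      have hy' := mem_cl.1 hy
      exact ⟨y, hy'.1, by rw [← cl_eq W hy'.2]; exact g4⟩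
  · exact fun S S' h h' => le_trans h' (card_le_card (cl_mono h W x))

end clsec

section scoresec
open Classical
variable {ε : Type*} [DecidableEq ε]

lemma ex_cs {p : ε → ℝ} (hp : IsP p) (E : Finset ε) (f g : Finset ε → ℝ) :
    (ex p E (fun S => f S * g S)) ^ 2 ≤ ex p E (fun S => f S ^ 2) * ex p E (fun S => g S ^ 2) := by
  unfold ex
  have hw : ∀ S, 0 ≤ (∏ e ∈ S, p e) * (∏ e ∈ E \ S, (1 - p e)) := fun S =>
    mul_nonneg (prod_nonneg fun e _ => (hp e).1)
      (prod_nonneg fun e _ => by linarith [(hp e).2])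
  refine Finset.sum_sq_le_sum_mul_sum_of_sq_le_mul _ (fun S _ => mul_nonneg (hw S) (sq_nonneg _))
    (fun S _ => mul_nonneg (hw S) (sq_nonneg _)) (fun S _ => le_of_eq (by ring))

noncomputable def dR (J : ε → ℝ) (β : ℝ) (F : Finset ε) (f : Finset ε → ℝ) : ℝ :=
  ∑ e ∈ F, J e * ex (pb J β) F (fun S => f (insert e S) - f S)

lemma dR_union (J : ε → ℝ) (β : ℝ) {F₁ F₂ : Finset ε} (h : Disjoint F₁ F₂) (f : Finset ε → ℝ) :
    dR J β (F₁ ∪ F₂) f = dR J β F₁ (fun S₁ => ex (pb J β) F₂ (fun S₂ => f (S₁ ∪ S₂))) +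
      ex (pb J β) F₁ (fun S₁ => dR J β F₂ (fun S₂ => f (S₁ ∪ S₂))) := by
  unfold dR
  rw [Finset.sum_union h, ex_sum]
  congr 1
  · refine sum_congr rfl fun e _ => ?_
    rw [ex_union _ h]
    simp only [ex_sub, Finset.insert_union]
  · refine sum_congr rfl fun e _ => ?_
    rw [ex_union _ h, ex_mul]
    simp only [Finset.union_insert]

lemma dR_insert (J : ε → ℝ) (β : ℝ) {e : ε} {F : Finset ε} (he : e ∉ F) (f : Finset ε → ℝ) :
    dR J β (insert e F) f = J e * (1 - pb J β e) *
      (ex (pb J β) F (fun S => f (insert e S)) - ex (pb J β) F f) +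
      (1 - pb J β e) * dR J β F f + pb J β e * dR J β F (fun S => f (insert e S)) := by
  rw [Finset.insert_eq, dR_union J β (by simpa using he)]
  unfold dR
  have h1 : ∀ g : Finset ε → ℝ, ex (pb J β) {e} g = (1 - pb J β e) * g ∅ + pb J β e * g {e} := by
    intro g
    have := ex_insert (pb J β) (Finset.notMem_empty e) g
    simpa using this
  have h2 : insert e ({e} : Finset ε) = {e} := by simp
  simp only [Finset.sum_singleton, h1, h2, Finset.empty_union, ← Finset.insert_eq, Finset.insert_idem, sub_self,
    insert_empty_eq]
  ring

lemma score {J : ε → ℝ} (hJ : ∀ e, 0 ≤ J e) {β : ℝ} (hβ : 0 < β) (F : Finset ε) :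
    ∃ Z : Finset ε → ℝ, (∀ g : Finset ε → ℝ, ex (pb J β) F (fun S => g S * Z S) = dR J β F g) ∧
      ex (pb J β) F Z = 0 ∧ ex (pb J β) F (fun S => Z S ^ 2) ≤ ∑ e ∈ F, J e / β := by
  induction F using Finset.induction_on with
  | empty => exact ⟨fun _ => 0, by simp [dR], by simp, by simp⟩
  | insert e F he ih =>
    obtain ⟨Z, h1, h2, h3⟩ := ih
    set p := pb J β e with hp
    have hp1 : p < 1 := by rw [hp]; unfold pb; linarith [Real.exp_pos (-β * J e)]
    have hp0 : 0 ≤ p := (pb_isP hJ hβ.le e).1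
    obtain ⟨s1, hs1, hs2⟩ : ∃ s1 : ℝ, p * s1 = J e * (1 - p) ∧ p * s1 ^ 2 + (1 - p) * J e ^ 2 ≤ J e / β := by
      rcases hp0.eq_or_lt with h0 | h0
      · have : J e = 0 := by
          have h4 : Real.exp (-β * J e) = 1 := by
            have : p = 1 - Real.exp (-β * J e) := rfl
            linarith
          rw [Real.exp_eq_one_iff] at h4
          nlinarith [hJ e]
        exact ⟨0, by rw [this]; ring, by rw [this]; simp⟩
      · refine ⟨J e * (1 - p) / p, by field_simp, ?_⟩
        have key : β * J e * (1 - p) ≤ p := by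
          have h5 := Real.add_one_le_exp (β * J e)
          have h6 : (1 - p) = Real.exp (-(β * J e)) := by rw [hp]; unfold pb; rw [neg_mul]; ring
          have h7 : Real.exp (β * J e) * (1 - p) = 1 := by rw [h6, ← Real.exp_add]; simp
          nlinarith
        have : p * (J e * (1 - p) / p) ^ 2 + (1 - p) * J e ^ 2 = J e ^ 2 * (1 - p) / p := by
          field_simp; ring
        rw [this, div_le_div_iff₀ h0 hβ]
        nlinarith [hJ e, mul_le_mul_of_nonneg_left key (hJ e)]
    have hZ : ∀ S ⊆ F, S.erase e = S := fun S hS => Finset.erase_eq_of_notMem fun h => he (hS h)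
    have hZ' : ∀ S ⊆ F, (insert e S).erase e = S := fun S hS => Finset.erase_insert fun h => he (hS h)
    have hm : ∀ S ⊆ F, e ∉ S := fun S hS h => he (hS h)
    have A : ∀ (G : ℝ → Finset ε → ℝ), ex (pb J β) (insert e F)
        (fun S => G ((if e ∈ S then s1 else -J e) + Z (S.erase e)) S) =
        (1 - p) * ex (pb J β) F (fun S => G (-J e + Z S) S) +
          p * ex (pb J β) F (fun S => G (s1 + Z S) (insert e S)) := by
      intro G
      rw [ex_insert _ he]
      congr 2
      · exact ex_congr fun S hS => by simp [hm S hS, hZ S hS]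
      · exact ex_congr fun S hS => by simp [hZ' S hS]
    refine ⟨fun S => (if e ∈ S then s1 else -J e) + Z (S.erase e), ?_, ?_, ?_⟩
    · intro g
      rw [A (fun z S => g S * z), dR_insert J β he, ← h1, ← h1]
      simp only [mul_add, ex_add, ex_mul']
      linear_combination (ex (pb J β) F (fun S => g (insert e S))) * hs1
    · rw [A (fun z S => z)]
      simp only [ex_add, ex_const, h2]
      linear_combination hs1
    · rw [A (fun z S => z ^ 2), Finset.sum_insert he]
      simp only [add_sq, ex_add, ex_const, ex_mul, h2]
      linarith

end scoresec

section explsec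
open Classical
variable {X : Type*} [DecidableEq X]

lemma expl {J : Sym2 X → ℝ} (hJ : ∀ e, 0 ≤ J e) {β : ℝ} (hβ : 0 < β) {W : Finset X} {x : X} (n : ℕ) {κ : ℝ}
    (hκ : ∀ v ∈ W, ∀ F ⊆ W.sym2, (∀ e ∈ F, v ∈ e) → ∑ e ∈ F, J e / β ≤ κ) :
    ∀ (k : ℕ) (F O : Finset (Sym2 X)) (D : Finset X), D.card + k = n → F ⊆ W.sym2 → D ⊆ cl O W x →
      O ⊆ W.sym2 → (∀ e ∈ F, ∀ v ∈ D, v ∉ e) → ∃ Z : Finset (Sym2 X) → ℝ,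
        ex (pb J β) F (fun S => (min (cl (O ∪ S) W x).card n : ℕ) * Z S) =
          dR J β F (fun S => (min (cl (O ∪ S) W x).card n : ℕ)) ∧ ex (pb J β) F Z = 0 ∧
        ex (pb J β) F (fun S => Z S ^ 2) ≤
          κ * (ex (pb J β) F (fun S => (min (cl (O ∪ S) W x).card n : ℕ)) - D.card) := by
  have hconst : ∀ (F : Finset (Sym2 X)) (f : Finset (Sym2 X) → ℝ) (D : ℝ),
      (∀ S ⊆ F, f S = D) → ∃ Z : Finset (Sym2 X) → ℝ,
        ex (pb J β) F (fun S => f S * Z S) = dR J β F f ∧ ex (pb J β) F Z = 0 ∧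
        ex (pb J β) F (fun S => Z S ^ 2) ≤ κ * (ex (pb J β) F f - D) := by
    intro F f D h
    refine ⟨fun _ => 0, ?_, ex_const _ _ _, ?_⟩
    · simp only [mul_zero, ex_const]
      unfold dR
      symm
      refine sum_eq_zero fun e he => ?_
      rw [ex_congr (g := fun _ => 0) fun S hS => by rw [h S hS, h _ (Finset.insert_subset he hS), sub_self]]
      rw [ex_const, mul_zero]
    · rw [ex_congr (f := f) (g := fun _ => D) h]
      simp [ex_const]
  intro k
  induction k with
  | zero =>
    intro F O D hD hF hDO hO hFD
    refine hconst F _ _ fun S hS => ?_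
    have h1 := card_le_card (hDO.trans (cl_mono Finset.subset_union_left W x) : D ⊆ cl (O ∪ S) W x)
    congr 1; omega
  | succ k ih =>
    intro F O D hD hF hDO hO hFD
    by_cases hex : ∃ v ∈ cl O W x, v ∉ D
    · obtain ⟨v, hv, hvD⟩ := hex
      have hcD : (insert v D).card = D.card + 1 := Finset.card_insert_of_notMem hvD
      set F₁ := F.filter (fun e => v ∈ e) with hF1
      set F₂ := F \ F₁ with hF2
      have hF12 : Disjoint F₁ F₂ := Finset.disjoint_sdiff
      have hFu : F₁ ∪ F₂ = F := Finset.union_sdiff_of_subset (filter_subset _ _)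
      have h1s : F₁ ⊆ F := filter_subset _ _
      have h2s : F₂ ⊆ F := Finset.sdiff_subset
      obtain ⟨Z₁, z1, z2, z3⟩ := score hJ hβ F₁
      have IH : ∀ S₁ : Finset (Sym2 X), ∃ Z : Finset (Sym2 X) → ℝ, S₁ ⊆ F₁ →
        ex (pb J β) F₂ (fun S => (min (cl (O ∪ (S₁ ∪ S)) W x).card n : ℕ) * Z S) =
          dR J β F₂ (fun S => (min (cl (O ∪ (S₁ ∪ S)) W x).card n : ℕ)) ∧ ex (pb J β) F₂ Z = 0 ∧
        ex (pb J β) F₂ (fun S => Z S ^ 2) ≤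
          κ * (ex (pb J β) F₂ (fun S => (min (cl (O ∪ (S₁ ∪ S)) W x).card n : ℕ)) - (D.card + 1)) := by
        intro S₁
        by_cases hS₁ : S₁ ⊆ F₁
        · obtain ⟨Z, g⟩ := ih F₂ (O ∪ S₁) (insert v D) (by omega) (h2s.trans hF)
            (Finset.insert_subset (cl_mono Finset.subset_union_left W x hv)
              (hDO.trans (cl_mono Finset.subset_union_left W x)))
            (Finset.union_subset hO ((hS₁.trans h1s).trans hF)) (by
              intro e he u hu
              rcases Finset.mem_insert.1 hu with rfl | hu
              · intro hue
                exact (Finset.mem_sdiff.1 he).2 (Finset.mem_filter.2 ⟨h2s he, hue⟩)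
              · exact hFD e (h2s he) u hu)
          refine ⟨Z, fun _ => ?_⟩
          simp only [Finset.union_assoc, hcD, Nat.cast_add, Nat.cast_one] at g
          exact g
        · exact ⟨fun _ => 0, fun h => absurd h hS₁⟩
      choose Z₂ hZ₂ using IH
      have i1 : ∀ S₁ ⊆ F₁, ∀ S₂ ⊆ F₂, (S₁ ∪ S₂) ∩ F₁ = S₁ := by
        intro S₁ h1 S₂ h2
        rw [Finset.union_inter_distrib_right, Finset.inter_eq_left.2 h1,
          Finset.disjoint_iff_inter_eq_empty.1 (hF12.symm.mono_left h2), Finset.union_empty]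
      have i2 : ∀ S₁ ⊆ F₁, ∀ S₂ ⊆ F₂, (S₁ ∪ S₂) ∩ F₂ = S₂ := by
        intro S₁ h1 S₂ h2
        rw [Finset.union_inter_distrib_right, Finset.inter_eq_left.2 h2,
          Finset.disjoint_iff_inter_eq_empty.1 (hF12.mono_left h1), Finset.empty_union]
      have A : ∀ G : ℝ → Finset (Sym2 X) → ℝ, ex (pb J β) F (fun S => G (Z₁ (S ∩ F₁) + Z₂ (S ∩ F₁) (S ∩ F₂)) S) =
          ex (pb J β) F₁ (fun S₁ => ex (pb J β) F₂ (fun S₂ => G (Z₁ S₁ + Z₂ S₁ S₂) (S₁ ∪ S₂))) := by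
        intro G
        conv_lhs => rw [← hFu]
        rw [ex_union _ hF12]
        exact ex_congr fun S₁ h1 => ex_congr fun S₂ h2 => by rw [i1 S₁ h1 S₂ h2, i2 S₁ h1 S₂ h2]
      refine ⟨fun S => Z₁ (S ∩ F₁) + Z₂ (S ∩ F₁) (S ∩ F₂), ?_, ?_, ?_⟩
      · rw [A (fun z S => (min (cl (O ∪ S) W x).card n : ℕ) * z)]
        conv_rhs => rw [← hFu]
        rw [dR_union J β hF12, ← z1, ← ex_add]
        refine ex_congr fun S₁ h1 => ?_
        rw [← (hZ₂ S₁ h1).1, ← ex_mul', ← ex_add]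
        exact ex_congr fun S₂ _ => by ring
      · rw [A (fun z S => z), ← z2]
        refine ex_congr fun S₁ h1 => ?_
        rw [ex_add, ex_const, (hZ₂ S₁ h1).2.1, add_zero]
      · rw [A (fun z S => z ^ 2)]
        have hsq : ex (pb J β) F₁ (fun S₁ => ex (pb J β) F₂ (fun S₂ => (Z₁ S₁ + Z₂ S₁ S₂) ^ 2)) ≤
            ex (pb J β) F₁ (fun S₁ => Z₁ S₁ ^ 2 + κ * (ex (pb J β) F₂ (fun S =>
              (min (cl (O ∪ (S₁ ∪ S)) W x).card n : ℕ)) - (D.card + 1))) := by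
          refine ex_mono (pb_isP hJ hβ.le) fun S₁ h1 => ?_
          simp only [add_sq, ex_add, ex_const, ex_mul, (hZ₂ S₁ h1).2.1]
          linarith [(hZ₂ S₁ h1).2.2]
        refine hsq.trans ?_
        simp only [ex_add, ex_mul, ex_sub, ex_const]
        have h5 := hκ v (cl_sub _ _ _ hv) F₁ (h1s.trans hF) (fun e he => (Finset.mem_filter.1 he).2)
        have h6 := ex_union (pb J β) hF12 (fun S => ((min (cl (O ∪ S) W x).card n : ℕ) : ℝ))
        rw [hFu] at h6
        rw [h6]
        linarith
    · push Not at hex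
      have hDe : D = cl O W x := Finset.Subset.antisymm hDO hex
      refine hconst F _ _ fun S hS => ?_
      have : cl (O ∪ S) W x = D := by
        rw [hDe]
        refine Finset.Subset.antisymm (fun y hy => ?_) (cl_mono Finset.subset_union_left W x)
        obtain ⟨hyW, hc⟩ := mem_cl.1 hy
        refine mem_cl.2 ⟨hyW, ?_⟩
        clear hy hyW
        induction hc with
        | refl => exact cn_refl _ _
        | @tail b c hb hbc ih2 =>
          refine cn_trans ih2 (cn_edge ?_)
          rcases Finset.mem_union.1 hbc.2 with h | h
          · exact h
          · exfalso
            have hbW := (Finset.mk_mem_sym2_iff.1 (hF (hS h))).1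
            exact hFD _ (hS h) b (hex b (mem_cl.2 ⟨hbW, ih2⟩)) (Sym2.mem_mk_left _ _)
      rw [this]; congr 1; omega

noncomputable def Mn (J : Sym2 X → ℝ) (W : Finset X) (x : X) (n : ℕ) (β : ℝ) : ℝ :=
  ex (pb J β) W.sym2 (fun S => (min (cl S W x).card n : ℕ))

lemma Mn_nn {J : Sym2 X → ℝ} (hJ : ∀ e, 0 ≤ J e) {β : ℝ} (hβ : 0 ≤ β) (W : Finset X) (x : X) (n : ℕ) :
    0 ≤ Mn J W x n β := ex_nn (pb_isP hJ hβ) fun S _ => by positivity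

lemma Mn_deriv {J : Sym2 X → ℝ} (hJ : ∀ e, 0 ≤ J e) {β : ℝ} (hβ : 0 < β) {W : Finset X} {x : X} (n : ℕ) {κ : ℝ}
    (hκ0 : 0 ≤ κ) (hκ : ∀ v ∈ W, ∀ F ⊆ W.sym2, (∀ e ∈ F, v ∈ e) → ∑ e ∈ F, J e / β ≤ κ) :
    ∃ D, HasDerivAt (Mn J W x n) D β ∧ D ≤ √(n * κ) * Mn J W x n β := by
  refine ⟨_, russo J W.sym2 _ β, ?_⟩
  obtain ⟨Z, h1, h2, h3⟩ := expl hJ hβ n hκ n W.sym2 ∅ ∅ (by simp) (le_refl _) (by simp) (by simp) (by simp)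
  simp only [Finset.empty_union, Finset.card_empty, Nat.cast_zero, sub_zero] at h1 h3
  have hcs := ex_cs (pb_isP hJ hβ.le) W.sym2 (fun S => ((min (cl S W x).card n : ℕ) : ℝ)) Z
  rw [h1] at hcs
  have hA := Mn_nn hJ hβ.le W x n
  have hf2 : ex (pb J β) W.sym2 (fun S => ((min (cl S W x).card n : ℕ) : ℝ) ^ 2) ≤ n * Mn J W x n β := by
    unfold Mn
    rw [← ex_mul]
    refine ex_mono (pb_isP hJ hβ.le) fun S _ => ?_
    rw [sq]
    exact mul_le_mul_of_nonneg_right (by exact_mod_cast min_le_right _ _) (by positivity)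
  change _ ≤ κ * Mn J W x n β at h3
  have h4 : dR J β W.sym2 (fun S => ((min (cl S W x).card n : ℕ) : ℝ)) ^ 2 ≤ (√(n * κ) * Mn J W x n β) ^ 2 := by
    rw [mul_pow, Real.sq_sqrt (by positivity)]
    refine hcs.trans ((mul_le_mul hf2 h3 (ex_nn (pb_isP hJ hβ.le) fun S _ => sq_nonneg _) (by positivity)).trans
      (le_of_eq (by ring)))
  exact (abs_le_of_sq_le_sq' h4 (by positivity)).2

lemma Mn_growth {J : Sym2 X → ℝ} (hJ : ∀ e, 0 ≤ J e) {β₀ β₁ : ℝ} (hβ : 0 < β₀) (h01 : β₀ ≤ β₁)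
    {W : Finset X} {x : X} (n : ℕ) {κ : ℝ}
    (hκ0 : 0 ≤ κ) (hκ : ∀ v ∈ W, ∀ F ⊆ W.sym2, (∀ e ∈ F, v ∈ e) → ∑ e ∈ F, J e / β₀ ≤ κ) :
    Mn J W x n β₁ ≤ Real.exp (√(n * κ) * (β₁ - β₀)) * Mn J W x n β₀ := by
  have hd : ∀ β, β₀ ≤ β → ∃ D, HasDerivAt (Mn J W x n) D β ∧ D ≤ √(n * κ) * Mn J W x n β := by
    intro β hb
    refine Mn_deriv hJ (hβ.trans_le hb) n hκ0 fun v hv F hF hvF => (sum_le_sum fun e _ => ?_).trans (hκ v hv F hF hvF)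
    exact div_le_div_of_nonneg_left (hJ e) hβ hb
  have hanti : AntitoneOn (fun β => Real.exp (-(√(n * κ) * β)) * Mn J W x n β) (Set.Ici β₀) := by
    have hder : ∀ β, β₀ ≤ β → ∃ D, HasDerivAt (fun β => Real.exp (-(√(n * κ) * β)) * Mn J W x n β) D β ∧ D ≤ 0 := by
      intro β hb
      obtain ⟨D, h1, h2⟩ := hd β hb
      have h3 : HasDerivAt (fun β => -(√(n * κ) * β)) (-(√(n * κ) * 1)) β := ((hasDerivAt_id β).const_mul _).neg
      refine ⟨_, h3.exp.mul h1, ?_⟩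
      have := Real.exp_pos (-(√(n * κ) * β))
      nlinarith
    refine antitoneOn_of_deriv_nonpos (convex_Ici _) ?_ ?_ ?_
    · intro β hb
      obtain ⟨D, h1, h2⟩ := hder β hb
      exact h1.continuousAt.continuousWithinAt
    · intro β hb
      rw [interior_Ici] at hb
      obtain ⟨D, h1, h2⟩ := hder β hb.le
      exact h1.differentiableAt.differentiableWithinAt
    · intro β hb
      rw [interior_Ici] at hb
      obtain ⟨D, h1, h2⟩ := hder β hb.le
      rw [h1.deriv]; exact h2
  have h := hanti (Set.self_mem_Ici) (Set.mem_Ici.2 h01) h01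
  simp only at h
  have h7 := mul_le_mul_of_nonneg_left h (Real.exp_pos (√(n * κ) * β₁)).le
  rw [← mul_assoc, ← mul_assoc, ← Real.exp_add, ← Real.exp_add] at h7
  have e1 : √(n * κ) * β₁ + -(√(n * κ) * β₁) = 0 := by ring
  have e2 : √(n * κ) * β₁ + -(√(n * κ) * β₀) = √(n * κ) * (β₁ - β₀) := by ring
  rw [e1, e2, Real.exp_zero, one_mul] at h7
  exact h7

end explsec

section trans
variable {X : Type*} [DecidableEq X]

lemma cn_map {Y : Type*} [DecidableEq Y] (φ : X ↪ Y) {S : Finset (Sym2 X)} {x y : X} (h : cn S x y) :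
    cn (S.map φ.sym2Map) (φ x) (φ y) := by
  induction h with
  | refl => exact cn_refl _ _
  | tail _ hbc ih =>
    refine cn_trans ih (cn_edge ?_)
    rw [Finset.mem_map]
    exact ⟨_, hbc.2, rfl⟩

lemma sym2_map_eq {Y : Type*} [DecidableEq Y] (φ : X ↪ Y) (W : Finset X) :
    (W.map φ).sym2 = W.sym2.map φ.sym2Map := by
  ext e
  induction e using Sym2.ind with
  | _ a b =>
    simp only [mk_mem_sym2_iff, Finset.mem_map]
    constructor
    · rintro ⟨⟨a', ha, rfl⟩, ⟨b', hb, rfl⟩⟩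
      exact ⟨s(a', b'), Finset.mk_mem_sym2_iff.2 ⟨ha, hb⟩, rfl⟩
    · rintro ⟨e, he, h⟩
      have h2 := Finset.mem_sym2_iff.1 he
      constructor
      · have : a ∈ φ.sym2Map e := by rw [h]; exact Sym2.mem_mk_left _ _
        obtain ⟨c, hc, rfl⟩ := Sym2.mem_map.1 this
        exact ⟨c, h2 c hc, rfl⟩
      · have : b ∈ φ.sym2Map e := by rw [h]; exact Sym2.mem_mk_right _ _
        obtain ⟨c, hc, rfl⟩ := Sym2.mem_map.1 this
        exact ⟨c, h2 c hc, rfl⟩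

lemma cn_map_iff (φ : X ≃ X) {S : Finset (Sym2 X)} {x y : X} :
    cn (S.map φ.toEmbedding.sym2Map) (φ x) (φ y) ↔ cn S x y := by
  refine ⟨fun h => ?_, fun h => cn_map φ.toEmbedding h⟩
  have h2 := cn_map φ.symm.toEmbedding h
  simp only [Equiv.coe_toEmbedding, Equiv.symm_apply_apply] at h2
  refine cn_mono (fun e he => ?_) h2
  rw [Finset.mem_map] at he
  obtain ⟨e', he', rfl⟩ := he
  rw [Finset.mem_map] at he'
  obtain ⟨e'', he'', rfl⟩ := he'
  convert he''
  change Sym2.map φ.symm (Sym2.map φ e'') = e''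
  rw [Sym2.map_map]; simp

lemma ex_shift (φ : X ≃ X) {p : Sym2 X → ℝ} (hp : ∀ e, p (Sym2.map φ e) = p e) (W : Finset X)
    (f : Finset (Sym2 X) → ℝ) : ex p (W.map φ.toEmbedding).sym2 f =
      ex p W.sym2 (fun S => f (S.map φ.toEmbedding.sym2Map)) := by
  rw [sym2_map_eq, ex_map]
  have : (fun e => p (φ.toEmbedding.sym2Map e)) = p := funext fun e => hp e
  rw [this]

lemma ta_shift (φ : X ≃ X) {p : Sym2 X → ℝ} (hp : ∀ e, p (Sym2.map φ e) = p e) (W : Finset X)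
    (x y : X) : ta p (W.map φ.toEmbedding) (φ x) (φ y) = ta p W x y := by
  unfold ta Pr
  rw [ex_shift φ hp]
  congr 1; funext S
  exact ind_congr (cn_map_iff φ)
end trans

section kernel
variable {d : ℕ} {J : V d → V d → ℝ} {α c C : ℝ}

noncomputable def Jt (J : V d → V d → ℝ) : Sym2 (V d) → ℝ :=
  Sym2.lift ⟨fun x y => (J x y + J y x) / 2, fun x y => by dsimp only; rw [add_comm]⟩

lemma Jt_mk (hJ : KernelHyp d J α c C) (x y : V d) : Jt J s(x, y) = J x y := by
  show (J x y + J y x) / 2 = J x y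
  rw [hJ.symm y x]; ring

lemma Jt_nn (hJ : KernelHyp d J α c C) (e : Sym2 (V d)) : 0 ≤ Jt J e := by
  induction e using Sym2.ind with
  | _ a b => rw [Jt_mk hJ]; exact hJ.nonneg a b

def sh (z : V d) : V d ≃ V d := Equiv.addRight z
@[simp] lemma sh_apply (z x : V d) : sh z x = x + z := rfl

lemma Jt_shift (hJ : KernelHyp d J α c C) (z : V d) (e : Sym2 (V d)) : Jt J (Sym2.map (sh z) e) = Jt J e := by
  induction e using Sym2.ind with
  | _ a b => rw [Sym2.map_mk, Jt_mk hJ, Jt_mk hJ]; exact hJ.transInv a b z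

noncomputable def pp (J : V d → V d → ℝ) (β : ℝ) : Sym2 (V d) → ℝ := pb (Jt J) β

lemma pp_isP (hJ : KernelHyp d J α c C) {β : ℝ} (hβ : 0 ≤ β) : IsP (pp J β) := pb_isP (Jt_nn hJ) hβ

lemma pp_le (hJ : KernelHyp d J α c C) {β : ℝ} (x y : V d) : pp J β s(x, y) ≤ β * J x y := by
  rw [← Jt_mk hJ]; exact pb_le _

lemma pp_shift (hJ : KernelHyp d J α c C) (β : ℝ) (z : V d) (e : Sym2 (V d)) :
    pp J β (Sym2.map (sh z) e) = pp J β e := by unfold pp pb; rw [Jt_shift hJ]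

noncomputable def tau (J : V d → V d → ℝ) (β : ℝ) (W : Finset (V d)) (x y : V d) : ℝ := ta (pp J β) W x y

def shS (z : V d) (W : Finset (V d)) : Finset (V d) := W.map (sh z).toEmbedding

@[simp] lemma mem_shS {z x : V d} {W : Finset (V d)} : x ∈ shS z W ↔ x - z ∈ W := by
  unfold shS
  rw [Finset.mem_map_equiv]
  show x + -z ∈ W ↔ _
  rw [sub_eq_add_neg]

lemma sum_shS (z : V d) (W : Finset (V d)) (f : V d → ℝ) : ∑ x ∈ shS z W, f x = ∑ x ∈ W, f (x + z) := by
  unfold shS; rw [Finset.sum_map]; rfl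

lemma card_shS (z : V d) (W : Finset (V d)) : (shS z W).card = W.card := Finset.card_map _

lemma tau_shift (hJ : KernelHyp d J α c C) (β : ℝ) (z : V d) (W : Finset (V d)) (x y : V d) :
    tau J β (shS z W) (x + z) (y + z) = tau J β W x y :=
  ta_shift (sh z) (pp_shift hJ β z) W x y

lemma tau_nn (hJ : KernelHyp d J α c C) {β : ℝ} (hβ : 0 ≤ β) (W : Finset (V d)) (x y : V d) :
    0 ≤ tau J β W x y := ta_nn (pp_isP hJ hβ) W x y
lemma tau_le1 (hJ : KernelHyp d J α c C) {β : ℝ} (hβ : 0 ≤ β) (W : Finset (V d)) (x y : V d) :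
    tau J β W x y ≤ 1 := ta_le1 (pp_isP hJ hβ) W x y
lemma tau_mono (hJ : KernelHyp d J α c C) {β : ℝ} (hβ : 0 ≤ β) {W W' : Finset (V d)} (h : W ⊆ W') (x y : V d) :
    tau J β W x y ≤ tau J β W' x y := ta_mono (pp_isP hJ hβ) h x y
lemma tau_beta (hJ : KernelHyp d J α c C) {β β' : ℝ} (hβ : 0 ≤ β) (h : β ≤ β') (W : Finset (V d)) (x y : V d) :
    tau J β W x y ≤ tau J β' W x y :=
  ex_mono_beta (Jt_nn hJ) _ (fun _ _ h => ind_mono (cn_mono h)) hβ h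
lemma tau_comm (β : ℝ) (W : Finset (V d)) (x y : V d) : tau J β W x y = tau J β W y x := ta_comm W x y
lemma tau_self (β : ℝ) (W : Finset (V d)) (x : V d) : tau J β W x x = 1 := ta_self W x
lemma tau_zero (β : ℝ) (W : Finset (V d)) {x y : V d} (hy : y ∈ W) (hx : x ∉ W) : tau J β W x y = 0 :=
  ta_zero W hy hx

noncomputable def Jtot (J : V d → V d → ℝ) : ℝ := ∑' x, J 0 x

lemma Jtot_nn (hJ : KernelHyp d J α c C) : 0 ≤ Jtot J := tsum_nonneg fun x => hJ.nonneg 0 x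

lemma row_sum (hJ : KernelHyp d J α c C) (a : V d) (W : Finset (V d)) : ∑ b ∈ W, J a b ≤ Jtot J := by
  have h1 : ∀ b ∈ W, J a b = J 0 (b + -a) := fun b _ => by
    rw [← hJ.transInv a b (-a)]; simp
  rw [sum_congr rfl h1, ← sum_shS (-a) W (fun x => J 0 x)]
  exact hJ.integrable.sum_le_tsum _ fun x _ => hJ.nonneg 0 x

def Bdd (J : V d → V d → ℝ) (β M : ℝ) : Prop := ∀ W x, ∑ u ∈ W, tau J β W x u ≤ M

lemma Bdd_beta (hJ : KernelHyp d J α c C) {β β' M : ℝ} (hβ : 0 ≤ β) (h : β ≤ β') (hB : Bdd J β' M) : Bdd J β M :=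
  fun W x => (sum_le_sum fun u _ => tau_beta hJ hβ h W x u).trans (hB W x)

theorem PHI (hJ : KernelHyp d J α c C) {β γ : ℝ} (hβ : 0 ≤ β) (hγ : γ < 1) (U : Finset (V d)) (h0 : 0 ∈ U)
    (h : ∀ W : Finset (V d), ∑ a ∈ U, ∑ b ∈ W \ U, tau J β U 0 a * (β * J a b) ≤ γ) :
    Bdd J β (U.card / (1 - γ)) := by
  intro W x'
  have hg : 0 < 1 - γ := by linarith
  set F : V d → ℝ := fun x => ∑ u ∈ W, tau J β W x u with hF
  have hFn : ∀ x, 0 ≤ F x := fun x => sum_nonneg fun u _ => tau_nn hJ hβ _ _ _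
  by_cases hx' : x' ∈ W
  swap
  · rw [sum_eq_zero fun u hu => tau_zero β W hu hx']; positivity
  obtain ⟨x, hx, hmax⟩ := Finset.exists_max_image W F ⟨x', hx'⟩
  refine (hmax x' hx').trans ?_
  rw [le_div_iff₀ hg]
  have hxU : x ∈ shS x U := by simp [h0]
  suffices hs : F x ≤ U.card + γ * F x by linarith
  have h1 : F x ≤ ∑ u ∈ W, (tau J β (W ∩ shS x U) x u + ∑ a ∈ W ∩ shS x U, ∑ b ∈ W \ shS x U,
      tau J β (W ∩ shS x U) x a * pp J β s(a, b) * tau J β W b u) :=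
    sum_le_sum fun u _ => SL_in (pp_isP hJ hβ) W (shS x U) hxU
  refine h1.trans ?_
  rw [sum_add_distrib]
  refine add_le_add ?_ ?_
  · rw [← Finset.sum_inter_add_sum_sdiff W (shS x U), sum_eq_zero (s := W \ shS x U), add_zero]
    · refine (sum_le_sum fun u _ => tau_le1 hJ hβ _ _ _).trans ?_
      rw [sum_const, nsmul_eq_mul, mul_one, ← card_shS x U]
      exact_mod_cast card_le_card Finset.inter_subset_right
    · intro u hu
      rw [tau_comm]
      exact tau_zero β _ (by simp [hx, h0]) (by simp at hu ⊢; tauto)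
  · have h2 : ∑ u ∈ W, ∑ a ∈ W ∩ shS x U, ∑ b ∈ W \ shS x U,
        tau J β (W ∩ shS x U) x a * pp J β s(a, b) * tau J β W b u =
        ∑ a ∈ W ∩ shS x U, ∑ b ∈ W \ shS x U, tau J β (W ∩ shS x U) x a * pp J β s(a, b) * F b := by
      rw [sum_comm]
      refine sum_congr rfl fun a _ => ?_
      rw [sum_comm]
      refine sum_congr rfl fun b _ => ?_
      rw [hF, mul_sum]
    rw [h2]
    have h3 : ∑ a ∈ W ∩ shS x U, ∑ b ∈ W \ shS x U, tau J β (W ∩ shS x U) x a * pp J β s(a, b) * F b ≤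
        ∑ a ∈ shS x U, ∑ b ∈ W \ shS x U, tau J β (shS x U) x a * (β * J a b) * F x := by
      refine (sum_le_sum_of_subset_of_nonneg Finset.inter_subset_right fun a _ _ =>
        sum_nonneg fun b _ => mul_nonneg (mul_nonneg (tau_nn hJ hβ _ _ _) (pp_isP hJ hβ _).1) (hFn b)).trans ?_
      refine sum_le_sum fun a _ => sum_le_sum fun b hb => ?_
      refine mul_le_mul (mul_le_mul (tau_mono hJ hβ Finset.inter_subset_right _ _) (pp_le hJ _ _)
        (pp_isP hJ hβ _).1 (tau_nn hJ hβ _ _ _)) (hmax b (Finset.mem_sdiff.1 hb).1) (hFn b) ?_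
      exact mul_nonneg (tau_nn hJ hβ _ _ _) (mul_nonneg hβ (hJ.nonneg _ _))
    refine h3.trans ?_
    simp only [← sum_mul]
    refine mul_le_mul_of_nonneg_right ?_ (hFn x)
    refine le_trans (le_of_eq ?_) (h (shS (-x) W))
    rw [sum_shS]
    refine sum_congr rfl fun a _ => ?_
    have h4 : W \ shS x U = shS x (shS (-x) W \ U) := by
      ext b; simp
    rw [h4, sum_shS]
    refine sum_congr rfl fun b _ => ?_
    rw [hJ.transInv]
    congr 1
    have := tau_shift hJ β x U 0 a
    rwa [zero_add] at this

lemma bdd_small (hJ : KernelHyp d J α c C) {β : ℝ} (hβ : 0 ≤ β) (h : β * Jtot J < 1) : ∃ M, Bdd J β M := by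
  refine ⟨_, PHI hJ hβ h {0} (by simp) fun W => ?_⟩
  rw [Finset.sum_singleton]
  simp only [tau_self, one_mul, ← mul_sum]
  exact mul_le_mul_of_nonneg_left (row_sum hJ 0 _) hβ

end kernel

section lattice
variable {d : ℕ}

lemma normInf_le {x : V d} {k : ℕ} : normInf x ≤ k ↔ ∀ i, (x i).natAbs ≤ k := by
  unfold normInf; simp [Finset.sup_le_iff]

def di (x y : V d) : ℕ := normInf (x - y)

lemma di_le {x y : V d} {k : ℕ} : di x y ≤ k ↔ ∀ i, (x i - y i).natAbs ≤ k := by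
  unfold di; rw [normInf_le]; simp

lemma di_comm (x y : V d) : di x y = di y x := by
  apply le_antisymm <;> rw [di_le] <;> intro i
  · have := di_le.1 (le_refl (di y x)) i; omega
  · have := di_le.1 (le_refl (di x y)) i; omega

lemma di_tri (x y z : V d) : di x z ≤ di x y + di y z := by
  rw [di_le]; intro i
  have h1 := di_le.1 (le_refl (di x y)) i
  have h2 := di_le.1 (le_refl (di y z)) i
  omega

lemma di_self (x : V d) : di x x = 0 := by
  apply Nat.eq_zero_of_le_zero; rw [di_le]; simp

lemma di_pos {x y : V d} (h : x ≠ y) : 1 ≤ di x y := by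
  by_contra hc
  apply h; funext i
  have := di_le.1 (show di x y ≤ 0 by omega) i
  omega

lemma di_shift (x y z : V d) : di (x + z) (y + z) = di x y := by unfold di; simp

noncomputable def bx (x : V d) (r : ℕ) : Finset (V d) := Fintype.piFinset fun i => Finset.Icc (x i - r) (x i + r)

lemma mem_bx {x v : V d} {r : ℕ} : v ∈ bx x r ↔ di x v ≤ r := by
  unfold bx; rw [Fintype.mem_piFinset, di_le]
  refine forall_congr' fun i => ?_
  rw [Finset.mem_Icc]; omega

lemma bx_self (x : V d) (r : ℕ) : x ∈ bx x r := by rw [mem_bx, di_self]; omega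

lemma bx_card (x : V d) (r : ℕ) : (bx x r).card = (2 * r + 1) ^ d := by
  unfold bx; rw [Fintype.card_piFinset]
  simp only [Int.card_Icc]
  rw [Finset.prod_congr rfl (g := fun _ => 2 * r + 1) (fun i _ => by omega)]
  simp

lemma bx_mono {x : V d} {r s : ℕ} (h : r ≤ s) : bx x r ⊆ bx x s := fun v hv => by
  rw [mem_bx] at *; omega

lemma shell_card (hd : d = 1 ∨ d = 2) (x : V d) (W : Finset (V d)) {k : ℕ} (hk : 1 ≤ k) :
    ((W.filter fun v => di x v = k).card : ℝ) ≤ 8 * (k : ℝ) ^ ((d : ℝ) - 1) := by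
  have h1 : (W.filter fun v => di x v = k) ⊆ bx x k \ bx x (k - 1) := fun v hv => by
    rw [mem_filter] at hv
    rw [mem_sdiff, mem_bx, mem_bx]; omega
  have h2 := card_le_card h1
  rw [Finset.card_sdiff_of_subset (bx_mono (by omega)), bx_card, bx_card] at h2
  obtain ⟨k, rfl⟩ := Nat.exists_eq_add_of_le hk
  rcases hd with rfl | rfl
  · have h3 : (W.filter fun v => di x v = 1 + k).card ≤ 2 := by
      refine h2.trans ?_; simp; omega
    have : ((W.filter fun v => di x v = 1 + k).card : ℝ) ≤ 2 := by exact_mod_cast h3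
    norm_num; linarith
  · have h3 : (W.filter fun v => di x v = 1 + k).card ≤ 8 * (1 + k) := by
      refine h2.trans ?_
      rw [Nat.sub_le_iff_le_add]
      have : 1 + k - 1 = k := by omega
      rw [this]; nlinarith
    have : ((W.filter fun v => di x v = 1 + k).card : ℝ) ≤ 8 * ((1 + k : ℕ) : ℝ) := by exact_mod_cast h3
    norm_num at this ⊢; linarith

lemma shell_sum (hd : d = 1 ∨ d = 2) (x : V d) (W : Finset (V d)) (I : Finset ℕ) (hI : ∀ k ∈ I, 1 ≤ k)
    (hW : ∀ v ∈ W, di x v ∈ I) {f : ℕ → ℝ} (hf : ∀ k, 0 ≤ f k) :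
    ∑ v ∈ W, f (di x v) ≤ 8 * ∑ k ∈ I, (k : ℝ) ^ ((d : ℝ) - 1) * f k := by
  rw [← Finset.sum_fiberwise_of_maps_to hW, mul_sum]
  refine sum_le_sum fun k hk => ?_
  rw [sum_congr rfl (g := fun _ => f k) (fun v hv => by rw [(Finset.mem_filter.1 hv).2])]
  rw [sum_const, nsmul_eq_mul, ← mul_assoc]
  exact mul_le_mul_of_nonneg_right (shell_card hd x W (hI k hk)) (hf k)

noncomputable def br (x y : V d) : ℝ := max 1 (di x y : ℝ)

lemma br_ge1 (x y : V d) : 1 ≤ br x y := le_max_left _ _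
lemma br_pos (x y : V d) : 0 < br x y := lt_of_lt_of_le one_pos (br_ge1 x y)
lemma br_comm (x y : V d) : br x y = br y x := by unfold br; rw [di_comm]
lemma br_tri (x y z : V d) : br x z ≤ br x y + br y z := by
  have h := di_tri x y z
  have h' : (di x z : ℝ) ≤ di x y + di y z := by exact_mod_cast h
  unfold br
  refine max_le ?_ ?_
  · linarith [le_max_left (1:ℝ) (di x y), le_max_left (1:ℝ) (di y z)]
  · linarith [le_max_right (1:ℝ) (di x y), le_max_right (1:ℝ) (di y z)]
lemma br_ne {x y : V d} (h : x ≠ y) : br x y = di x y := by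
  unfold br; rw [max_eq_right]; exact_mod_cast di_pos h
lemma br_shift (x y z : V d) : br (x + z) (y + z) = br x y := by unfold br; rw [di_shift]
lemma br_rpow (x y : V d) (t : ℝ) : 0 < br x y ^ t := Real.rpow_pos_of_pos (br_pos x y) t
lemma br_rpow_le1 (x y : V d) {t : ℝ} (ht : t ≤ 0) : br x y ^ t ≤ 1 :=
  Real.rpow_le_one_of_one_le_of_nonpos (br_ge1 x y) ht

lemma J_le {J : V d → V d → ℝ} {α c C : ℝ} (hJ : KernelHyp d J α c C) {a b : V d} (h : a ≠ b) :
    J a b ≤ C * br a b ^ (-(d : ℝ) - α) := by rw [br_ne h]; exact hJ.upper a b h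
lemma J_ge {J : V d → V d → ℝ} {α c C : ℝ} (hJ : KernelHyp d J α c C) {a b : V d} (h : a ≠ b) :
    c * br a b ^ (-(d : ℝ) - α) ≤ J a b := by rw [br_ne h]; exact hJ.lower a b h

lemma step_up {s : ℝ} (hs : 0 < s) (hs1 : s ≤ 1) (k : ℕ) :
    ((k + 1 : ℕ) : ℝ) ^ (s - 1) ≤ (((k + 1 : ℕ) : ℝ) ^ s - (k : ℝ) ^ s) / s := by
  have hk : (0:ℝ) < k + 1 := by positivity
  rw [le_div_iff₀ hs]
  have h := rpow_one_add_le_one_add_mul_self (s := -1 / ((k:ℝ) + 1)) (p := s)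
    (by rw [neg_div, neg_le_neg_iff, div_le_one hk]; linarith [Nat.cast_nonneg (α := ℝ) k]) hs.le hs1
  have h2 : 1 + -1 / ((k:ℝ) + 1) = k / (k + 1) := by field_simp; ring
  rw [h2, Real.div_rpow (by positivity) hk.le, div_le_iff₀ (by positivity)] at h
  have h3 : ((k:ℝ) + 1) ^ s = ((k:ℝ) + 1) ^ (s - 1) * (k + 1) := by
    rw [← Real.rpow_add_one hk.ne']; congr 1; ring
  have h4 : (1 + s * (-1 / ((k:ℝ) + 1))) * ((k:ℝ) + 1) ^ s = ((k:ℝ) + 1) ^ s - s * ((k:ℝ) + 1) ^ (s - 1) := by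
    rw [h3]; field_simp; ring
  rw [h4] at h
  push_cast; linarith

lemma sum_up {s : ℝ} (hs : 0 < s) (hs1 : s ≤ 1) (r : ℕ) :
    ∑ k ∈ Finset.Icc 1 r, (k : ℝ) ^ (s - 1) ≤ (r : ℝ) ^ s / s := by
  induction r with
  | zero => simp [hs.ne']
  | succ n ih =>
    rw [Finset.sum_Icc_succ_top (by omega)]
    have := step_up hs hs1 n
    rw [sub_div] at this; linarith

lemma step_dn {s : ℝ} (hs : 0 < s) {k : ℕ} (hk : 1 ≤ k) :
    ((k + 1 : ℕ) : ℝ) ^ (-1 - s) ≤ ((k : ℝ) ^ (-s) - ((k + 1 : ℕ) : ℝ) ^ (-s)) / s := by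
  have hk0 : (0:ℝ) < k := by exact_mod_cast hk
  have hk1 : (0:ℝ) < k + 1 := by positivity
  rw [le_div_iff₀ hs]
  push_cast
  have h1 : (1:ℝ) + s / (k + 1) ≤ ((k:ℝ) / (k + 1)) ^ (-s) := by
    have hx : 0 < (k:ℝ) / (k + 1) := by positivity
    rw [Real.rpow_def_of_pos hx]
    have h2 := Real.log_le_sub_one_of_pos hx
    have h3 : (k:ℝ) / (k + 1) - 1 = - (1 / (k + 1)) := by field_simp; ring
    have h4 := Real.add_one_le_exp (Real.log ((k:ℝ) / (k + 1)) * -s)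
    have h5 : s / (k + 1) ≤ Real.log ((k:ℝ) / (k + 1)) * -s := by
      rw [h3] at h2
      have := mul_le_mul_of_nonneg_right h2 hs.le
      have h6 : s / (k + 1) = 1 / ((k:ℝ) + 1) * s := by ring
      rw [h6]; linarith
    linarith
  rw [Real.div_rpow hk0.le hk1.le, le_div_iff₀ (by positivity)] at h1
  have h3 : ((k:ℝ) + 1) ^ (-s) = ((k:ℝ) + 1) ^ (-1 - s) * (k + 1) := by
    rw [← Real.rpow_add_one hk1.ne']; congr 1; ring
  have h4 : (1 + s / ((k:ℝ) + 1)) * ((k:ℝ) + 1) ^ (-s) = ((k:ℝ) + 1) ^ (-s) + s * ((k:ℝ) + 1) ^ (-1 - s) := by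
    rw [h3]; field_simp
  rw [h4] at h1; linarith

lemma sum_dn {s : ℝ} (hs : 0 < s) {r : ℕ} (hr : 1 ≤ r) (n : ℕ) :
    ∑ k ∈ Finset.Ioc r (r + n), (k : ℝ) ^ (-1 - s) ≤ ((r : ℝ) ^ (-s) - ((r + n : ℕ) : ℝ) ^ (-s)) / s := by
  induction n with
  | zero => simp
  | succ n ih =>
    rw [← add_assoc, Finset.sum_Ioc_succ_top (by omega)]
    have := step_dn hs (k := r + n) (by omega)
    rw [sub_div] at *; linarith

lemma lat1 (hd : d = 1 ∨ d = 2) {s : ℝ} (hs : 0 < s) (hs1 : s ≤ 1) (x : V d) {r : ℕ} (hr : 1 ≤ r)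
    (W : Finset (V d)) (hW : ∀ v ∈ W, di x v ≤ r) :
    ∑ v ∈ W, br x v ^ (s - d) ≤ 9 / s * (r : ℝ) ^ s := by
  have hr1 : (1:ℝ) ≤ (r:ℝ) ^ s := Real.one_le_rpow (by exact_mod_cast hr) hs.le
  rw [← sum_filter_add_sum_filter_not W (fun v => x = v)]
  have h1 : ∑ v ∈ W with x = v, br x v ^ (s - d) ≤ 1 / s * (r:ℝ) ^ s := by
    calc ∑ v ∈ W with x = v, br x v ^ (s - d) ≤ ∑ v ∈ {x}, br x v ^ (s - d) :=
          sum_le_sum_of_subset_of_nonneg (fun v hv => by simp at hv ⊢; exact hv.2.symm)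
            (fun v _ _ => (br_rpow x v _).le)
      _ = 1 := by simp [br, di_self]
      _ ≤ 1 / s * (r:ℝ) ^ s := by
        have : 1 ≤ 1 / s := by rw [le_div_iff₀ hs]; linarith
        nlinarith
  have h2 : ∑ v ∈ W with ¬ x = v, br x v ^ (s - d) ≤ 8 / s * (r:ℝ) ^ s := by
    rw [sum_congr rfl (g := fun v => (fun k : ℕ => (k:ℝ) ^ (s - d)) (di x v))
      (fun v hv => by rw [br_ne (Finset.mem_filter.1 hv).2])]
    refine (shell_sum hd x _ (Finset.Icc 1 r) (fun k hk => (Finset.mem_Icc.1 hk).1) (fun v hv => ?_)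
      (f := fun k : ℕ => (k:ℝ) ^ (s - d)) (fun k => by positivity)).trans ?_
    · rw [mem_filter] at hv
      exact Finset.mem_Icc.2 ⟨di_pos hv.2, hW v hv.1⟩
    · rw [sum_congr rfl (g := fun k : ℕ => (k:ℝ) ^ (s - 1)) (fun k hk => ?_)]
      · have := sum_up hs hs1 r
        calc 8 * ∑ k ∈ Finset.Icc 1 r, (k : ℝ) ^ (s - 1) ≤ 8 * ((r : ℝ) ^ s / s) := by linarith
          _ = _ := by ring
      · have : (0:ℝ) < k := by exact_mod_cast (Finset.mem_Icc.1 hk).1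
        rw [← Real.rpow_add this]; congr 1; ring
  calc _ ≤ 1 / s * (r:ℝ) ^ s + 8 / s * (r:ℝ) ^ s := add_le_add h1 h2
    _ = _ := by ring

lemma lat2 (hd : d = 1 ∨ d = 2) {s : ℝ} (hs : 0 < s) (x : V d) {r : ℕ} (hr : 1 ≤ r)
    (W : Finset (V d)) (hW : ∀ v ∈ W, r < di x v) :
    ∑ v ∈ W, br x v ^ (-(d:ℝ) - s) ≤ 8 / s * (r : ℝ) ^ (-s) := by
  rw [sum_congr rfl (g := fun v => (fun k : ℕ => (k:ℝ) ^ (-(d:ℝ) - s)) (di x v))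
      (fun v hv => by rw [br_ne]; rintro rfl; have := hW _ hv; rw [di_self] at this; omega)]
  refine (shell_sum hd x _ (Finset.Ioc r (r + W.sup (di x))) (fun k hk => by rw [Finset.mem_Ioc] at hk; omega)
    (fun v hv => ?_) (f := fun k : ℕ => (k:ℝ) ^ (-(d:ℝ) - s)) (fun k => by positivity)).trans ?_
  · have := Finset.le_sup (f := di x) hv
    have := hW v hv
    rw [Finset.mem_Ioc]; omega
  · rw [sum_congr rfl (g := fun k : ℕ => (k:ℝ) ^ (-1 - s)) (fun k hk => ?_)]
    · have h1 := sum_dn hs hr (W.sup (di x))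
      have h2 : (0:ℝ) ≤ ((r + W.sup (di x) : ℕ) : ℝ) ^ (-s) := by positivity
      calc _ ≤ 8 * (((r : ℝ) ^ (-s) - ((r + W.sup (di x) : ℕ) : ℝ) ^ (-s)) / s) := by linarith
        _ ≤ 8 * ((r : ℝ) ^ (-s) / s) := by gcongr; linarith
        _ = _ := by ring
    · have : (0:ℝ) < k := by rw [Finset.mem_Ioc] at hk; exact_mod_cast (by omega : 0 < k)
      rw [← Real.rpow_add this]; congr 1; ring

lemma lat3 (hd : d = 1 ∨ d = 2) (x : V d) {r : ℕ} (hr : 1 ≤ r)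
    (W : Finset (V d)) (hW : ∀ v ∈ W, di x v ≤ r) :
    ∑ v ∈ W, br x v ^ (-(d:ℝ)) ≤ 9 * (1 + Real.log r) := by
  have hl : 0 ≤ Real.log r := Real.log_nonneg (by exact_mod_cast hr)
  rw [← sum_filter_add_sum_filter_not W (fun v => x = v)]
  have h1 : ∑ v ∈ W with x = v, br x v ^ (-(d:ℝ)) ≤ 1 := by
    calc ∑ v ∈ W with x = v, br x v ^ (-(d:ℝ)) ≤ ∑ v ∈ {x}, br x v ^ (-(d:ℝ)) :=
          sum_le_sum_of_subset_of_nonneg (fun v hv => by simp at hv ⊢; exact hv.2.symm)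
            (fun v _ _ => (br_rpow x v _).le)
      _ = 1 := by simp [br, di_self]
  have h2 : ∑ v ∈ W with ¬ x = v, br x v ^ (-(d:ℝ)) ≤ 8 * (1 + Real.log r) := by
    rw [sum_congr rfl (g := fun v => (fun k : ℕ => (k:ℝ) ^ (-(d:ℝ))) (di x v))
      (fun v hv => by rw [br_ne (Finset.mem_filter.1 hv).2])]
    refine (shell_sum hd x _ (Finset.Icc 1 r) (fun k hk => (Finset.mem_Icc.1 hk).1) (fun v hv => ?_)
      (f := fun k : ℕ => (k:ℝ) ^ (-(d:ℝ))) (fun k => by positivity)).trans ?_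
    · rw [mem_filter] at hv
      exact Finset.mem_Icc.2 ⟨di_pos hv.2, hW v hv.1⟩
    · rw [sum_congr rfl (g := fun k : ℕ => ((k:ℝ))⁻¹) (fun k hk => ?_)]
      · have h := harmonic_le_one_add_log r
        rw [harmonic_eq_sum_Icc] at h
        push_cast at h
        linarith
      · have : (0:ℝ) < k := by exact_mod_cast (Finset.mem_Icc.1 hk).1
        rw [← Real.rpow_add this, ← Real.rpow_neg_one]; congr 1; ring
  linarith

end lattice

section cut
open Classical
variable {X : Type*} [DecidableEq X]

lemma edge_pairs {W U : Finset X} (hU : U ⊆ W) {f : Sym2 X → ℝ} (hf : ∀ e, 0 ≤ f e) :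
    ∑ a ∈ U, ∑ b ∈ W \ U, f s(a, b) ≤ ∑ e ∈ W.sym2, f e := by
  rw [← Finset.sum_product' (f := fun a b => f s(a, b))]
  rw [← Finset.sum_image (s := U ×ˢ (W \ U)) (g := fun q : X × X => s(q.1, q.2)) (f := f)]
  · refine sum_le_sum_of_subset_of_nonneg (fun e he => ?_) fun e _ _ => hf e
    obtain ⟨q, hq, rfl⟩ := Finset.mem_image.1 he
    rw [mem_product, mem_sdiff] at hq
    exact Finset.mk_mem_sym2_iff.2 ⟨hU hq.1, hq.2.1⟩
  · rintro ⟨a, b⟩ hq ⟨a', b'⟩ hq' h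
    simp only [Finset.coe_product, Set.mem_prod, Finset.mem_coe, mem_sdiff] at hq hq'
    rcases Sym2.eq_iff.1 h with ⟨rfl, rfl⟩ | ⟨rfl, rfl⟩
    · rfl
    · exact absurd hq.1 hq'.2.2

noncomputable def nc (W T : Finset X) (S : Finset (Sym2 X)) : Finset X :=
  W.filter fun z => ∀ t ∈ T, ¬ cn S z t

lemma mem_nc {W T : Finset X} {S : Finset (Sym2 X)} {z : X} : z ∈ nc W T S ↔ z ∈ W ∧ ∀ t ∈ T, ¬ cn S z t := by
  simp [nc]

lemma cn_leave {S : Finset (Sym2 X)} {U : Finset X} {x y : X} (h : cn S x y) (hx : x ∈ U) (hy : y ∉ U) :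
    ∃ a b, a ∈ U ∧ b ∉ U ∧ s(a, b) ∈ S := by
  induction h with
  | refl => exact absurd hx hy
  | @tail b c _ hbc ih =>
    by_cases hb : b ∈ U
    · exact ⟨b, c, hb, hy, hbc.2⟩
    · exact ih hb

lemma cn_stay {S : Finset (Sym2 X)} {U : Finset X} {x y : X} (h : cn S x y) (hU : ∀ v, cn S x v → v ∈ U) :
    cn (S ∩ U.sym2) x y := by
  induction h with
  | refl => exact cn_refl _ _
  | @tail b c hb hbc ih =>
    refine cn_trans ih (cn_edge ?_)
    rw [Finset.mem_inter, mk_mem_sym2_iff]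
    exact ⟨hbc.2, hU b hb, hU c (cn_trans hb (cn_edge hbc.2))⟩

lemma cn_avoid {S : Finset (Sym2 X)} {U : Finset X} {x y : X} (h : cn S x y) (hU : ∀ v, cn S x v → v ∉ U) :
    cn (S \ U.sym2) x y := by
  induction h with
  | refl => exact cn_refl _ _
  | @tail b c hb hbc ih =>
    refine cn_trans ih (cn_edge ?_)
    rw [mem_sdiff, mk_mem_sym2_iff]
    exact ⟨hbc.2, fun h => hU b hb h.1⟩

lemma nc_iff {W T U : Finset X} (hT : T ⊆ W) {S : Finset (Sym2 X)} (hS : S ⊆ W.sym2) :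
    nc W T S = U ↔ nc W T (S \ U.sym2) = U := by
  have hsub : S \ U.sym2 ⊆ S := Finset.sdiff_subset
  constructor
  · rintro h
    ext z
    rw [mem_nc]
    constructor
    · rintro ⟨h1, h2⟩
      by_contra hz
      have h3 : ∃ t ∈ T, cn S z t := by
        by_contra hc; push Not at hc
        exact hz (h ▸ mem_nc.2 ⟨h1, hc⟩)
      obtain ⟨t, ht, h3⟩ := h3
      refine h2 t ht (cn_avoid h3 fun v hv hvU => ?_)
      rw [← h] at hvU
      exact (mem_nc.1 hvU).2 t ht (cn_trans (cn_symm hv) h3)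
    · intro hz
      rw [← h] at hz
      exact ⟨(mem_nc.1 hz).1, fun t ht hc => (mem_nc.1 hz).2 t ht (cn_mono hsub hc)⟩
  · intro h
    have hTU : ∀ t ∈ T, t ∉ U := fun t ht htU => by
      rw [← h] at htU; exact (mem_nc.1 htU).2 t ht (cn_refl _ _)
    ext z
    rw [mem_nc]
    constructor
    · rintro ⟨h1, h2⟩
      rw [← h, mem_nc]
      exact ⟨h1, fun t ht hc => h2 t ht (cn_mono hsub hc)⟩
    · intro hz
      refine ⟨(mem_nc.1 (h ▸ hz)).1, fun t ht hc => ?_⟩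
      obtain ⟨a, b, ha, hb, hab⟩ := cn_leave hc hz (hTU t ht)
      have hbW : b ∈ W := (Finset.mk_mem_sym2_iff.1 (hS hab)).2
      have h3 : ∃ t ∈ T, cn (S \ U.sym2) b t := by
        by_contra hc; push Not at hc
        exact hb (h ▸ mem_nc.2 ⟨hbW, hc⟩)
      obtain ⟨t', ht', h3⟩ := h3
      refine (mem_nc.1 (h ▸ ha)).2 t' ht' (cn_trans (cn_edge ?_) h3)
      rw [mem_sdiff, mk_mem_sym2_iff]
      exact ⟨hab, fun h => hb h.2⟩

lemma nc_prob (p : Sym2 X → ℝ) {W T U : Finset X} (hT : T ⊆ W) (hU : U ⊆ W) {x : X} (hx : x ∈ U) (a : X) :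
    Pr p W.sym2 (fun S => nc W T S = U ∧ cn S x a) = Pr p W.sym2 (fun S => nc W T S = U) * ta p U x a := by
  have hUs : U.sym2 ⊆ W.sym2 := sym2_mono hU
  have key : ∀ S ⊆ W.sym2, S ∩ (W.sym2 \ U.sym2) = S \ U.sym2 := fun S hS => by
    rw [← Finset.inter_sdiff_assoc, Finset.inter_eq_left.2 hS]
  have h1 : ex p W.sym2 (fun S => ind (cn (S ∩ U.sym2) x a) * ind (nc W T (S ∩ (W.sym2 \ U.sym2)) = U)) =
      ta p U x a * ex p (W.sym2 \ U.sym2) (fun S => ind (nc W T S = U)) :=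
    ex_indep p hUs Finset.sdiff_subset Finset.disjoint_sdiff (fun S => ind (cn S x a)) (fun S => ind (nc W T S = U))
  have h2 : ex p (W.sym2 \ U.sym2) (fun S => ind (nc W T S = U)) = Pr p W.sym2 (fun S => nc W T S = U) := by
    rw [← ex_inter p (E₁ := W.sym2 \ U.sym2) Finset.sdiff_subset]
    refine ex_congr fun S hS => ind_congr ?_
    rw [key S hS, ← nc_iff hT hS]
  rw [mul_comm, ← h2, ← h1]
  refine ex_congr fun S hS => ?_
  rw [← ind_and, key S hS, ← nc_iff hT hS]
  refine ind_congr ⟨fun h => ⟨cn_stay h.2 fun v hv => ?_, h.1⟩, fun h => ⟨h.2, cn_mono Finset.inter_subset_left h.1⟩⟩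
  rw [← h.1] at hx ⊢
  exact mem_nc.2 ⟨cn_mem hS hv (mem_nc.1 hx).1, fun t ht hc => (mem_nc.1 hx).2 t ht (cn_trans hv hc)⟩

lemma russo_lower {J : Sym2 X → ℝ} (hJ : ∀ e, 0 ≤ J e) {β q : ℝ} (hβ : 0 ≤ β) {W T : Finset X} (hT : T ⊆ W)
    {x : X} (hxW : x ∈ W)
    (h : ∀ U ⊆ W \ T, x ∈ U → q ≤ ∑ a ∈ U, ∑ b ∈ W \ U, ta (pb J β) U x a * J s(a, b)) :
    q * (1 - Pr (pb J β) W.sym2 (fun S => ∃ t ∈ T, cn S x t)) ≤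
      ∑ e ∈ W.sym2, J e * ex (pb J β) W.sym2 (fun S => ind (∃ t ∈ T, cn (insert e S) x t) - ind (∃ t ∈ T, cn S x t)) := by
  set p := pb J β
  have hp : IsP p := pb_isP hJ hβ
  set 𝒰 := (W \ T).powerset.filter (fun U => x ∈ U)

  have h1 : 1 - Pr p W.sym2 (fun S => ∃ t ∈ T, cn S x t) = ∑ U ∈ 𝒰, Pr p W.sym2 (fun S => nc W T S = U) := by
    unfold Pr
    rw [← ex_const p W.sym2 1, ← ex_sub, ← ex_sum]
    refine ex_congr fun S hS => ?_
    by_cases hA : ∃ t ∈ T, cn S x t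
    · rw [ind_t hA, sub_self, sum_eq_zero]
      intro U hU
      refine ind_f fun hc => ?_
      obtain ⟨t, ht, hct⟩ := hA
      have := (Finset.mem_filter.1 hU).2
      rw [← hc] at this
      exact (mem_nc.1 this).2 t ht hct
    · rw [ind_f hA, Finset.sum_eq_single (nc W T S)]
      · rw [ind_t rfl]; ring
      · intro U _ hU; exact ind_f fun hc => hU hc.symm
      · intro hn; exfalso; apply hn
        push Not at hA
        refine Finset.mem_filter.2 ⟨Finset.mem_powerset.2 fun z hz => ?_, mem_nc.2 ⟨hxW, hA⟩⟩
        exact Finset.mem_sdiff.2 ⟨(mem_nc.1 hz).1, fun hzT => (mem_nc.1 hz).2 z hzT (cn_refl _ _)⟩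
  rw [h1, mul_sum]
  have h2 : ∑ U ∈ 𝒰, q * Pr p W.sym2 (fun S => nc W T S = U) ≤
      ∑ U ∈ 𝒰, ∑ a ∈ U, ∑ b ∈ W \ U, J s(a, b) * Pr p W.sym2 (fun S => nc W T S = U ∧ cn S x a) := by
    refine sum_le_sum fun U hU => ?_
    obtain ⟨hU1, hU2⟩ := Finset.mem_filter.1 hU
    rw [mem_powerset] at hU1
    refine (mul_le_mul_of_nonneg_right (h U hU1 hU2) (Pr_nn hp)).trans (le_of_eq ?_)
    simp only [sum_mul]
    refine sum_congr rfl fun a _ => sum_congr rfl fun b _ => ?_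
    rw [nc_prob p hT (hU1.trans Finset.sdiff_subset) hU2]; ring
  refine h2.trans ?_
  simp only [Pr, ← ex_mul, ← ex_sum]
  refine ex_mono hp fun S hS => ?_
  have hnn : ∀ e, 0 ≤ ind (∃ t ∈ T, cn (insert e S) x t) - ind (∃ t ∈ T, cn S x t) := fun e =>
    sub_nonneg.2 (ind_mono fun ⟨t, ht, h⟩ => ⟨t, ht, cn_mono (Finset.subset_insert _ _) h⟩)
  by_cases hm : nc W T S ∈ 𝒰
  swap
  · rw [sum_eq_zero]
    · exact sum_nonneg fun e _ => mul_nonneg (hJ e) (hnn e)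
    · intro U hU
      refine sum_eq_zero fun a _ => sum_eq_zero fun b _ => ?_
      rw [ind_f, mul_zero]
      rintro ⟨h, -⟩; exact hm (h ▸ hU)
  rw [Finset.sum_eq_single_of_mem _ hm]
  swap
  · intro U hU hne
    refine sum_eq_zero fun a _ => sum_eq_zero fun b _ => ?_
    rw [ind_f, mul_zero]
    rintro ⟨h, -⟩; exact hne h.symm
  refine le_trans ?_ (edge_pairs (U := nc W T S) (fun z hz => (mem_nc.1 hz).1) (fun e => mul_nonneg (hJ e) (hnn e)))
  refine sum_le_sum fun a ha => sum_le_sum fun b hb => ?_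
  refine mul_le_mul_of_nonneg_left ?_ (hJ _)
  by_cases hc : cn S x a
  swap
  · rw [ind_f fun h => hc h.2]; exact hnn _
  have hx := (Finset.mem_filter.1 hm).2
  rw [ind_t ⟨rfl, hc⟩, ind_f (P := ∃ t ∈ T, cn S x t), ind_t, sub_zero]
  · rw [mem_sdiff, mem_nc] at hb
    push Not at hb
    obtain ⟨t, ht, hbt⟩ := hb.2 hb.1
    exact ⟨t, ht, cn_trans (cn_mono (Finset.subset_insert _ _) hc) (cn_trans (cn_edge (Finset.mem_insert_self _ _))
      (cn_mono (Finset.subset_insert _ _) hbt))⟩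
  · rintro ⟨t, ht, h⟩; exact (mem_nc.1 hx).2 t ht h
end cut

section m3
open Classical
variable {d : ℕ} {J : V d → V d → ℝ} {α c C : ℝ}

noncomputable def thF (J : V d → V d → ℝ) (W : Finset (V d)) (R : ℕ) (β : ℝ) : ℝ :=
  Pr (pp J β) W.sym2 (fun S => ∃ t ∈ W \ bx 0 R, cn S 0 t)

lemma thF_deriv (hJ : KernelHyp d J α c C) {β q : ℝ} (hβ : 0 ≤ β) {W : Finset (V d)} {R : ℕ}
    (hW : bx 0 R ⊆ W)
    (h : ∀ U ⊆ bx 0 R, 0 ∈ U → q ≤ ∑ a ∈ U, ∑ b ∈ W \ U, tau J β U 0 a * J a b) :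
    ∃ D, HasDerivAt (thF J W R) D β ∧ q * (1 - thF J W R β) ≤ D := by
  refine ⟨_, russo (Jt J) W.sym2 (fun S => ind (∃ t ∈ W \ bx 0 R, cn S 0 t)) β, ?_⟩
  refine russo_lower (Jt_nn hJ) hβ Finset.sdiff_subset (hW (bx_self 0 R)) fun U hU h0 => ?_
  rw [Finset.sdiff_sdiff_eq_self hW] at hU
  refine (h U hU h0).trans (le_of_eq ?_)
  refine sum_congr rfl fun a _ => sum_congr rfl fun b _ => ?_
  rw [Jt_mk hJ]; rfl

theorem M3fin (hJ : KernelHyp d J α c C) {β₁ β' : ℝ} (hβ : 0 < β₁) (h1 : β₁ ≤ β') (hB : ¬ ∃ M, Bdd J β₁ M)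
    (R : ℕ) : ∃ W₀ : Finset (V d), ∀ W, W₀ ⊆ W → min (1 / 2) ((β' - β₁) / (4 * β')) ≤ thF J W R β' := by
  have hex : ∀ U : Finset (V d), 0 ∈ U → ∃ W : Finset (V d), 1 / 2 ≤ ∑ a ∈ U, ∑ b ∈ W \ U, tau J β₁ U 0 a * (β₁ * J a b) := by
    intro U h0
    by_contra hc
    push Not at hc
    exact hB ⟨_, PHI hJ hβ.le (by norm_num : (1/2:ℝ) < 1) U h0 fun W => (hc W).le⟩
  choose! f hf using hex
  refine ⟨bx 0 R ∪ (bx 0 R).powerset.biUnion f, fun W hW => ?_⟩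
  have hb' : 0 < β' := by linarith
  have hd : ∀ β ∈ Set.Icc β₁ β', ∃ D, HasDerivAt (thF J W R) D β ∧ 1 / (2 * β') * (1 - thF J W R β) ≤ D := by
    intro β hb
    refine thF_deriv hJ (hβ.le.trans hb.1) (Finset.subset_union_left.trans hW) fun U hU h0 => ?_
    have hfW : f U ⊆ W := (Finset.subset_biUnion_of_mem f (Finset.mem_powerset.2 hU)).trans
      (Finset.subset_union_right.trans hW)
    have h2 : β' * ∑ a ∈ U, ∑ b ∈ W \ U, tau J β U 0 a * J a b ≥ 1 / 2 := by
      refine (hf U h0).trans ?_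
      simp only [mul_sum]
      refine sum_le_sum fun a _ => ?_
      refine (sum_le_sum_of_subset_of_nonneg (Finset.sdiff_subset_sdiff hfW (le_refl U)) fun b _ _ =>
        mul_nonneg (tau_nn hJ hβ.le _ _ _) (mul_nonneg hβ.le (hJ.nonneg _ _))).trans ?_
      refine sum_le_sum fun b _ => ?_
      calc tau J β₁ U 0 a * (β₁ * J a b) ≤ tau J β U 0 a * (β' * J a b) :=
            mul_le_mul (tau_beta hJ hβ.le hb.1 _ _ _) (mul_le_mul_of_nonneg_right h1 (hJ.nonneg _ _))
              (mul_nonneg hβ.le (hJ.nonneg _ _)) (tau_nn hJ (hβ.le.trans hb.1) _ _ _)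
        _ = _ := by ring
    rw [div_le_iff₀ (by positivity)]; linarith
  by_cases hlt : 1 / 2 ≤ thF J W R β'
  · exact (min_le_left _ _).trans hlt
  push Not at hlt
  refine (min_le_right _ _).trans ?_
  have hmono : ∀ β ∈ Set.Icc β₁ β', thF J W R β ≤ thF J W R β' := fun β hb =>
    ex_mono_beta (Jt_nn hJ) _ (fun _ _ h => ind_mono fun ⟨t, ht, h'⟩ => ⟨t, ht, cn_mono h h'⟩) (hβ.le.trans hb.1) hb.2
  have := (convex_Icc β₁ β').mul_sub_le_image_sub_of_le_deriv (f := thF J W R) (C := 1 / (4 * β'))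
    (fun β hb => (hd β hb).choose_spec.1.continuousAt.continuousWithinAt)
    (fun β hb => (hd β (interior_subset hb)).choose_spec.1.differentiableAt.differentiableWithinAt)
    (fun β hb => by
      obtain ⟨D, h2, h3⟩ := hd β (interior_subset hb)
      rw [h2.deriv]
      refine le_trans ?_ h3
      have := hmono β (interior_subset hb)
      calc 1 / (4 * β') = 1 / (2 * β') * (1 / 2) := by field_simp; norm_num
        _ ≤ _ := mul_le_mul_of_nonneg_left (by linarith) (by positivity))
    β₁ (by simp [h1]) β' (by simp [h1]) h1
  have h4 : 0 ≤ thF J W R β₁ := Pr_nn (pp_isP hJ hβ.le)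
  calc (β' - β₁) / (4 * β') = 1 / (4 * β') * (β' - β₁) := by ring
    _ ≤ _ := by linarith
end m3

section link
open Classical
variable {d : ℕ} {J : V d → V d → ℝ} {α c C : ℝ} {P : ℝ → Measure (Config d)}

noncomputable def op (ω : Config d) (E : Finset (Sym2 (V d))) : Finset (Sym2 (V d)) := E.filter fun e => ω e = true

lemma op_mono (ω : Config d) {E E' : Finset (Sym2 (V d))} (h : E ⊆ E') : op ω E ⊆ op ω E' :=
  Finset.filter_subset_filter _ h

lemma op_eq (ω : Config d) (E S : Finset (Sym2 (V d))) (hS : S ⊆ E) :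
    op ω E = S ↔ ∀ e ∈ E, ω e = decide (e ∈ S) := by
  unfold op
  constructor
  · rintro rfl e he
    by_cases h : ω e = true <;> simp [h, he]
  · intro h
    ext e
    rw [mem_filter]
    constructor
    · rintro ⟨h1, h2⟩
      rw [h e h1] at h2; simpa using h2
    · intro he
      exact ⟨hS he, by rw [h e (hS he)]; simpa using he⟩

lemma cyl_meas (E : Finset (Sym2 (V d))) (f : Sym2 (V d) → Bool) : MeasurableSet {ω : Config d | ∀ e ∈ E, ω e = f e} := by
  have : {ω : Config d | ∀ e ∈ E, ω e = f e} = ⋂ e ∈ E, (fun ω : Config d => ω e) ⁻¹' {f e} := by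
    ext ω; simp
  rw [this]
  exact Finset.measurableSet_biInter _ fun e _ => measurable_pi_apply e (measurableSet_singleton _)

lemma ev_eq (E : Finset (Sym2 (V d))) (Φ : Finset (Sym2 (V d)) → Prop) :
    {ω : Config d | Φ (op ω E)} = ⋃ S ∈ E.powerset.filter Φ, {ω | ∀ e ∈ E, ω e = decide (e ∈ S)} := by
  ext ω
  simp only [Set.mem_ofPred_eq, Set.mem_iUnion, mem_filter, mem_powerset, exists_prop]
  constructor
  · intro h
    exact ⟨op ω E, ⟨filter_subset _ _, h⟩, (op_eq ω E _ (filter_subset _ _)).1 rfl⟩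
  · rintro ⟨S, ⟨h1, h2⟩, h3⟩
    rwa [(op_eq ω E S h1).2 h3]

lemma ev_meas (E : Finset (Sym2 (V d))) (Φ : Finset (Sym2 (V d)) → Prop) : MeasurableSet {ω : Config d | Φ (op ω E)} := by
  rw [ev_eq]
  exact Finset.measurableSet_biUnion _ fun S _ => cyl_meas E _

lemma P_ev (hJ : KernelHyp d J α c C) (hP : IsLRP J P) {β : ℝ} (hβ : 0 ≤ β) (E : Finset (Sym2 (V d)))
    (Φ : Finset (Sym2 (V d)) → Prop) : P β {ω | Φ (op ω E)} = ENNReal.ofReal (Pr (pp J β) E Φ) := by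
  have hp := pp_isP hJ hβ
  rw [ev_eq, measure_biUnion_finset]
  · unfold Pr ex
    rw [ENNReal.ofReal_sum_of_nonneg]
    swap
    · intro S _
      exact mul_nonneg (mul_nonneg (prod_nonneg fun e _ => (hp e).1)
        (prod_nonneg fun e _ => by linarith [(hp e).2])) (ind_nn _)
    rw [Finset.sum_filter]
    refine sum_congr rfl fun S hS => ?_
    beta_reduce
    by_cases h : Φ S
    · rw [if_pos h, ind_t h, mul_one, hP, ENNReal.ofReal_mul (prod_nonneg fun e _ => (hp e).1),
        ENNReal.ofReal_prod_of_nonneg fun e _ => (hp e).1,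
        ENNReal.ofReal_prod_of_nonneg fun e _ => by linarith [(hp e).2]]
      rw [← Finset.prod_filter_mul_prod_filter_not E (fun e => e ∈ S)]
      rw [mem_powerset] at hS
      have e1 : E.filter (fun e => e ∈ S) = S := by
        ext e; rw [mem_filter]; exact ⟨fun h => h.2, fun h => ⟨hS h, h⟩⟩
      have e2 : E.filter (fun e => ¬ e ∈ S) = E \ S := by
        ext e; rw [mem_filter, mem_sdiff]
      rw [e1, e2]
      congr 1
      · refine Finset.prod_congr rfl fun e he => ?_
        simp only [he, decide_true, if_true]; rfl
      · refine Finset.prod_congr rfl fun e he => ?_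
        rw [mem_sdiff] at he
        simp only [he.2, decide_false]
        rw [ENNReal.ofReal_sub _ (hp e).1, ENNReal.ofReal_one]; rfl
    · rw [if_neg h, ind_f h]; simp
  · intro S hS S' hS' hne
    refine Set.disjoint_left.2 fun ω h1 h2 => hne ?_
    have hS := Finset.mem_powerset.1 (Finset.mem_filter.1 hS).1
    have hS' := Finset.mem_powerset.1 (Finset.mem_filter.1 hS').1
    rw [← (op_eq ω E S hS).2 h1, (op_eq ω E S' hS').2 h2]
  · exact fun S _ => cyl_meas E _

lemma P_univ (hP : IsLRP J P) (β : ℝ) : P β Set.univ = 1 := by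
  have := hP β ∅ (fun _ => true)
  simpa using this

noncomputable def bE (d N : ℕ) : Finset (Sym2 (V d)) := (bx (0 : V d) N).sym2

lemma bE_mono {N N' : ℕ} (h : N ≤ N') : bE d N ⊆ bE d N' := sym2_mono (bx_mono h)

lemma cn_conn {ω : Config d} {E : Finset (Sym2 (V d))} {x y : V d} (h : cn (op ω E) x y) : conn ω x y :=
  Relation.ReflTransGen.mono (fun a b hab => ⟨hab.1, (Finset.mem_filter.1 hab.2).2⟩) _ _ h

lemma conn_cn {ω : Config d} {x y : V d} (h : conn ω x y) : ∃ N, ∀ N' ≥ N, cn (op ω (bE d N')) x y := by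
  induction h with
  | refl => exact ⟨0, fun _ _ => cn_refl _ _⟩
  | @tail b c hb hbc ih =>
    obtain ⟨N, ih⟩ := ih
    refine ⟨max N (max (di 0 b) (di 0 c)), fun N' hN' => cn_trans (ih N' (by omega)) (cn_edge ?_)⟩
    refine Finset.mem_filter.2 ⟨Finset.mk_mem_sym2_iff.2 ⟨mem_bx.2 (by omega), mem_bx.2 (by omega)⟩, hbc.2⟩

lemma fin_cn {ω : Config d} {x : V d} (A : Finset (V d)) (h : ∀ y ∈ A, conn ω x y) :
    ∃ N, ∀ N' ≥ N, ∀ y ∈ A, cn (op ω (bE d N')) x y := by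
  induction A using Finset.induction_on with
  | empty => exact ⟨0, by simp⟩
  | insert a A ha ih =>
    obtain ⟨N, hN⟩ := ih fun y hy => h y (Finset.mem_insert_of_mem hy)
    obtain ⟨N₂, hN₂⟩ := conn_cn (h a (Finset.mem_insert_self _ _))
    refine ⟨max N N₂, fun N' hN' y hy => ?_⟩
    rcases Finset.mem_insert.1 hy with rfl | hy
    · exact hN₂ N' (by omega)
    · exact hN N' (by omega) y hy

lemma theta_up (hJ : KernelHyp d J α c C) (hP : IsLRP J P) {β : ℝ} (hβ : 0 ≤ β) (x : V d) (n : ℕ) {q : ℝ}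
    (h : ∀ N, Pr (pp J β) (bE d N) (fun S => n ≤ (cl S (bx 0 N) x).card) ≤ q) :
    P β {ω | (cluster ω x).Infinite} ≤ ENNReal.ofReal q := by
  have h1 : {ω | (cluster ω x).Infinite} ⊆ ⋃ N, {ω | n ≤ (cl (op ω (bE d N)) (bx 0 N) x).card} := by
    intro ω hω
    obtain ⟨A, hA, hn⟩ := Set.Infinite.exists_subset_card_eq hω n
    obtain ⟨N, hN⟩ := fin_cn A fun y hy => hA hy
    obtain ⟨N₂, hN₂⟩ : ∃ N₂, ∀ y ∈ A, di 0 y ≤ N₂ := ⟨A.sup (di 0), fun y hy => Finset.le_sup hy⟩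
    rw [Set.mem_iUnion]
    refine ⟨max N N₂, ?_⟩
    show n ≤ _
    rw [← hn]
    exact card_le_card fun y hy => mem_cl.2 ⟨mem_bx.2 ((hN₂ y hy).trans (le_max_right _ _)), hN _ (le_max_left _ _) y hy⟩
  refine (measure_mono h1).trans ?_
  rw [Monotone.measure_iUnion]
  · refine iSup_le fun N => ?_
    rw [P_ev hJ hP hβ (bE d N) (fun S => n ≤ (cl S (bx 0 N) x).card)]
    exact ENNReal.ofReal_le_ofReal (h N)
  · intro N N' hN ω hω
    refine le_trans (show n ≤ _ from hω) (card_le_card fun y hy => ?_)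
    rw [mem_cl] at hy ⊢
    exact ⟨bx_mono hN hy.1, cn_mono (op_mono ω (bE_mono hN)) hy.2⟩

lemma theta_low (hJ : KernelHyp d J α c C) (hP : IsLRP J P) {β : ℝ} (hβ : 0 ≤ β) {q : ℝ}
    (h : ∀ R : ℕ, ∃ W₀ : Finset (V d), ∀ W, W₀ ⊆ W → q ≤ thF J W R β) :
    ENNReal.ofReal q ≤ P β {ω | (cluster ω 0).Infinite} := by
  have : IsProbabilityMeasure (P β) := ⟨P_univ hP β⟩
  set A : ℕ → Set (Config d) := fun R => {ω | ∃ t, R < di 0 t ∧ conn ω 0 t} with hA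
  have h1 : (⋂ R, A R) ⊆ {ω | (cluster ω 0).Infinite} := by
    intro ω hω hfin
    have hω := Set.mem_iInter.1 hω (hfin.toFinset.sup (di 0))
    obtain ⟨t, ht, hc⟩ := hω
    have := Finset.le_sup (f := di 0) (hfin.mem_toFinset.2 hc)
    omega
  have hAe : ∀ R, A R = ⋃ N, {ω | ∃ t ∈ bx 0 N \ bx 0 R, cn (op ω (bE d N)) 0 t} := by
    intro R
    ext ω
    rw [Set.mem_iUnion]
    constructor
    · rintro ⟨t, ht, hc⟩
      obtain ⟨N, hN⟩ := conn_cn hc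
      refine ⟨max N (di 0 t), t, Finset.mem_sdiff.2 ⟨mem_bx.2 (le_max_right _ _), fun hh => ?_⟩, hN _ (le_max_left _ _)⟩
      rw [mem_bx] at hh; omega
    · rintro ⟨N, t, ht, hc⟩
      rw [mem_sdiff, mem_bx, mem_bx] at ht
      exact ⟨t, by omega, cn_conn hc⟩
  refine le_trans ?_ (measure_mono h1)
  rw [Antitone.measure_iInter]
  · refine le_iInf fun R => ?_
    obtain ⟨W₀, hW⟩ := h R
    have hsub : W₀ ⊆ bx 0 (W₀.sup (di 0)) := fun v hv => mem_bx.2 (Finset.le_sup (f := di 0) hv)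
    refine (ENNReal.ofReal_le_ofReal (hW _ hsub)).trans ?_
    unfold thF
    have := P_ev hJ hP hβ (bE d (W₀.sup (di 0))) (fun S => ∃ t ∈ bx 0 (W₀.sup (di 0)) \ bx 0 R, cn S 0 t)
    unfold bE at this
    rw [← this, hAe]
    exact measure_mono (Set.subset_iUnion (fun N => {ω : Config d | ∃ t ∈ bx 0 N \ bx 0 R, cn (op ω (bE d N)) 0 t}) _)
  · intro R R' hR ω hω
    obtain ⟨t, ht, hc⟩ := hω
    exact ⟨t, by omega, hc⟩
  · intro R
    rw [hAe]
    exact (MeasurableSet.iUnion fun N => ev_meas (bE d N) (fun S => ∃ t ∈ bx 0 N \ bx 0 R, cn S 0 t)).nullMeasurableSet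
  · exact ⟨0, measure_ne_top _ _⟩

lemma markov (hJ : KernelHyp d J α c C) {β M : ℝ} (hβ : 0 ≤ β) (hB : Bdd J β M) (W : Finset (V d)) (x : V d) {n : ℕ}
    (hn : 1 ≤ n) : Pr (pp J β) W.sym2 (fun S => n ≤ (cl S W x).card) ≤ M / n := by
  have hn0 : (0:ℝ) < n := by exact_mod_cast hn
  rw [le_div_iff₀ hn0]
  refine le_trans ?_ (hB W x)
  unfold tau ta Pr
  rw [← ex_mul', ← ex_sum]
  refine ex_mono (pp_isP hJ hβ) fun S _ => ?_
  rw [← cl_card]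
  by_cases h : n ≤ (cl S W x).card
  · rw [ind_t h, one_mul]; exact_mod_cast h
  · rw [ind_f h]; simp

lemma no_inf (hJ : KernelHyp d J α c C) (hP : IsLRP J P) {β M : ℝ} (hβ : 0 ≤ β) (hB : Bdd J β M) :
    P β {ω | ∃ x, (cluster ω x).Infinite} = 0 := by
  rw [Set.ofPred_exists, measure_iUnion_null_iff]
  intro x
  refine le_antisymm ?_ (zero_le)
  have h1 : ∀ n : ℕ, P β {ω | (cluster ω x).Infinite} ≤ ENNReal.ofReal (M / (n + 1 : ℕ)) := fun n =>
    theta_up hJ hP hβ x (n + 1) fun N => markov hJ hβ hB _ _ (by omega)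
  have h2 : Filter.Tendsto (fun n : ℕ => ENNReal.ofReal (M / (n + 1 : ℕ))) Filter.atTop (nhds 0) := by
    rw [← ENNReal.ofReal_zero]
    refine ENNReal.tendsto_ofReal ?_
    exact (tendsto_const_div_atTop_nhds_zero_nat M).comp (Filter.tendsto_add_atTop_nat 1)
  exact ge_of_tendsto' h2 h1

def BS (J : V d → V d → ℝ) : Set ℝ := {β | 0 ≤ β ∧ ∃ M, Bdd J β M}

noncomputable def bst (J : V d → V d → ℝ) : ℝ := sSup (BS J)

lemma bst_pos (hJ : KernelHyp d J α c C) (hb : BddAbove (BS J)) : 0 < bst J := by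
  have h0 := Jtot_nn hJ
  have hp : 0 < 1 / (2 * (Jtot J + 1)) := by positivity
  refine lt_of_lt_of_le hp (le_csSup hb ⟨hp.le, bdd_small hJ hp.le ?_⟩)
  rw [div_mul_eq_mul_div, div_lt_one (by positivity)]; linarith

lemma bdd_lt (hJ : KernelHyp d J α c C) {β : ℝ} (h0 : 0 ≤ β) (h : β < bst J) : ∃ M, Bdd J β M := by
  have hne : (BS J).Nonempty := ⟨0, le_refl _, bdd_small hJ (le_refl _) (by simp)⟩
  obtain ⟨β', ⟨h1, M, h2⟩, h3⟩ := exists_lt_of_lt_csSup hne h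
  exact ⟨M, Bdd_beta hJ h0 h3.le h2⟩

lemma not_bdd (hb : BddAbove (BS J)) {β : ℝ} (h0 : 0 ≤ β) (h : bst J < β) : ¬ ∃ M, Bdd J β M := fun hc =>
  absurd (le_csSup hb ⟨h0, hc⟩) (not_le.2 h)

lemma theta_lower (hJ : KernelHyp d J α c C) (hP : IsLRP J P) (hb : BddAbove (BS J)) {ε : ℝ} (hε : 0 < ε) :
    ENNReal.ofReal (min (1 / 2) (ε / 2 / (4 * (bst J + ε)))) ≤ P (bst J + ε) {ω | (cluster ω 0).Infinite} := by
  have hp := bst_pos hJ hb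
  refine theta_low hJ hP (by positivity) fun R => ?_
  obtain ⟨W₀, h⟩ := M3fin hJ (β₁ := bst J + ε / 2) (β' := bst J + ε) (by positivity) (by linarith)
    (not_bdd hb (by positivity) (by linarith)) R
  refine ⟨W₀, fun W hW => ?_⟩
  have := h W hW
  rwa [show bst J + ε - (bst J + ε / 2) = ε / 2 by ring] at this

lemma betaC_eq (hJ : KernelHyp d J α c C) (hP : IsLRP J P) (hb : BddAbove (BS J)) : betaC P = bst J := by
  have hp := bst_pos hJ hb
  unfold betaC
  have h1 : ∀ β, bst J < β → 0 ≤ β ∧ 0 < P β {ω | ∃ x, (cluster ω x).Infinite} := by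
    intro β hβ
    refine ⟨by linarith, ?_⟩
    have h := theta_lower hJ hP hb (ε := β - bst J) (by linarith)
    rw [add_sub_cancel] at h
    refine lt_of_lt_of_le ?_ (h.trans (measure_mono fun ω hω => ⟨0, hω⟩))
    rw [ENNReal.ofReal_pos]
    refine lt_min (by norm_num) ?_
    have : 0 < β - bst J := by linarith
    have : 0 < β := by linarith
    positivity
  have h2 : ∀ β ∈ {β : ℝ | 0 ≤ β ∧ 0 < P β {ω | ∃ x, (cluster ω x).Infinite}}, bst J ≤ β := by
    rintro β ⟨h0, h⟩
    by_contra hc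
    push Not at hc
    obtain ⟨M, hM⟩ := bdd_lt hJ h0 hc
    rw [no_inf hJ hP h0 hM] at h
    exact lt_irrefl _ h
  apply le_antisymm
  · refine le_of_forall_pos_le_add fun ε hε => ?_
    exact csInf_le ⟨bst J, h2⟩ (h1 _ (by linarith))
  · exact le_csInf ⟨bst J + 1, h1 _ (by linarith)⟩ h2
end link

section stepB
open Classical
variable {X : Type*} [DecidableEq X]

lemma Pr_none {ε : Type*} [DecidableEq ε] (p : ε → ℝ) {F E : Finset ε} (h : F ⊆ E) :
    Pr p E (fun S => ∀ e ∈ F, e ∉ S) = ∏ e ∈ F, (1 - p e) := by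
  have h1 : Pr p E (fun S => ∀ e ∈ F, e ∉ S) = Pr p F (fun S => ∀ e ∈ F, e ∉ S) := by
    unfold Pr
    rw [← ex_inter p h]
    refine ex_congr fun S _ => ind_congr (forall₂_congr fun e he => ?_)
    simp [he]
  rw [h1]; unfold Pr ex
  rw [Finset.sum_eq_single ∅]
  · beta_reduce; rw [ind_t (by simp)]; simp
  · intro S hS hne
    obtain ⟨e, he⟩ := Finset.nonempty_iff_ne_empty.2 hne
    beta_reduce; rw [ind_f (fun h : ∀ e ∈ F, e ∉ S => h e (Finset.mem_powerset.1 hS he) he), mul_zero]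
  · intro h; exact absurd (Finset.empty_mem_powerset _) h

lemma sym2_disj {A B : Finset X} (h : Disjoint A B) : Disjoint A.sym2 B.sym2 := by
  rw [Finset.disjoint_left] at h ⊢
  intro e he he'
  induction e using Sym2.ind with
  | _ a b => exact h (Finset.mk_mem_sym2_iff.1 he).1 (Finset.mk_mem_sym2_iff.1 he').1

lemma link (p : Sym2 X → ℝ) {W A B : Finset X} (hA : A ⊆ W) (hB : B ⊆ W) (hAB : Disjoint A B)
    (f g : Finset (Sym2 X) → Finset X) (hf : ∀ S, f S ⊆ A) (hg : ∀ S, g S ⊆ B)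
    (F : Finset (Sym2 X) → Finset (Sym2 X) → ℝ) :
    ex p W.sym2 (fun S => F (S ∩ A.sym2) (S ∩ B.sym2) *
      ind (∀ a ∈ f (S ∩ A.sym2), ∀ b ∈ g (S ∩ B.sym2), s(a, b) ∉ S)) =
    ex p W.sym2 (fun S => F (S ∩ A.sym2) (S ∩ B.sym2) *
      ∏ a ∈ f (S ∩ A.sym2), ∏ b ∈ g (S ∩ B.sym2), (1 - p s(a, b))) := by
  set E₁ := A.sym2 ∪ B.sym2
  have hE : E₁ ⊆ W.sym2 := Finset.union_subset (sym2_mono hA) (sym2_mono hB)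
  rw [← Finset.union_sdiff_of_subset hE, ex_union p Finset.disjoint_sdiff, ex_union p Finset.disjoint_sdiff]
  refine ex_congr fun S₁ hS₁ => ?_
  have key : ∀ S₂ ⊆ W.sym2 \ E₁, (S₁ ∪ S₂) ∩ A.sym2 = S₁ ∩ A.sym2 ∧ (S₁ ∪ S₂) ∩ B.sym2 = S₁ ∩ B.sym2 := by
    intro S₂ hS₂
    constructor
    · ext e; have := @hS₂ e
      simp only [E₁, Finset.mem_inter, Finset.mem_union, mem_sdiff] at *; tauto
    · ext e; have := @hS₂ e
      simp only [E₁, Finset.mem_inter, Finset.mem_union, mem_sdiff] at *; tauto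
  set A' := f (S₁ ∩ A.sym2) with hA'
  set B' := g (S₁ ∩ B.sym2) with hB'
  have hdis : ∀ a ∈ A', ∀ b ∈ B', s(a, b) ∈ W.sym2 \ E₁ := by
    intro a ha b hb
    have ha := hf _ ha
    have hb := hg _ hb
    rw [Finset.disjoint_left] at hAB
    simp only [E₁, Finset.mem_union, mem_sdiff, mk_mem_sym2_iff]
    refine ⟨⟨hA ha, hB hb⟩, ?_⟩
    rintro (⟨_, h⟩ | ⟨h, _⟩)
    · exact hAB h hb
    · exact hAB ha h
  have hinj : Set.InjOn (fun q : X × X => s(q.1, q.2)) (A' ×ˢ B' : Finset (X × X)) := by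
    rintro ⟨a, b⟩ hq ⟨a', b'⟩ hq' h
    simp only [Finset.coe_product, Set.mem_prod, Finset.mem_coe] at hq hq'
    rcases Sym2.eq_iff.1 h with ⟨rfl, rfl⟩ | ⟨rfl, rfl⟩
    · rfl
    · exact absurd (hg _ hq'.2) (Finset.disjoint_left.1 hAB (hf _ hq.1))
  set F₀ := (A' ×ˢ B').image (fun q : X × X => s(q.1, q.2)) with hF₀
  have hF₀s : F₀ ⊆ W.sym2 \ E₁ := by
    intro e he
    obtain ⟨q, hq, rfl⟩ := Finset.mem_image.1 he
    rw [mem_product] at hq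
    exact hdis _ hq.1 _ hq.2
  have hprod : ∏ a ∈ A', ∏ b ∈ B', (1 - p s(a, b)) = ∏ e ∈ F₀, (1 - p e) := by
    rw [hF₀, Finset.prod_image hinj, Finset.prod_product]
  have l1 : ex p (W.sym2 \ E₁) (fun S₂ => F ((S₁ ∪ S₂) ∩ A.sym2) ((S₁ ∪ S₂) ∩ B.sym2) *
      ∏ a ∈ f ((S₁ ∪ S₂) ∩ A.sym2), ∏ b ∈ g ((S₁ ∪ S₂) ∩ B.sym2), (1 - p s(a, b))) =
      F (S₁ ∩ A.sym2) (S₁ ∩ B.sym2) * ∏ e ∈ F₀, (1 - p e) := by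
    rw [← ex_const p (W.sym2 \ E₁) (F (S₁ ∩ A.sym2) (S₁ ∩ B.sym2) * ∏ e ∈ F₀, (1 - p e))]
    refine ex_congr fun S₂ hS₂ => ?_
    rw [(key S₂ hS₂).1, (key S₂ hS₂).2, ← hprod]
  rw [l1, ← Pr_none p hF₀s]
  unfold Pr
  rw [← ex_mul]
  refine ex_congr fun S₂ hS₂ => ?_
  rw [(key S₂ hS₂).1, (key S₂ hS₂).2]
  congr 1
  refine ind_congr ⟨fun h e he => ?_, fun h a ha b hb hc => ?_⟩
  · obtain ⟨q, hq, rfl⟩ := Finset.mem_image.1 he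
    rw [mem_product] at hq
    exact fun hc => h _ hq.1 _ hq.2 (Finset.mem_union_right _ hc)
  · rcases Finset.mem_union.1 hc with hc | hc
    · exact (Finset.mem_sdiff.1 (hdis a ha b hb)).2 (hS₁ hc)
    · exact h s(a, b) (Finset.mem_image.2 ⟨(a, b), Finset.mem_product.2 ⟨ha, hb⟩, rfl⟩) hc

lemma prod_pb_le {J : Sym2 X → ℝ} {β j₀ : ℝ} (hβ : 0 ≤ β) {A B : Finset X}
    (h : ∀ a ∈ A, ∀ b ∈ B, j₀ ≤ J s(a, b)) :
    ∏ a ∈ A, ∏ b ∈ B, (1 - pb J β s(a, b)) ≤ Real.exp (-(β * j₀ * (A.card * B.card))) := by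
  have h1 : ∏ a ∈ A, ∏ b ∈ B, (1 - pb J β s(a, b)) = Real.exp (∑ a ∈ A, ∑ b ∈ B, -β * J s(a, b)) := by
    rw [Real.exp_sum]
    refine Finset.prod_congr rfl fun a _ => ?_
    rw [Real.exp_sum]
    refine Finset.prod_congr rfl fun b _ => ?_
    unfold pb; ring
  rw [h1, Real.exp_le_exp]
  calc ∑ a ∈ A, ∑ b ∈ B, -β * J s(a, b) ≤ ∑ a ∈ A, ∑ b ∈ B, -β * j₀ :=
        sum_le_sum fun a ha => sum_le_sum fun b hb => by
          have := mul_le_mul_of_nonneg_left (h a ha b hb) hβ; linarith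
    _ = _ := by simp; ring

noncomputable def rp (W : Finset X) (m : ℕ) (S : Finset (Sym2 X)) : Finset X :=
  if h : big W m S then cl S W h.choose else ∅

lemma rp_sub (W : Finset X) (m : ℕ) (S : Finset (Sym2 X)) : rp W m S ⊆ W := by
  unfold rp; split_ifs
  · exact cl_sub _ _ _
  · simp

lemma rp_card {W : Finset X} {m : ℕ} {S : Finset (Sym2 X)} (h : big W m S) : m ≤ (rp W m S).card := by
  unfold rp; rw [dif_pos h]; exact h.choose_spec.2

lemma rp_cn {W : Finset X} {m : ℕ} {S : Finset (Sym2 X)} {a b : X} (ha : a ∈ rp W m S) (hb : b ∈ rp W m S) : cn S a b := by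
  unfold rp at ha hb; split_ifs at ha hb
  · exact cn_trans (cn_symm (mem_cl.1 ha).2) (mem_cl.1 hb).2
  · simp at ha

lemma big_step {J : Sym2 X → ℝ} (hJ : ∀ e, 0 ≤ J e) {β j₀ q : ℝ} (hβ : 0 ≤ β) (hj : 0 ≤ j₀) {W : Finset X} {ι : Type*} [Fintype ι]
    (hι : Fintype.card ι = 64) (Q : ι → Finset X) (hQ : ∀ i, Q i ⊆ W) (hdis : ∀ i j, i ≠ j → Disjoint (Q i) (Q j))
    {m : ℕ} (hm : 1 ≤ m) (hq : ∀ i, Pr (pb J β) (Q i).sym2 (fun S => ¬ big (Q i) m S) ≤ q)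
    (hJ0 : ∀ a ∈ W, ∀ b ∈ W, a ≠ b → j₀ ≤ J s(a, b)) :
    Pr (pb J β) W.sym2 (fun S => ¬ big W (63 * m) S) ≤ 64 ^ 2 * (q ^ 2 + Real.exp (-(β * j₀ * m ^ 2))) := by
  have hp := pb_isP hJ hβ
  set p := pb J β with hpdef
  set A1 : ι × ι → Finset (Sym2 X) → Prop := fun q S => q.1 ≠ q.2 ∧ ¬ big (Q q.1) m (S ∩ (Q q.1).sym2) ∧
    ¬ big (Q q.2) m (S ∩ (Q q.2).sym2)
  set A2 : ι × ι → Finset (Sym2 X) → Prop := fun q S => q.1 ≠ q.2 ∧ (big (Q q.1) m (S ∩ (Q q.1).sym2) ∧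
    big (Q q.2) m (S ∩ (Q q.2).sym2)) ∧ ∀ a ∈ rp (Q q.1) m (S ∩ (Q q.1).sym2), ∀ b ∈ rp (Q q.2) m (S ∩ (Q q.2).sym2), s(a, b) ∉ S
  have hcov : ∀ S ⊆ W.sym2, ¬ big W (63 * m) S → (∃ r ∈ (Finset.univ : Finset (ι × ι)), A1 r S ∨ A2 r S) := by
    intro S hS hnb
    by_contra hc
    push Not at hc
    have hc1 : ∀ i j, i ≠ j → big (Q i) m (S ∩ (Q i).sym2) ∨ big (Q j) m (S ∩ (Q j).sym2) := by
      intro i j hij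
      by_contra h; push Not at h
      exact (hc (i, j) (Finset.mem_univ _)).1 ⟨hij, h.1, h.2⟩
    have hc2 : ∀ i j, i ≠ j → big (Q i) m (S ∩ (Q i).sym2) → big (Q j) m (S ∩ (Q j).sym2) →
        ∃ a ∈ rp (Q i) m (S ∩ (Q i).sym2), ∃ b ∈ rp (Q j) m (S ∩ (Q j).sym2), s(a, b) ∈ S := by
      intro i j hij h1 h2
      by_contra h; push Not at h
      exact (hc (i, j) (Finset.mem_univ _)).2 ⟨hij, ⟨h1, h2⟩, h⟩
    set G := Finset.univ.filter (fun i => big (Q i) m (S ∩ (Q i).sym2)) with hG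
    have hGc : 63 ≤ G.card := by
      have h1 : (Finset.univ.filter (fun i => ¬ big (Q i) m (S ∩ (Q i).sym2))).card ≤ 1 := by
        rw [Finset.card_le_one]
        intro i hi j hj
        by_contra hij
        rcases hc1 i j hij with h | h
        · exact (Finset.mem_filter.1 hi).2 h
        · exact (Finset.mem_filter.1 hj).2 h
      have h2 : G.card + (Finset.univ.filter (fun i => ¬ big (Q i) m (S ∩ (Q i).sym2))).card = 64 := by
        rw [hG, ← hι, ← Finset.card_univ]
        convert Finset.card_filter_add_card_filter_not (s := (Finset.univ : Finset ι)) (fun i => big (Q i) m (S ∩ (Q i).sym2))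
      omega
    obtain ⟨i₀, hi₀⟩ : G.Nonempty := Finset.card_pos.1 (by omega)
    have hb0 := (Finset.mem_filter.1 hi₀).2
    obtain ⟨y, hy⟩ : (rp (Q i₀) m (S ∩ (Q i₀).sym2)).Nonempty := Finset.card_pos.1 (by have := rp_card hb0; omega)
    refine hnb ⟨y, hQ _ (rp_sub _ _ _ hy), ?_⟩
    have hsub : G.biUnion (fun i => rp (Q i) m (S ∩ (Q i).sym2)) ⊆ cl S W y := by
      intro v hv
      obtain ⟨i, hi, hv⟩ := Finset.mem_biUnion.1 hv
      refine mem_cl.2 ⟨hQ _ (rp_sub _ _ _ hv), ?_⟩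
      by_cases hii : i₀ = i
      · subst hii; exact cn_mono Finset.inter_subset_left (rp_cn hy hv)
      · obtain ⟨a, ha, b, hb, hab⟩ := hc2 i₀ i hii hb0 (Finset.mem_filter.1 hi).2
        exact cn_trans (cn_mono Finset.inter_subset_left (rp_cn hy ha)) (cn_trans (cn_edge hab)
          (cn_mono Finset.inter_subset_left (rp_cn hb hv)))
    refine le_trans ?_ (card_le_card hsub)
    rw [Finset.card_biUnion]
    · calc 63 * m ≤ G.card * m := Nat.mul_le_mul_right _ hGc
        _ = ∑ i ∈ G, m := by simp
        _ ≤ _ := sum_le_sum fun i hi => rp_card (Finset.mem_filter.1 hi).2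
    · intro i _ j _ hij
      exact Finset.disjoint_of_subset_left (rp_sub _ _ _) (Finset.disjoint_of_subset_right (rp_sub _ _ _) (hdis i j hij))
  have hq0 : ∀ i : ι, 0 ≤ q := fun i => (Pr_nn hp).trans (hq i)
  have h1 : ∀ r, Pr p W.sym2 (A1 r) ≤ q ^ 2 := by
    rintro ⟨i, j⟩
    by_cases hij : i = j
    · have : Pr p W.sym2 (A1 (i, j)) ≤ 0 := by
        unfold Pr; rw [← ex_const p W.sym2 0]
        exact ex_mono hp fun S _ => (ind_f fun h => h.1 hij).le
      exact this.trans (by positivity)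
    · have h2 : Pr p W.sym2 (A1 (i, j)) = Pr p (Q i).sym2 (fun S => ¬ big (Q i) m S) * Pr p (Q j).sym2 (fun S => ¬ big (Q j) m S) := by
        unfold Pr
        rw [← ex_indep p (sym2_mono (hQ i)) (sym2_mono (hQ j)) (sym2_disj (hdis i j hij))]
        refine ex_congr fun S _ => ?_
        rw [← ind_and]
        exact ind_congr ⟨fun h => h.2, fun h => ⟨hij, h⟩⟩
      rw [h2, sq]
      exact mul_le_mul (hq i) (hq j) (Pr_nn hp) (hq0 i)
  have h2 : ∀ r, Pr p W.sym2 (A2 r) ≤ Real.exp (-(β * j₀ * m ^ 2)) := by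
    rintro ⟨i, j⟩
    by_cases hij : i = j
    · have : Pr p W.sym2 (A2 (i, j)) ≤ 0 := by
        unfold Pr; rw [← ex_const p W.sym2 0]
        exact ex_mono hp fun S _ => (ind_f fun h => h.1 hij).le
      exact this.trans (Real.exp_pos _).le
    · have h3 := link p (hQ i) (hQ j) (hdis i j hij) (rp (Q i) m) (rp (Q j) m) (rp_sub _ _) (rp_sub _ _)
        (fun S S' => ind (big (Q i) m S ∧ big (Q j) m S'))
      have h4 : Pr p W.sym2 (A2 (i, j)) = ex p W.sym2 (fun S => ind (big (Q i) m (S ∩ (Q i).sym2) ∧ big (Q j) m (S ∩ (Q j).sym2)) *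
          ind (∀ a ∈ rp (Q i) m (S ∩ (Q i).sym2), ∀ b ∈ rp (Q j) m (S ∩ (Q j).sym2), s(a, b) ∉ S)) := by
        refine ex_congr fun S _ => ?_
        rw [← ind_and]
        exact ind_congr ⟨fun h => h.2, fun h => ⟨hij, h⟩⟩
      rw [h4, h3]
      rw [← ex_const p W.sym2 (Real.exp _)]
      refine ex_mono hp fun S _ => ?_
      by_cases hb : big (Q i) m (S ∩ (Q i).sym2) ∧ big (Q j) m (S ∩ (Q j).sym2)
      swap
      · rw [ind_f hb, zero_mul]; exact (Real.exp_pos _).le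
      rw [ind_t hb, one_mul]
      refine (prod_pb_le hβ (j₀ := j₀) fun a ha b hb => ?_).trans ?_
      · refine hJ0 _ (hQ i (rp_sub _ _ _ ha)) _ (hQ j (rp_sub _ _ _ hb)) ?_
        rintro rfl
        exact Finset.disjoint_left.1 (hdis i j hij) (rp_sub _ _ _ ha) (rp_sub _ _ _ hb)
      · rw [Real.exp_le_exp, neg_le_neg_iff]
        refine mul_le_mul_of_nonneg_left ?_ (by positivity)
        have e1 : (m:ℝ) ≤ ((rp (Q i) m (S ∩ (Q i).sym2)).card : ℝ) := by exact_mod_cast rp_card hb.1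
        have e2 : (m:ℝ) ≤ ((rp (Q j) m (S ∩ (Q j).sym2)).card : ℝ) := by exact_mod_cast rp_card hb.2
        rw [sq]
        exact mul_le_mul e1 e2 (by positivity) (by positivity)
  refine (Pr_union_le hp Finset.univ (fun r S => A1 r S ∨ A2 r S) _ hcov).trans ?_
  calc ∑ r : ι × ι, Pr p W.sym2 (fun S => A1 r S ∨ A2 r S) ≤ ∑ r : ι × ι, (q ^ 2 + Real.exp (-(β * j₀ * m ^ 2))) :=
        sum_le_sum fun r _ => (Pr_or_le hp fun S _ h => h).trans (add_le_add (h1 r) (h2 r))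
    _ = _ := by
      rw [sum_const, Finset.card_univ, Fintype.card_prod, hι, nsmul_eq_mul]; norm_num

lemma trunc {p : Sym2 X → ℝ} (hp : IsP p) (W : Finset X) (x : X) {m : ℕ} (hm : 1 ≤ m) {q : ℝ} (hq : 0 < q)
    (hb : Pr p W.sym2 (big W m) ≤ 1 - q) :
    ∑ u ∈ W, ta p W x u ≤ 2 / q * ex p W.sym2 (fun S => (min (cl S W x).card m : ℕ)) := by
  have hY : ∑ u ∈ W, ta p W x u = ex p W.sym2 (fun S => (cl S W x).card) := by
    unfold ta Pr; rw [← ex_sum]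
    exact ex_congr fun S _ => (cl_card _ _ _).symm
  have hlayer : ∀ (n K : ℕ), n ≤ K → (n : ℝ) = ∑ N ∈ Finset.Icc 1 K, ind (N ≤ n) := by
    intro n K h
    have e0 : ∀ N, ind (N ≤ n) = if N ≤ n then 1 else 0 := fun N => by unfold ind; congr
    simp only [e0]
    rw [Finset.sum_boole]
    congr 1
    have : (Finset.Icc 1 K).filter (fun N => N ≤ n) = Finset.Icc 1 n := by
      ext N; simp only [mem_filter, Finset.mem_Icc]; omega
    rw [this]; simp
  set K := W.card
  set Y : Finset (Sym2 X) → ℕ := fun S => (cl S W x).card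
  have hYK : ∀ S, Y S ≤ K := fun S => card_le_card (cl_sub _ _ _)
  have h1 : ex p W.sym2 (fun S => (Y S : ℝ)) = ∑ N ∈ Finset.Icc 1 K, Pr p W.sym2 (fun S => N ≤ Y S) := by
    unfold Pr; rw [← ex_sum]
    exact ex_congr fun S _ => hlayer _ _ (hYK S)
  have h2 : ∑ N ∈ (Finset.Icc 1 K).filter (fun N => ¬ 2 * m < N), Pr p W.sym2 (fun S => N ≤ Y S) ≤
      2 * ex p W.sym2 (fun S => (min (Y S) m : ℕ)) := by
    unfold Pr; rw [← ex_sum, ← ex_mul]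
    refine ex_mono hp fun S _ => ?_
    have e1 : ∑ N ∈ (Finset.Icc 1 K).filter (fun N => ¬ 2 * m < N), ind (N ≤ Y S) ≤ ((min (Y S) (2 * m) : ℕ) : ℝ) := by
      rw [hlayer (min (Y S) (2 * m)) (2 * m) (min_le_right _ _)]
      refine (sum_le_sum_of_subset_of_nonneg (t := Finset.Icc 1 (2 * m)) (fun N hN => ?_) fun N _ _ => ind_nn _).trans ?_
      · simp only [mem_filter, Finset.mem_Icc] at hN ⊢; omega
      · exact sum_le_sum fun N hN => ind_mono fun h => le_min h (Finset.mem_Icc.1 hN).2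
    refine e1.trans ?_
    have : min (Y S) (2 * m) ≤ 2 * min (Y S) m := by omega
    exact_mod_cast this
  have h3 : ∑ N ∈ (Finset.Icc 1 K).filter (fun N => 2 * m < N), Pr p W.sym2 (fun S => N ≤ Y S) ≤
      (1 - q) * ex p W.sym2 (fun S => (Y S : ℝ)) := by
    rw [h1, mul_sum]
    have e1 : ∀ N ∈ (Finset.Icc 1 K).filter (fun N => 2 * m < N), Pr p W.sym2 (fun S => N ≤ Y S) ≤
        (1 - q) * Pr p W.sym2 (fun S => N - 2 * m ≤ Y S) := by
      intro N hN
      rw [mem_filter] at hN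
      refine (split_bound hp W x hm (by omega)).trans ?_
      rw [mul_comm]
      exact mul_le_mul_of_nonneg_right hb (Pr_nn hp)
    refine (sum_le_sum e1).trans ?_
    have e2 : Set.InjOn (fun N => N - 2 * m) ((Finset.Icc 1 K).filter (fun N => 2 * m < N) : Finset ℕ) := by
      intro a ha b hb h
      simp only [Finset.coe_filter, Set.mem_ofPred_eq] at ha hb h
      omega
    rw [← Finset.sum_image (f := fun N => (1 - q) * Pr p W.sym2 (fun S => N ≤ Y S)) e2]
    refine sum_le_sum_of_subset_of_nonneg (fun N hN => ?_) fun N _ _ => mul_nonneg ((Pr_nn hp).trans hb) (Pr_nn hp)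
    obtain ⟨N', hN', rfl⟩ := Finset.mem_image.1 hN
    simp only [mem_filter, Finset.mem_Icc] at hN' ⊢; omega
  rw [hY]
  have h4 := sum_filter_add_sum_filter_not (Finset.Icc 1 K) (fun N => 2 * m < N) (fun N => Pr p W.sym2 (fun S => N ≤ Y S))
  rw [← h1] at h4
  rw [div_mul_eq_mul_div, le_div_iff₀ hq]
  change ex p W.sym2 (fun S => (Y S : ℝ)) * q ≤ 2 * ex p W.sym2 (fun S => (min (Y S) m : ℕ))
  linarith

lemma glue {J : Sym2 X → ℝ} (hJ : ∀ e, 0 ≤ J e) {β j₀ v : ℝ} (hβ : 0 ≤ β) (hj : 0 ≤ j₀) {W A B : Finset X}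
    (hA : A ⊆ W) (hB : B ⊆ W) (hAB : Disjoint A B) {m : ℕ} (hv : β * j₀ * m ^ 2 ≤ v)
    (hJ0 : ∀ a ∈ A, ∀ b ∈ B, j₀ ≤ J s(a, b)) (x u : X) :
    β * j₀ / (1 + v) * (ex (pb J β) A.sym2 (fun S => (min (cl S A x).card m : ℕ)) *
      ex (pb J β) B.sym2 (fun S => (min (cl S B u).card m : ℕ))) ≤ ta (pb J β) W x u := by
  have hp := pb_isP hJ hβ
  set p := pb J β with hpdef
  have h3 := link p hA hB hAB (fun S => cl S A x) (fun S => cl S B u) (fun S => cl_sub _ _ _) (fun S => cl_sub _ _ _)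
    (fun _ _ => 1)
  simp only [one_mul] at h3
  rw [← ex_indep p (sym2_mono hA) (sym2_mono hB) (sym2_disj hAB), ← ex_mul]
  have h4 : ex p W.sym2 (fun S => 1 - ∏ a ∈ cl (S ∩ A.sym2) A x, ∏ b ∈ cl (S ∩ B.sym2) B u, (1 - p s(a, b))) ≤ ta p W x u := by
    rw [ex_sub, ← h3, ← ex_sub]
    refine ex_mono hp fun S _ => ?_
    by_cases hc : ∀ a ∈ cl (S ∩ A.sym2) A x, ∀ b ∈ cl (S ∩ B.sym2) B u, s(a, b) ∉ S
    · rw [ind_t hc, sub_self]; exact ind_nn _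
    · rw [ind_f hc]
      push Not at hc
      obtain ⟨a, ha, b, hb, hab⟩ := hc
      rw [ind_t]
      · simp
      · exact cn_trans (cn_mono Finset.inter_subset_left (mem_cl.1 ha).2) (cn_trans (cn_edge hab)
          (cn_symm (cn_mono Finset.inter_subset_left (mem_cl.1 hb).2)))
  refine le_trans (ex_mono hp fun S _ => ?_) h4
  set k := (cl (S ∩ A.sym2) A x).card
  set k' := (cl (S ∩ B.sym2) B u).card
  set t := β * j₀ * ((min k m : ℕ) * (min k' m : ℕ)) with ht
  have ht0 : 0 ≤ t := by positivity
  have e1 : ∏ a ∈ cl (S ∩ A.sym2) A x, ∏ b ∈ cl (S ∩ B.sym2) B u, (1 - p s(a, b)) ≤ Real.exp (-t) := by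
    refine (prod_pb_le hβ (j₀ := j₀) fun a ha b hb => hJ0 _ (cl_sub _ _ _ ha) _ (cl_sub _ _ _ hb)).trans ?_
    rw [Real.exp_le_exp, neg_le_neg_iff]
    refine mul_le_mul_of_nonneg_left ?_ (by positivity)
    gcongr
    · exact min_le_left _ _
    · exact min_le_left _ _
  have htv : t ≤ v := by
    refine le_trans ?_ hv
    refine mul_le_mul_of_nonneg_left ?_ (by positivity)
    rw [sq]
    gcongr
    · exact min_le_right _ _
    · exact min_le_right _ _
  have e2 : Real.exp (-t) ≤ 1 / (1 + t) := by
    rw [Real.exp_neg, ← one_div]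
    exact one_div_le_one_div_of_le (by positivity) (by linarith [Real.add_one_le_exp t])
  have e3 : t / (1 + v) ≤ 1 - 1 / (1 + t) := by
    have : 1 - 1 / (1 + t) = t / (1 + t) := by field_simp; ring
    rw [this]
    exact div_le_div_of_nonneg_left ht0 (by positivity) (by linarith)
  calc β * j₀ / (1 + v) * (((min k m : ℕ) : ℝ) * ((min k' m : ℕ) : ℝ)) = t / (1 + v) := by rw [ht]; ring
    _ ≤ _ := by linarith
end stepB

section stepB2
open Classical
variable {d : ℕ} {J : V d → V d → ℝ} {α c C : ℝ}

noncomputable def qb (z : V d) (l : ℕ) : Finset (V d) := Fintype.piFinset fun i => Finset.Ico (z i) (z i + l)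

lemma mem_qb {z v : V d} {l : ℕ} : v ∈ qb z l ↔ ∀ i, z i ≤ v i ∧ v i < z i + l := by
  unfold qb; simp [Fintype.mem_piFinset]

lemma qb_card (z : V d) (l : ℕ) : (qb z l).card = l ^ d := by
  unfold qb; rw [Fintype.card_piFinset]; simp

lemma qb_shift (w z : V d) (l : ℕ) : shS w (qb z l) = qb (z + w) l := by
  ext v; rw [mem_shS, mem_qb, mem_qb]
  refine forall_congr' fun i => ?_
  simp only [Pi.sub_apply, Pi.add_apply]
  omega

lemma qb_di {z u v : V d} {l : ℕ} (hu : u ∈ qb z l) (hv : v ∈ qb z l) : di u v ≤ l := by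
  rw [di_le]; intro i
  have h1 := mem_qb.1 hu i
  have h2 := mem_qb.1 hv i
  omega

def dig {b : ℕ} (l : ℕ) (k : Fin d → Fin b) : V d := fun i => (l : ℤ) * (k i : ℕ)

lemma dig_sub {b : ℕ} (l : ℕ) (k : Fin d → Fin b) (z : V d) : qb (z + dig l k) l ⊆ qb z (b * l) := by
  intro v hv
  rw [mem_qb] at *
  intro i
  have h := hv i
  have hk : ((k i : ℕ) : ℤ) + 1 ≤ b := by exact_mod_cast (k i).2
  simp only [Pi.add_apply, dig] at h
  have h0 : (0:ℤ) ≤ (l:ℤ) * (k i : ℕ) := by positivity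
  have h1 : (l:ℤ) * ((k i : ℕ) + 1) ≤ (l:ℤ) * b := mul_le_mul_of_nonneg_left hk (by positivity)
  push_cast
  constructor
  · linarith [h.1]
  · nlinarith [h.2]

lemma dig_disj {b : ℕ} (l : ℕ) {k k' : Fin d → Fin b} (h : k ≠ k') (z : V d) :
    Disjoint (qb (z + dig l k) l) (qb (z + dig l k') l) := by
  rw [Finset.disjoint_left]
  intro v hv hv'
  apply h; funext i
  have h1 := mem_qb.1 hv i
  have h2 := mem_qb.1 hv' i
  simp only [Pi.add_apply, dig] at h1 h2
  apply Fin.ext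
  by_contra hne
  rcases lt_or_gt_of_ne hne with hlt | hlt
  · have e : ((k i : ℕ) : ℤ) + 1 ≤ (k' i : ℕ) := by exact_mod_cast hlt
    have := mul_le_mul_of_nonneg_left e (show (0:ℤ) ≤ l by positivity)
    linarith [h1.1, h1.2, h2.1, h2.2]
  · have e : ((k' i : ℕ) : ℤ) + 1 ≤ (k i : ℕ) := by exact_mod_cast hlt
    have := mul_le_mul_of_nonneg_left e (show (0:ℤ) ≤ l by positivity)
    linarith [h1.1, h1.2, h2.1, h2.2]

def bb (d : ℕ) : ℕ := if d = 1 then 64 else 8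

lemma bb_pos (d : ℕ) : 1 ≤ bb d := by unfold bb; split_ifs <;> norm_num

lemma bb_pow (hd : d = 1 ∨ d = 2) : bb d ^ d = 64 := by
  rcases hd with rfl | rfl <;> simp [bb]

lemma bb_rpow (hd : d = 1 ∨ d = 2) (hα : α = (d:ℝ) / 3) : (bb d : ℝ) ^ ((d:ℝ) + α) = 256 := by
  have h : (d:ℝ) + α = (d:ℝ) * (4 / 3) := by rw [hα]; ring
  have h64 : (bb d : ℝ) ^ d = 64 := by exact_mod_cast bb_pow hd
  rw [h, Real.rpow_mul (by positivity), Real.rpow_natCast, h64]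
  have : (64:ℝ) = (4:ℝ) ^ (3:ℝ) := by norm_num
  rw [this, ← Real.rpow_mul (by norm_num)]; norm_num

lemma cl_shift (w : V d) (S : Finset (Sym2 (V d))) (W : Finset (V d)) (x : V d) :
    cl (S.map (sh w).toEmbedding.sym2Map) (shS w W) (x + w) = shS w (cl S W x) := by
  ext v
  rw [mem_shS, mem_cl, mem_cl, mem_shS]
  have := cn_map_iff (sh w) (S := S) (x := x) (y := v - w)
  simp only [sh_apply, sub_add_cancel] at this
  rw [this]

lemma big_shift (w : V d) (S : Finset (Sym2 (V d))) (W : Finset (V d)) (m : ℕ) :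
    big (shS w W) m (S.map (sh w).toEmbedding.sym2Map) ↔ big W m S := by
  constructor
  · rintro ⟨y, hy, h⟩
    refine ⟨y - w, mem_shS.1 hy, ?_⟩
    rw [← card_shS w, ← cl_shift, sub_add_cancel]; exact h
  · rintro ⟨y, hy, h⟩
    refine ⟨y + w, by rw [mem_shS]; simpa using hy, ?_⟩
    rw [cl_shift, card_shS]; exact h

lemma Pr_big_shift (hJ : KernelHyp d J α c C) (β : ℝ) (w z : V d) (l m : ℕ) :
    Pr (pp J β) (qb (z + w) l).sym2 (fun S => ¬ big (qb (z + w) l) m S) =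
    Pr (pp J β) (qb z l).sym2 (fun S => ¬ big (qb z l) m S) := by
  rw [← qb_shift]
  unfold Pr
  have := ex_shift (sh w) (pp_shift hJ β w) (qb z l) (fun S => ind (¬ big (shS w (qb z l)) m S))
  refine this.trans (ex_congr fun S _ => ind_congr (not_congr (big_shift w S (qb z l) m)))

lemma Pr_not {ε : Type*} [DecidableEq ε] (p : ε → ℝ) (E : Finset ε) (A : Finset ε → Prop) :
    Pr p E (fun S => ¬ A S) = 1 - Pr p E A := by
  unfold Pr
  rw [← ex_const p E 1, ← ex_sub]
  exact ex_congr fun S _ => ind_not _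

noncomputable def qs : ℝ := 1 / (2 * 64 ^ 2)
noncomputable def v0 : ℝ := Real.log (4 * 64 ^ 4)

lemma v0_pos : 0 < v0 := Real.log_pos (by norm_num)

lemma qs_step {v : ℝ} (h : v0 ≤ v) : 64 ^ 2 * (qs ^ 2 + Real.exp (-v)) ≤ qs := by
  have h1 : Real.exp (-v) ≤ 1 / (4 * 64 ^ 4) := by
    calc Real.exp (-v) ≤ Real.exp (-v0) := Real.exp_le_exp.2 (by linarith)
      _ = _ := by rw [Real.exp_neg, v0, Real.exp_log (by norm_num)]; norm_num
  unfold qs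
  norm_num at h1 ⊢
  linarith

lemma J_low (hJ : KernelHyp d J α c C) {a b : V d} {l : ℕ} (hab : a ≠ b) (h : di a b ≤ l) :
    c * (l:ℝ) ^ (-((d:ℝ) + α)) ≤ J a b := by
  refine le_trans ?_ (J_ge hJ hab)
  refine mul_le_mul_of_nonneg_left ?_ hJ.c_pos.le
  rw [br_ne hab, neg_add']
  exact Real.rpow_le_rpow_of_nonpos (by exact_mod_cast di_pos hab) (by exact_mod_cast h)
    (by have := hJ.alpha_pos; have : (0:ℝ) ≤ d := by positivity
        linarith)

lemma bigiter (hd : d = 1 ∨ d = 2) (hα : α = (d:ℝ) / 3) (hJ : KernelHyp d J α c C) {β : ℝ} (hβ : 0 ≤ β)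
    {l m : ℕ} (hl : 1 ≤ l) (hm : 1 ≤ m)
    (hq : ∀ z : V d, Pr (pp J β) (qb z l).sym2 (fun S => ¬ big (qb z l) m S) ≤ qs)
    (hv : v0 ≤ β * (c * ((bb d * l : ℕ) : ℝ) ^ (-((d:ℝ) + α))) * (m:ℝ) ^ 2) (j : ℕ) :
    (∀ z : V d, Pr (pp J β) (qb z (bb d ^ j * l)).sym2 (fun S => ¬ big (qb z (bb d ^ j * l)) (63 ^ j * m) S) ≤ qs) ∧
    v0 ≤ β * (c * ((bb d * (bb d ^ j * l) : ℕ) : ℝ) ^ (-((d:ℝ) + α))) * ((63 ^ j * m : ℕ) : ℝ) ^ 2 := by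
  have hc := hJ.c_pos
  induction j with
  | zero =>
    rw [pow_zero, pow_zero, one_mul, one_mul]; exact ⟨hq, hv⟩
  | succ j ih =>
    obtain ⟨h1, h2⟩ := ih
    constructor
    · intro z
      have hpos : 1 ≤ 63 ^ j * m := Nat.succ_le_of_lt (by positivity)
      have := big_step (Jt_nn hJ) (β := β) (j₀ := c * ((bb d * (bb d ^ j * l) : ℕ) : ℝ) ^ (-((d:ℝ) + α))) (q := qs) hβ
        (by positivity) (W := qb z (bb d * (bb d ^ j * l))) (ι := Fin d → Fin (bb d))
        (by rw [Fintype.card_fun, Fintype.card_fin, Fintype.card_fin]; exact bb_pow hd)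
        (fun k => qb (z + dig (bb d ^ j * l) k) (bb d ^ j * l)) (fun k => dig_sub _ _ _) (fun k k' h => dig_disj _ h z)
        hpos (fun k => h1 _) (fun a ha b hb hab => by
          rw [Jt_mk hJ]; exact J_low hJ hab (qb_di ha hb))
      rw [show bb d ^ (j + 1) * l = bb d * (bb d ^ j * l) by ring, show 63 ^ (j+1) * m = 63 * (63 ^ j * m) by ring]
      exact this.trans (qs_step h2)
    · refine h2.trans ?_
      rw [show bb d * (bb d ^ (j + 1) * l) = bb d * (bb d * (bb d ^ j * l)) by ring,
        show 63 ^ (j+1) * m = 63 * (63 ^ j * m) by ring]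
      rw [Nat.cast_mul (bb d) (bb d * (bb d ^ j * l)), Real.mul_rpow (by positivity) (by positivity),
        Real.rpow_neg (x := (bb d : ℝ)) (by positivity) ((d:ℝ) + α), bb_rpow hd hα]
      rw [Nat.cast_mul 63]
      set t := ((bb d * (bb d ^ j * l) : ℕ) : ℝ) ^ (-((d:ℝ) + α))
      set n := ((63 ^ j * m : ℕ) : ℝ)
      have ht : 0 ≤ β * (c * t) * n ^ 2 := by positivity
      have : β * (c * ((256:ℝ)⁻¹ * t)) * (((63:ℕ):ℝ) * n) ^ 2 = (3969 / 256) * (β * (c * t) * n ^ 2) := by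
        push_cast; ring
      rw [this]; linarith

lemma big_sq {S : Finset (Sym2 (V d))} {W : Finset (V d)} {n : ℕ} (h : big W n S) :
    (n:ℝ) ^ 2 ≤ ∑ x ∈ W, ((cl S W x).card : ℝ) := by
  obtain ⟨y, hy, hn⟩ := h
  have hn' : (n:ℝ) ≤ (cl S W y).card := by exact_mod_cast hn
  calc (n:ℝ) ^ 2 ≤ ((cl S W y).card : ℝ) * (cl S W y).card := by
        rw [sq]; exact mul_le_mul hn' hn' (by positivity) (by positivity)
    _ = ∑ x ∈ cl S W y, ((cl S W y).card : ℝ) := by simp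
    _ = ∑ x ∈ cl S W y, ((cl S W x).card : ℝ) := sum_congr rfl fun x hx => by
        rw [cl_eq W (mem_cl.1 hx).2]
    _ ≤ _ := sum_le_sum_of_subset_of_nonneg (cl_sub _ _ _) fun _ _ _ => by positivity

lemma big_ex (hJ : KernelHyp d J α c C) {β M : ℝ} (hβ : 0 ≤ β) (hB : Bdd J β M) (W : Finset (V d)) (n : ℕ) :
    (n:ℝ) ^ 2 * Pr (pp J β) W.sym2 (big W n) ≤ W.card * M := by
  calc (n:ℝ) ^ 2 * Pr (pp J β) W.sym2 (big W n) ≤ ex (pp J β) W.sym2 (fun S => ∑ x ∈ W, ((cl S W x).card : ℝ)) := by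
        unfold Pr; rw [← ex_mul]
        refine ex_mono (pp_isP hJ hβ) fun S _ => ?_
        by_cases h : big W n S
        · rw [ind_t h, mul_one]; exact big_sq h
        · rw [ind_f h, mul_zero]; positivity
    _ = ∑ x ∈ W, ∑ u ∈ W, tau J β W x u := by
        rw [ex_sum]
        refine sum_congr rfl fun x _ => ?_
        unfold tau ta Pr; rw [← ex_sum]
        exact ex_congr fun S _ => cl_card _ _ _
    _ ≤ ∑ x ∈ W, M := sum_le_sum fun x _ => hB W x
    _ = _ := by simp

lemma notbig (hd : d = 1 ∨ d = 2) (hα : α = (d:ℝ) / 3) (hJ : KernelHyp d J α c C) {β M : ℝ} (hβ : 0 ≤ β)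
    (hB : Bdd J β M) {l m : ℕ} (hl : 1 ≤ l) (hm : 1 ≤ m)
    (hv : v0 ≤ β * (c * ((bb d * l : ℕ) : ℝ) ^ (-((d:ℝ) + α))) * (m:ℝ) ^ 2) (z : V d) :
    Pr (pp J β) (qb z l).sym2 (big (qb z l) m) ≤ 1 - qs := by
  by_contra hc
  push Not at hc
  have hq : ∀ z' : V d, Pr (pp J β) (qb z' l).sym2 (fun S => ¬ big (qb z' l) m S) ≤ qs := by
    intro z'
    have := Pr_big_shift hJ β (z' - z) z l m
    rw [add_sub_cancel] at this
    rw [this, Pr_not]; linarith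
  have key : ∀ j : ℕ, (2:ℝ) ^ j ≤ 2 * l ^ d * M := by
    intro j
    have h1 := (bigiter hd hα hJ hβ hl hm hq hv j).1 0
    rw [Pr_not] at h1
    have h2 := big_ex hJ hβ hB (qb (0 : V d) (bb d ^ j * l)) (63 ^ j * m)
    have hqs : qs ≤ 1 / 2 := by unfold qs; norm_num
    rw [qb_card, mul_pow, ← pow_mul, mul_comm j d, pow_mul, bb_pow hd] at h2
    set A := Pr (pp J β) (qb (0 : V d) (bb d ^ j * l)).sym2 (big (qb (0 : V d) (bb d ^ j * l)) (63 ^ j * m))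
    have hA : 1 / 2 ≤ A := by linarith
    push_cast at h2
    have hm1 : (1:ℝ) ≤ m := by exact_mod_cast hm
    have e1 : (64:ℝ) ^ j * 2 ^ j ≤ ((63:ℝ) ^ j * m) ^ 2 := by
      calc (64:ℝ) ^ j * 2 ^ j = (128:ℝ) ^ j := by rw [← mul_pow]; norm_num
        _ ≤ (3969:ℝ) ^ j := pow_le_pow_left₀ (by norm_num) (by norm_num) j
        _ = ((63:ℝ) ^ j) ^ 2 := by rw [← pow_mul, mul_comm, pow_mul]; norm_num
        _ ≤ ((63:ℝ) ^ j * m) ^ 2 := by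
          refine pow_le_pow_left₀ (by positivity) ?_ 2
          exact le_mul_of_one_le_right (by positivity) hm1
    have e2 : (64:ℝ) ^ j * 2 ^ j * (1 / 2) ≤ 64 ^ j * l ^ d * M :=
      (mul_le_mul e1 hA (by norm_num) (by positivity)).trans h2
    have e3 : (0:ℝ) < 64 ^ j := by positivity
    have : (64:ℝ) ^ j * 2 ^ j ≤ 64 ^ j * (2 * l ^ d * M) := by linarith
    exact le_of_mul_le_mul_left this e3
  obtain ⟨j, hj⟩ := pow_unbounded_of_one_lt (2 * (l:ℝ) ^ d * M) (by norm_num : (1:ℝ) < 2)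
  linarith [key j]

lemma qs_pos : 0 < qs := by unfold qs; norm_num

lemma bc_lt (hd : d = 1 ∨ d = 2) (hα : α = (d:ℝ) / 3) (hJ : KernelHyp d J α c C) {β M : ℝ} (hβ : 0 ≤ β)
    (hB : Bdd J β M) : β * c ≤ 256 * v0 := by
  by_contra hc
  push Not at hc
  have h := notbig hd hα hJ hβ hB (l := 1) (m := 1) le_rfl le_rfl (by
    rw [mul_one, Real.rpow_neg (by positivity), bb_rpow hd hα]; push_cast; linarith) 0
  have h1 : Pr (pp J β) (qb (0 : V d) 1).sym2 (big (qb (0 : V d) 1) 1) = 1 := by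
    rw [← ex_const (pp J β) (qb (0 : V d) 1).sym2 1]
    refine ex_congr fun S _ => ind_t ⟨0, mem_qb.2 fun i => by simp, ?_⟩
    exact Finset.card_pos.2 ⟨0, mem_cl.2 ⟨mem_qb.2 fun i => by simp, cn_refl _ _⟩⟩
  linarith [qs_pos]

theorem BS_bdd (hd : d = 1 ∨ d = 2) (hα : α = (d:ℝ) / 3) (hJ : KernelHyp d J α c C) : BddAbove (BS J) := by
  refine ⟨256 * v0 / c, ?_⟩
  rintro β ⟨hβ, M, hB⟩
  rw [le_div_iff₀ hJ.c_pos]; exact bc_lt hd hα hJ hβ hB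

noncomputable def Tq (J : V d → V d → ℝ) (β : ℝ) (l : ℕ) : ℝ := ∑ x ∈ qb (0 : V d) l, ∑ u ∈ qb (0 : V d) l, tau J β (qb 0 l) x u

lemma Tq_shift (hJ : KernelHyp d J α c C) (β : ℝ) (z : V d) (l : ℕ) :
    ∑ x ∈ qb z l, ∑ u ∈ qb z l, tau J β (qb z l) x u = Tq J β l := by
  have : qb z l = shS z (qb 0 l) := by rw [qb_shift, zero_add]
  rw [this, sum_shS]
  refine sum_congr rfl fun x _ => ?_
  rw [sum_shS]
  exact sum_congr rfl fun u _ => tau_shift hJ β z _ _ _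

lemma Tq_step (hd : d = 1 ∨ d = 2) (hα : α = (d:ℝ) / 3) (hJ : KernelHyp d J α c C) {β M : ℝ} (hβ : 0 < β)
    (hB : Bdd J β M) {l : ℕ} (hl : 1 ≤ l) :
    β * (c * ((2 * l : ℕ) : ℝ) ^ (-((d:ℝ) + α))) / (1 + 1024 * v0) * (qs / 2 * Tq J β l) ^ 2 ≤ Tq J β (2 * l) := by
  have hc := hJ.c_pos
  have hv0 := v0_pos
  have hqs := qs_pos
  have hl0 : (0:ℝ) < l := by exact_mod_cast hl
  have hb0 : (0:ℝ) < bb d := by exact_mod_cast bb_pos d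
  have hD : 0 < (d:ℝ) + α := by have := hJ.alpha_pos; positivity
  set D := (d:ℝ) + α with hDdef
  set t := v0 * ((bb d * l : ℕ):ℝ) ^ D / (β * c) with ht
  have ht0 : 0 < t := by
    have : (0:ℝ) < ((bb d * l : ℕ):ℝ) := by push_cast; positivity
    positivity
  set m := ⌈√t⌉₊ with hm
  have hm1 : 1 ≤ m := Nat.one_le_ceil_iff.2 (Real.sqrt_pos.2 ht0)
  have hmt : t ≤ (m:ℝ) ^ 2 := by
    calc t = √t ^ 2 := (Real.sq_sqrt ht0.le).symm
      _ ≤ _ := pow_le_pow_left₀ (Real.sqrt_nonneg _) (Nat.le_ceil _) 2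
  have hmt' : (m:ℝ) ^ 2 ≤ 2 * t + 2 := by
    have h1 : (m:ℝ) < √t + 1 := Nat.ceil_lt_add_one (Real.sqrt_nonneg _)
    have h2 : (m:ℝ) ^ 2 ≤ (√t + 1) ^ 2 := pow_le_pow_left₀ (by positivity) h1.le 2
    nlinarith [Real.sq_sqrt ht0.le, sq_nonneg (√t - 1)]
  have hbl : (0:ℝ) < ((bb d * l : ℕ):ℝ) ^ D := Real.rpow_pos_of_pos (by push_cast; positivity) _
  have hv : v0 ≤ β * (c * ((bb d * l : ℕ) : ℝ) ^ (-D)) * (m:ℝ) ^ 2 := by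
    have : β * (c * ((bb d * l : ℕ) : ℝ) ^ (-D)) * t = v0 := by
      rw [ht, Real.rpow_neg (by positivity)]; field_simp
    rw [← this]
    exact mul_le_mul_of_nonneg_left hmt (by positivity)
  set j₀ := c * ((2 * l : ℕ) : ℝ) ^ (-D) with hj
  have hj0 : 0 ≤ j₀ := by positivity
  have hv1 : β * j₀ * (m:ℝ) ^ 2 ≤ 1024 * v0 := by
    have e1 : ((2 * l : ℕ) : ℝ) ^ (-D) ≤ (l:ℝ) ^ (-D) := Real.rpow_le_rpow_of_nonpos hl0 (by push_cast; linarith) (by linarith)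
    have e2 : (l:ℝ) ^ (-D) ≤ 1 := Real.rpow_le_one_of_one_le_of_nonpos (by exact_mod_cast hl) (by linarith)
    have e3 : β * j₀ ≤ β * (c * (l:ℝ) ^ (-D)) := by
      rw [hj]; gcongr
    have e4 : β * (c * (l:ℝ) ^ (-D)) * t = 256 * v0 := by
      rw [ht, Nat.cast_mul, Real.mul_rpow hb0.le hl0.le, bb_rpow hd hα, Real.rpow_neg hl0.le]
      have : (l:ℝ) ^ D ≠ 0 := (Real.rpow_pos_of_pos hl0 _).ne'
      field_simp
    have e5 : β * (c * (l:ℝ) ^ (-D)) ≤ β * c := by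
      refine mul_le_mul_of_nonneg_left ?_ hβ.le
      exact mul_le_of_le_one_right hc.le e2
    have e6 := bc_lt hd hα hJ hβ.le hB
    calc β * j₀ * (m:ℝ) ^ 2 ≤ β * (c * (l:ℝ) ^ (-D)) * (2 * t + 2) := mul_le_mul e3 hmt' (by positivity) (by positivity)
      _ ≤ 1024 * v0 := by linarith
  have hd0 : 0 < d := by rcases hd with rfl | rfl <;> norm_num
  set e : V d := fun i => (l : ℤ) * (if i = ⟨0, hd0⟩ then 1 else 0) with he
  set A := qb (0 : V d) l
  set B := qb e l
  set W := qb (0 : V d) (2 * l)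
  have hA : A ⊆ W := fun v hv => mem_qb.2 fun i => by
    have := mem_qb.1 hv i; push_cast; omega
  have hBW : B ⊆ W := fun v hv => mem_qb.2 fun i => by
    have := mem_qb.1 hv i; push_cast; simp only [he, Pi.zero_apply] at *; split_ifs at this <;> omega
  have hAB : Disjoint A B := Finset.disjoint_left.2 fun v hv hv' => by
    have h1 := mem_qb.1 hv ⟨0, hd0⟩
    have h2 := mem_qb.1 hv' ⟨0, hd0⟩
    simp only [he, Pi.zero_apply, if_true] at h1 h2; omega
  have hP := pp_isP hJ hβ.le
  set fA : V d → ℝ := fun x => ex (pb (Jt J) β) A.sym2 (fun S => (min (cl S A x).card m : ℕ))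
  set fB : V d → ℝ := fun x => ex (pb (Jt J) β) B.sym2 (fun S => (min (cl S B x).card m : ℕ))
  have hglue : ∀ x u, β * j₀ / (1 + 1024 * v0) * (fA x * fB u) ≤ tau J β W x u := fun x u =>
    glue (Jt_nn hJ) hβ.le hj0 hA hBW hAB hv1 (fun a ha b hb => by
      rw [Jt_mk hJ]
      refine J_low hJ ?_ (qb_di (hA ha) (hBW hb))
      rintro rfl; exact Finset.disjoint_left.1 hAB ha hb) x u
  have hTA : qs / 2 * Tq J β l ≤ ∑ x ∈ A, fA x := by
    rw [← Tq_shift hJ β 0 l, mul_sum]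
    refine sum_le_sum fun x _ => ?_
    have := trunc hP A x hm1 qs_pos (notbig hd hα hJ hβ.le hB hl hm1 hv 0)
    calc qs / 2 * ∑ u ∈ A, tau J β A x u ≤ qs / 2 * (2 / qs * fA x) := mul_le_mul_of_nonneg_left this (by positivity)
      _ = fA x := by field_simp
  have hTB : qs / 2 * Tq J β l ≤ ∑ x ∈ B, fB x := by
    rw [← Tq_shift hJ β e l, mul_sum]
    refine sum_le_sum fun x _ => ?_
    have := trunc hP B x hm1 qs_pos (notbig hd hα hJ hβ.le hB hl hm1 hv e)
    calc qs / 2 * ∑ u ∈ B, tau J β B x u ≤ qs / 2 * (2 / qs * fB x) := mul_le_mul_of_nonneg_left this (by positivity)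
      _ = fB x := by field_simp
  have hT0 : 0 ≤ Tq J β l := sum_nonneg fun x _ => sum_nonneg fun u _ => tau_nn hJ hβ.le _ _ _
  calc β * j₀ / (1 + 1024 * v0) * (qs / 2 * Tq J β l) ^ 2
      ≤ β * j₀ / (1 + 1024 * v0) * ((∑ x ∈ A, fA x) * ∑ u ∈ B, fB u) := by
        refine mul_le_mul_of_nonneg_left ?_ (by positivity)
        rw [sq]; exact mul_le_mul hTA hTB (by positivity) (le_trans (by positivity) hTA)
    _ = ∑ x ∈ A, ∑ u ∈ B, β * j₀ / (1 + 1024 * v0) * (fA x * fB u) := by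
        rw [Finset.sum_mul_sum, mul_sum]
        exact sum_congr rfl fun x _ => mul_sum _ _ _
    _ ≤ ∑ x ∈ A, ∑ u ∈ B, tau J β W x u := sum_le_sum fun x _ => sum_le_sum fun u _ => hglue x u
    _ ≤ ∑ x ∈ A, ∑ u ∈ W, tau J β W x u := sum_le_sum fun x _ =>
        sum_le_sum_of_subset_of_nonneg hBW fun u _ _ => tau_nn hJ hβ.le _ _ _
    _ ≤ Tq J β (2 * l) := sum_le_sum_of_subset_of_nonneg hA fun x _ _ =>
        sum_nonneg fun u _ => tau_nn hJ hβ.le _ _ _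

noncomputable def kB (d : ℕ) (α c β₀ : ℝ) : ℝ :=
  β₀ * (c * (2:ℝ) ^ (-((d:ℝ) + α))) / (1 + 1024 * v0) * (qs / 2) ^ 2 * (2:ℝ) ^ (-((d:ℝ) + α))

set_option maxHeartbeats 1000000 in
lemma Tq_le (hd : d = 1 ∨ d = 2) (hα : α = (d:ℝ) / 3) (hJ : KernelHyp d J α c C) {β β₀ M : ℝ} (h0 : 0 < β₀) (hβ : β₀ ≤ β)
    (hB : Bdd J β M) {l : ℕ} (hl : 1 ≤ l) : kB d α c β₀ * (Tq J β l * (l:ℝ) ^ (-((d:ℝ) + α))) < 1 := by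
  have hc := hJ.c_pos
  have hv0 := v0_pos
  have hqs := qs_pos
  have ha := hJ.alpha_pos
  set D := (d:ℝ) + α with hDdef
  have hk : 0 < kB d α c β₀ := by unfold kB; positivity
  have hT0 : ∀ l, 0 ≤ Tq J β l := fun l => sum_nonneg fun x _ => sum_nonneg fun u _ => tau_nn hJ (h0.le.trans hβ) _ _ _
  set y : ℕ → ℝ := fun l => kB d α c β₀ * (Tq J β l * (l:ℝ) ^ (-D)) with hy
  have hstep : ∀ l, 1 ≤ l → y l ^ 2 ≤ y (2 * l) := by
    intro l hl
    have hl0 : (0:ℝ) < l := by exact_mod_cast hl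
    have h1 := Tq_step hd hα hJ (lt_of_lt_of_le h0 hβ) hB hl
    have e : ((2 * l : ℕ) : ℝ) ^ (-D) = 2 ^ (-D) * (l:ℝ) ^ (-D) := by
      rw [Nat.cast_mul, Real.mul_rpow (by positivity) (by positivity)]; norm_num
    simp only [hy]
    rw [← hDdef, e] at h1
    rw [e]
    set p2 := (2:ℝ) ^ (-D)
    set pl := (l:ℝ) ^ (-D)
    have hp2 : 0 < p2 := by positivity
    have hpl : 0 < pl := Real.rpow_pos_of_pos hl0 _
    have h2 : β₀ * (c * (p2 * pl)) / (1 + 1024 * v0) * (qs / 2 * Tq J β l) ^ 2 ≤ Tq J β (2 * l) := by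
      refine le_trans ?_ h1
      refine mul_le_mul_of_nonneg_right ?_ (sq_nonneg _)
      refine div_le_div_of_nonneg_right ?_ (by linarith)
      exact mul_le_mul_of_nonneg_right hβ (mul_nonneg hc.le (mul_nonneg hp2.le hpl.le))
    calc (kB d α c β₀ * (Tq J β l * pl)) ^ 2
        = kB d α c β₀ * ((β₀ * (c * (p2 * pl)) / (1 + 1024 * v0) * (qs / 2 * Tq J β l) ^ 2) * (p2 * pl)) := by
          unfold kB; simp only [← hDdef]; ring
      _ ≤ _ := mul_le_mul_of_nonneg_left (mul_le_mul_of_nonneg_right h2 (by positivity)) hk.le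
  by_contra hcon
  push Not at hcon
  have hge : ∀ j : ℕ, 1 ≤ y (2 ^ j * l) := by
    intro j
    induction j with
    | zero => simpa using hcon
    | succ j ih =>
      rw [show 2 ^ (j + 1) * l = 2 * (2 ^ j * l) by ring]
      refine le_trans ?_ (hstep _ (Nat.succ_le_of_lt (by positivity)))
      exact one_le_pow₀ ih
  have hup : ∀ n : ℕ, 1 ≤ n → y n ≤ kB d α c β₀ * (M * (n:ℝ) ^ (-α)) := by
    intro n hn
    have hn0 : (0:ℝ) < n := by exact_mod_cast hn
    refine mul_le_mul_of_nonneg_left ?_ hk.le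
    have : Tq J β n ≤ (n:ℝ) ^ (d:ℝ) * M := by
      calc Tq J β n ≤ ∑ x ∈ qb (0 : V d) n, M := sum_le_sum fun x _ => hB _ x
        _ = _ := by rw [sum_const, qb_card, nsmul_eq_mul, Real.rpow_natCast]; push_cast; ring
    calc Tq J β n * (n:ℝ) ^ (-D) ≤ (n:ℝ) ^ (d:ℝ) * M * (n:ℝ) ^ (-D) := mul_le_mul_of_nonneg_right this (by positivity)
      _ = M * ((n:ℝ) ^ (d:ℝ) * (n:ℝ) ^ (-D)) := by ring
      _ = _ := by rw [← Real.rpow_add hn0, hDdef]; congr 2; ring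
  have hlim : Filter.Tendsto (fun n : ℕ => kB d α c β₀ * (M * (n:ℝ) ^ (-α))) Filter.atTop (nhds 0) := by
    have := ((tendsto_rpow_neg_atTop ha).comp tendsto_natCast_atTop_atTop).const_mul M |>.const_mul (kB d α c β₀)
    simpa using this
  obtain ⟨N, hN⟩ := Filter.eventually_atTop.1 (hlim.eventually (gt_mem_nhds (show (0:ℝ) < 1 by norm_num)))
  have hle : N ≤ 2 ^ N * l := by
    calc N ≤ 2 ^ N := Nat.lt_two_pow_self.le
      _ ≤ 2 ^ N * l := Nat.le_mul_of_pos_right _ hl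
  have h3 := hN _ hle
  have h4 := hup (2 ^ N * l) (Nat.succ_le_of_lt (by positivity))
  have h5 := hge N
  linarith

theorem stepB (hd : d = 1 ∨ d = 2) (hα : α = (d:ℝ) / 3) (hJ : KernelHyp d J α c C) {β₀ : ℝ} (h0 : 0 < β₀) :
    ∃ CB : ℝ, 0 < CB ∧ ∀ β, β₀ ≤ β → (∃ M, Bdd J β M) → ∀ (R : ℕ), 1 ≤ R → ∀ (x : V d) (W : Finset (V d)),
      (∀ u ∈ W, di x u ≤ R) → ∑ u ∈ W, tau J β W x u ≤ CB * (R:ℝ) ^ α := by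
  have hc := hJ.c_pos
  have hv0 := v0_pos
  have hqs := qs_pos
  have ha := hJ.alpha_pos
  have hk : 0 < kB d α c β₀ := by unfold kB; positivity
  refine ⟨(3:ℝ) ^ ((d:ℝ) + α) / kB d α c β₀, by positivity, ?_⟩
  rintro β hβ ⟨M, hB⟩ R hR x W hW
  have hβ0 : 0 ≤ β := h0.le.trans hβ
  have hR0 : (0:ℝ) < R := by exact_mod_cast hR
  set S := ∑ u ∈ W, tau J β W x u
  have h1 := Tq_le hd hα hJ h0 hβ hB (l := 3 * R) (by omega)
  have h2 : (R:ℝ) ^ (d:ℝ) * S ≤ Tq J β (3 * R) := by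
    have e1 : ∀ x' ∈ qb (fun _ => (R:ℤ) : V d) R, S ≤ ∑ u ∈ qb (0 : V d) (3 * R), tau J β (qb 0 (3 * R)) x' u := by
      intro x' hx'
      have hsub : shS (x' - x) W ⊆ qb (0 : V d) (3 * R) := by
        intro v hv
        have h := di_le.1 (hW _ (mem_shS.1 hv))
        rw [mem_qb]; intro i
        have h3 := h i
        have h4 := mem_qb.1 hx' i
        simp only [Pi.sub_apply, Pi.zero_apply] at *
        push_cast; omega
      calc S = ∑ u ∈ shS (x' - x) W, tau J β (shS (x' - x) W) x' u := by
            rw [sum_shS]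
            refine sum_congr rfl fun u _ => ?_
            have := tau_shift hJ β (x' - x) W x u
            rw [add_sub_cancel] at this; exact this.symm
        _ ≤ ∑ u ∈ shS (x' - x) W, tau J β (qb 0 (3 * R)) x' u := sum_le_sum fun u _ => tau_mono hJ hβ0 hsub _ _
        _ ≤ _ := sum_le_sum_of_subset_of_nonneg hsub fun u _ _ => tau_nn hJ hβ0 _ _ _
    calc (R:ℝ) ^ (d:ℝ) * S = ∑ x' ∈ qb (fun _ => (R:ℤ) : V d) R, S := by
          rw [sum_const, qb_card, nsmul_eq_mul, Real.rpow_natCast]; push_cast; ring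
      _ ≤ _ := sum_le_sum e1
      _ ≤ _ := by
        refine sum_le_sum_of_subset_of_nonneg (fun v hv => ?_) fun x _ _ => sum_nonneg fun u _ => tau_nn hJ hβ0 _ _ _
        rw [mem_qb] at *
        intro i; have := hv i
        simp only [Pi.zero_apply] at *; push_cast; omega
  rw [div_mul_eq_mul_div, le_div_iff₀ hk]
  have e3 : ((3 * R : ℕ):ℝ) ^ (-((d:ℝ) + α)) = ((3:ℝ) ^ ((d:ℝ) + α) * (R:ℝ) ^ ((d:ℝ) + α))⁻¹ := by
    rw [Nat.cast_mul, Real.rpow_neg (by positivity), Real.mul_rpow (by positivity) (by positivity)]; norm_num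
  rw [e3] at h1
  have hRd : 0 < (R:ℝ) ^ (d:ℝ) := by positivity
  have hRa : 0 < (R:ℝ) ^ α := by positivity
  have h3d : 0 < (3:ℝ) ^ ((d:ℝ) + α) := by positivity
  rw [Real.rpow_add hR0] at h1
  have h5 : kB d α c β₀ * Tq J β (3 * R) ≤ (3:ℝ) ^ ((d:ℝ) + α) * ((R:ℝ) ^ (d:ℝ) * (R:ℝ) ^ α) := by
    rw [← mul_assoc, mul_inv_lt_iff₀ (by positivity), one_mul] at h1
    exact h1.le
  have h6 : (R:ℝ) ^ (d:ℝ) * (S * kB d α c β₀) ≤ (R:ℝ) ^ (d:ℝ) * ((3:ℝ) ^ ((d:ℝ) + α) * (R:ℝ) ^ α) := by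
    have := mul_le_mul_of_nonneg_left h2 hk.le
    linarith
  exact le_of_mul_le_mul_left h6 hRd

end stepB2

section stepC
open Classical
variable {d : ℕ} {J : V d → V d → ℝ} {α c C : ℝ}

noncomputable def nn (x : V d) (k : ℕ) (a b : V d) : ℕ := ((Finset.Ico k (2 * k)).filter (fun j => di x a ≤ j ∧ j < di x b)).card

lemma nn_le_k (x : V d) (k : ℕ) (a b : V d) : nn x k a b ≤ k := by
  refine (Finset.card_filter_le _ _).trans ?_
  simp; omega

lemma nn_le_di (x : V d) (k : ℕ) (a b : V d) : nn x k a b ≤ di a b := by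
  have h : (Finset.Ico k (2 * k)).filter (fun j => di x a ≤ j ∧ j < di x b) ⊆ Finset.Ico (di x a) (di x b) := fun j hj => by
    rw [mem_filter] at hj; rw [Finset.mem_Ico]; exact hj.2
  have h1 := card_le_card h
  rw [Nat.card_Ico] at h1
  have := di_tri x a b
  unfold nn; omega

lemma nn_zero {x : V d} {k : ℕ} {a b : V d} (h : di x b ≤ k) : nn x k a b = 0 := by
  unfold nn; rw [Finset.card_eq_zero, Finset.filter_eq_empty_iff]
  intro j hj; rw [Finset.mem_Ico] at hj; omega

lemma avg (x : V d) (k : ℕ) (W : Finset (V d)) (f : V d → V d → ℝ) (hf : ∀ a b, 0 ≤ f a b) :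
    ∑ j ∈ Finset.Ico k (2 * k), ∑ a ∈ W ∩ bx x j, ∑ b ∈ W \ bx x j, f a b ≤
      ∑ b ∈ W, ∑ a ∈ W ∩ bx x (2 * k), (nn x k a b : ℝ) * f a b := by
  calc ∑ j ∈ Finset.Ico k (2 * k), ∑ a ∈ W ∩ bx x j, ∑ b ∈ W \ bx x j, f a b
      ≤ ∑ j ∈ Finset.Ico k (2 * k), ∑ a ∈ W ∩ bx x (2 * k), ∑ b ∈ W, ind (di x a ≤ j ∧ j < di x b) * f a b := by
        refine sum_le_sum fun j hj => ?_
        rw [Finset.mem_Ico] at hj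
        have hsub : W ∩ bx x j ⊆ W ∩ bx x (2 * k) := Finset.inter_subset_inter_left (bx_mono (by omega))
        refine le_trans ?_ (sum_le_sum_of_subset_of_nonneg hsub fun a _ _ => sum_nonneg fun b _ => mul_nonneg (ind_nn _) (hf _ _))
        refine sum_le_sum fun a ha => ?_
        refine le_trans ?_ (sum_le_sum_of_subset_of_nonneg (Finset.sdiff_subset (t := bx x j)) fun b _ _ => mul_nonneg (ind_nn _) (hf _ _))
        refine sum_le_sum fun b hb => ?_
        rw [Finset.mem_inter, mem_bx] at ha
        rw [mem_sdiff, mem_bx] at hb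
        rw [ind_t ⟨ha.2, by omega⟩, one_mul]
    _ = ∑ b ∈ W, ∑ a ∈ W ∩ bx x (2 * k), ∑ j ∈ Finset.Ico k (2 * k), ind (di x a ≤ j ∧ j < di x b) * f a b := by
        rw [sum_comm]
        rw [sum_congr rfl fun a _ => sum_comm]
        rw [sum_comm]
    _ = _ := by
        refine sum_congr rfl fun b _ => sum_congr rfl fun a _ => ?_
        rw [← sum_mul]
        congr 1
        unfold nn
        rw [Finset.card_filter]; push_cast
        refine sum_congr rfl fun j _ => ?_
        unfold ind; congr

lemma SLavg (hJ : KernelHyp d J α c C) {β : ℝ} (hβ : 0 ≤ β) (W : Finset (V d)) {x y : V d} (k : ℕ) (t : ℝ)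
    (ht : ∀ j ∈ Finset.Ico k (2 * k), tau J β (W ∩ bx x j) x y ≤ t) :
    (k:ℝ) * tau J β W x y ≤ k * t + ∑ b ∈ W, ∑ a ∈ W ∩ bx x (2 * k),
      (nn x k a b : ℝ) * (tau J β (W ∩ bx x (2 * k)) x a * (β * J a b) * tau J β W b y) := by
  have hp := pp_isP hJ hβ
  have h1 : ∀ j ∈ Finset.Ico k (2 * k), tau J β W x y ≤ t + ∑ a ∈ W ∩ bx x j, ∑ b ∈ W \ bx x j,
      tau J β (W ∩ bx x (2 * k)) x a * (β * J a b) * tau J β W b y := by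
    intro j hj
    refine (SL_in hp W (bx x j) (bx_self x j)).trans (add_le_add (ht j hj) ?_)
    rw [Finset.mem_Ico] at hj
    refine sum_le_sum fun a _ => sum_le_sum fun b _ => ?_
    refine mul_le_mul_of_nonneg_right ?_ (tau_nn hJ hβ _ _ _)
    exact mul_le_mul (tau_mono hJ hβ (Finset.inter_subset_inter_left (bx_mono (by omega))) _ _) (pp_le hJ a b) (hp _).1
      (tau_nn hJ hβ _ _ _)
  have h2 := sum_le_sum h1
  rw [sum_add_distrib, sum_const, sum_const, Nat.card_Ico, nsmul_eq_mul, nsmul_eq_mul,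
    show 2 * k - k = k by omega] at h2
  refine h2.trans (add_le_add le_rfl ?_)
  exact avg x k W (fun a b => tau J β (W ∩ bx x (2 * k)) x a * (β * J a b) * tau J β W b y) fun a b =>
    mul_nonneg (mul_nonneg (tau_nn hJ hβ _ _ _) (mul_nonneg hβ (hJ.nonneg _ _))) (tau_nn hJ hβ _ _ _)

lemma near (hd : d = 1 ∨ d = 2) (hα : α < 1) (hJ : KernelHyp d J α c C) (b : V d) (W : Finset (V d)) {r : ℝ} (hr : 0 ≤ r)
    (hW : ∀ a ∈ W, (di a b : ℝ) ≤ r) : ∑ a ∈ W, J a b * di a b ≤ C * (9 / (1 - α)) * r ^ (1 - α) := by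
  have hC : 0 ≤ C := hJ.c_pos.le.trans hJ.c_le_C
  have h1a : 0 < 1 - α := by linarith
  have hdi : ∀ a ∈ W, di b a ≤ ⌊r⌋₊ := fun a ha => by rw [di_comm]; exact Nat.le_floor (hW a ha)
  have h1 : ∀ a ∈ W, J a b * di a b ≤ C * br b a ^ ((1 - α) - d) := by
    intro a ha
    by_cases hab : a = b
    · subst hab; rw [di_self]; have := br_rpow a a ((1 - α) - d); simp; positivity
    · calc J a b * di a b ≤ C * br a b ^ (-(d:ℝ) - α) * br a b := by
            rw [← br_ne hab]; exact mul_le_mul_of_nonneg_right (J_le hJ hab) (br_pos _ _).le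
        _ = _ := by
            rw [mul_assoc, ← Real.rpow_add_one (br_pos a b).ne', br_comm]; congr 2; ring
  by_cases hr1 : 1 ≤ ⌊r⌋₊
  · calc ∑ a ∈ W, J a b * di a b ≤ ∑ a ∈ W, C * br b a ^ ((1 - α) - d) := sum_le_sum h1
      _ = C * ∑ a ∈ W, br b a ^ ((1 - α) - d) := (mul_sum _ _ _).symm
      _ ≤ C * (9 / (1 - α) * (⌊r⌋₊:ℝ) ^ (1 - α)) := mul_le_mul_of_nonneg_left
          (lat1 hd h1a (by linarith [hJ.alpha_pos]) b hr1 W hdi) hC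
      _ ≤ C * (9 / (1 - α) * r ^ (1 - α)) := by
          have := Nat.floor_le hr
          gcongr
      _ = _ := by ring
  · refine le_trans (Finset.sum_nonpos fun a ha => ?_) (by positivity)
    have : di a b = 0 := by have := hdi a ha; rw [di_comm]; omega
    rw [this]; simp

lemma row1 (hd : d = 1 ∨ d = 2) (hα : α < 1) (hJ : KernelHyp d J α c C) (a : V d) (W : Finset (V d)) {k : ℕ} (hk : 1 ≤ k) :
    ∑ b ∈ W, J a b * min (k:ℝ) (di a b) ≤ C * (9 / (1 - α) + 8 / α) * (k:ℝ) ^ (1 - α) := by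
  have hC : 0 ≤ C := hJ.c_pos.le.trans hJ.c_le_C
  have hk0 : (0:ℝ) < k := by exact_mod_cast hk
  rw [← sum_filter_add_sum_filter_not W (fun b => di a b ≤ k)]
  have h1 : ∑ b ∈ W with di a b ≤ k, J a b * min (k:ℝ) (di a b) ≤ C * (9 / (1 - α)) * (k:ℝ) ^ (1 - α) := by
    refine le_trans (sum_le_sum fun b hb => ?_) (near hd hα hJ a (W.filter fun b => di a b ≤ k) hk0.le fun b hb => ?_)
    · rw [hJ.symm, di_comm]; exact mul_le_mul_of_nonneg_left (min_le_right _ _) (hJ.nonneg _ _)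
    · rw [di_comm]; exact_mod_cast (Finset.mem_filter.1 hb).2
  have h2 : ∑ b ∈ W with ¬ di a b ≤ k, J a b * min (k:ℝ) (di a b) ≤ C * (8 / α) * (k:ℝ) ^ (1 - α) := by
    calc ∑ b ∈ W with ¬ di a b ≤ k, J a b * min (k:ℝ) (di a b) ≤ ∑ b ∈ W with ¬ di a b ≤ k, (C * k) * br a b ^ (-(d:ℝ) - α) := by
          refine sum_le_sum fun b hb => ?_
          have hb := (Finset.mem_filter.1 hb).2
          have hab : a ≠ b := by rintro rfl; rw [di_self] at hb; omega
          calc J a b * min (k:ℝ) (di a b) ≤ (C * br a b ^ (-(d:ℝ) - α)) * k :=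
                mul_le_mul (J_le hJ hab) (min_le_left _ _) (by positivity) (mul_nonneg hC (br_rpow _ _ _).le)
            _ = _ := by ring
      _ = (C * k) * ∑ b ∈ W with ¬ di a b ≤ k, br a b ^ (-(d:ℝ) - α) := (mul_sum _ _ _).symm
      _ ≤ (C * k) * (8 / α * (k:ℝ) ^ (-α)) := mul_le_mul_of_nonneg_left
          (lat2 hd hJ.alpha_pos a hk _ fun b hb => by have := (Finset.mem_filter.1 hb).2; omega) (by positivity)
      _ = C * (8 / α) * ((k:ℝ) ^ (1:ℝ) * (k:ℝ) ^ (-α)) := by rw [Real.rpow_one]; ring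
      _ = _ := by rw [← Real.rpow_add hk0]; congr 2
  linarith

lemma part1 (hd : d = 1 ∨ d = 2) (hα : α < 1) (hJ : KernelHyp d J α c C) {β CB A : ℝ} (hβ : 0 ≤ β) (hCB : 0 ≤ CB) (hA0 : 0 ≤ A)
    (hB : ∀ (R : ℕ), 1 ≤ R → ∀ (x : V d) (W : Finset (V d)), (∀ u ∈ W, di x u ≤ R) → ∑ u ∈ W, tau J β W x u ≤ CB * (R:ℝ) ^ α)
    {W : Finset (V d)} (hA : ∀ x ∈ W, ∀ y ∈ W, tau J β W x y ≤ A * br x y ^ (α - d)) {x y : V d} (hx : x ∈ W) (hy : y ∈ W)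
    {k : ℕ} (hk : 1 ≤ k) (hρ : 2 * di x y ≤ k) :
    tau J β W x y ≤ tau J β (W ∩ bx x (2 * k)) x y + β * CB * (C * (9 / (1 - α) + 8 / α)) * 2 ^ (d:ℝ) * A * (k:ℝ) ^ (α - d) := by
  have hk0 : (0:ℝ) < k := by exact_mod_cast hk
  have hC : 0 ≤ C := hJ.c_pos.le.trans hJ.c_le_C
  have ha := hJ.alpha_pos
  have had := hJ.alpha_lt_d
  have h1a : 0 < 1 - α := by linarith
  set U := W ∩ bx x (2 * k) with hU
  set CR := C * (9 / (1 - α) + 8 / α) with hCR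
  have hCR0 : 0 ≤ CR := by positivity
  have h1 := SLavg hJ hβ W (x := x) (y := y) k (tau J β U x y) fun j hj => tau_mono hJ hβ
    (Finset.inter_subset_inter_left (bx_mono (by rw [Finset.mem_Ico] at hj; omega))) _ _
  set T := A * ((k:ℝ) / 2) ^ (α - d) with hT
  have hT0 : 0 ≤ T := by positivity
  have h2 : ∑ b ∈ W, ∑ a ∈ U, (nn x k a b : ℝ) * (tau J β U x a * (β * J a b) * tau J β W b y) ≤
      CB * ((2 * k : ℕ):ℝ) ^ α * (β * T * (CR * (k:ℝ) ^ (1 - α))) := by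
    calc ∑ b ∈ W, ∑ a ∈ U, (nn x k a b : ℝ) * (tau J β U x a * (β * J a b) * tau J β W b y)
        ≤ ∑ b ∈ W, ∑ a ∈ U, tau J β U x a * (β * T * (J a b * min (k:ℝ) (di a b))) := by
          refine sum_le_sum fun b hb => sum_le_sum fun a ha => ?_
          have t1 := tau_nn hJ hβ U x a
          have t2 := hJ.nonneg a b
          by_cases hbk : di x b ≤ k
          · rw [nn_zero hbk]; simp; positivity
          have t3 : tau J β W b y ≤ T := by
            refine (hA b hb y hy).trans (mul_le_mul_of_nonneg_left ?_ hA0)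
            refine Real.rpow_le_rpow_of_nonpos (by positivity) ?_ (by linarith)
            have := di_tri x y b
            have h4 : k ≤ 2 * di b y := by rw [di_comm b y]; omega
            have h5 : (k:ℝ) ≤ 2 * di b y := by exact_mod_cast h4
            refine le_trans ?_ (le_max_right _ _)
            linarith
          have t4 : (nn x k a b : ℝ) ≤ min (k:ℝ) (di a b) := le_min (by exact_mod_cast nn_le_k x k a b) (by exact_mod_cast nn_le_di x k a b)
          calc (nn x k a b : ℝ) * (tau J β U x a * (β * J a b) * tau J β W b y)
              ≤ min (k:ℝ) (di a b) * (tau J β U x a * (β * J a b) * T) :=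
                mul_le_mul t4 (mul_le_mul_of_nonneg_left t3 (by positivity)) (mul_nonneg (by positivity) (tau_nn hJ hβ _ _ _)) (by positivity)
            _ = _ := by ring
      _ = ∑ a ∈ U, tau J β U x a * (β * T * ∑ b ∈ W, (J a b * min (k:ℝ) (di a b))) := by
          rw [sum_comm]
          refine sum_congr rfl fun a _ => ?_
          rw [mul_sum, mul_sum]
      _ ≤ ∑ a ∈ U, tau J β U x a * (β * T * (CR * (k:ℝ) ^ (1 - α))) := by
          refine sum_le_sum fun a _ => mul_le_mul_of_nonneg_left ?_ (tau_nn hJ hβ _ _ _)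
          exact mul_le_mul_of_nonneg_left (row1 hd hα hJ a W hk) (by positivity)
      _ = (∑ a ∈ U, tau J β U x a) * (β * T * (CR * (k:ℝ) ^ (1 - α))) := (sum_mul _ _ _).symm
      _ ≤ _ := by
          refine mul_le_mul_of_nonneg_right ?_ (by positivity)
          exact hB (2 * k) (by omega) x U fun u hu => mem_bx.1 (Finset.mem_inter.1 hu).2
  have h3 : CB * ((2 * k : ℕ):ℝ) ^ α * (β * T * (CR * (k:ℝ) ^ (1 - α))) = k * (β * CB * CR * 2 ^ (d:ℝ) * A * (k:ℝ) ^ (α - d)) := by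
    have e1 : ((2 * k : ℕ):ℝ) ^ α = 2 ^ α * (k:ℝ) ^ α := by rw [Nat.cast_mul, Real.mul_rpow (by positivity) hk0.le]; norm_num
    have e2 : ((k:ℝ) / 2) ^ (α - d) = (k:ℝ) ^ (α - d) * 2 ^ ((d:ℝ) - α) := by
      rw [Real.div_rpow hk0.le (by norm_num), div_eq_mul_inv, ← Real.rpow_neg (by norm_num)]; congr 2; ring
    have e3 : (k:ℝ) ^ α * (k:ℝ) ^ (1 - α) = k := by rw [← Real.rpow_add hk0]; simp
    have e4 : (2:ℝ) ^ α * 2 ^ ((d:ℝ) - α) = 2 ^ (d:ℝ) := by rw [← Real.rpow_add (by norm_num)]; congr 1; ring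
    rw [e1, hT, e2]
    calc CB * (2 ^ α * (k:ℝ) ^ α) * (β * (A * ((k:ℝ) ^ (α - d) * 2 ^ ((d:ℝ) - α))) * (CR * (k:ℝ) ^ (1 - α)))
        = ((k:ℝ) ^ α * (k:ℝ) ^ (1 - α)) * (β * CB * CR * ((2:ℝ) ^ α * 2 ^ ((d:ℝ) - α)) * A * (k:ℝ) ^ (α - d)) := by ring
      _ = _ := by rw [e3, e4]
  rw [h3] at h2
  have h4 : (k:ℝ) * tau J β W x y ≤ k * (tau J β U x y + β * CB * CR * 2 ^ (d:ℝ) * A * (k:ℝ) ^ (α - d)) := by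
    rw [mul_add]; exact h1.trans (add_le_add le_rfl h2)
  exact le_of_mul_le_mul_left h4 hk0

lemma part2 (hd : d = 1 ∨ d = 2) (hα : α < 1) (hJ : KernelHyp d J α c C) {β CB A : ℝ} (hβ : 0 ≤ β) (hCB : 0 ≤ CB) (hA0 : 0 ≤ A)
    (hB : ∀ (R : ℕ), 1 ≤ R → ∀ (x : V d) (W : Finset (V d)), (∀ u ∈ W, di x u ≤ R) → ∑ u ∈ W, tau J β W x u ≤ CB * (R:ℝ) ^ α)
    {W : Finset (V d)} {x y : V d} (hx : x ∈ W) {s : ℕ} (hs : 1 ≤ s) (hρ : 2 * s ≤ di x y)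
    (hA : ∀ u ∈ W ∩ bx x (2 * s), ∀ v ∈ W ∩ bx x (2 * s), tau J β (W ∩ bx x (2 * s)) u v ≤ A * br u v ^ (α - d))
    {δ : ℝ} (hδ : 0 < δ) (hδ1 : δ ≤ 1 / 2) :
    tau J β W x y ≤ (β * (2 ^ ((d:ℝ) - α) * (C * (9 / (1 - α)))) * A * δ ^ (1 - α) + β * C * CB * 2 ^ α * δ ^ (-(d:ℝ) - α)) *
      (s:ℝ) ^ (-(d:ℝ)) * ∑ b ∈ W, tau J β W b y := by
  have hs0 : (0:ℝ) < s := by exact_mod_cast hs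
  have hC : 0 ≤ C := hJ.c_pos.le.trans hJ.c_le_C
  have ha := hJ.alpha_pos
  have had := hJ.alpha_lt_d
  have h1a : 0 < 1 - α := by linarith
  set U := W ∩ bx x (2 * s) with hU
  have hxU : x ∈ U := Finset.mem_inter.2 ⟨hx, bx_self _ _⟩
  have h1 := SLavg hJ hβ W (x := x) (y := y) s 0 fun j hj => by
    rw [tau_comm]
    rw [Finset.mem_Ico] at hj
    refine (tau_zero β _ (Finset.mem_inter.2 ⟨hx, bx_self _ _⟩) fun h => ?_).le
    have := mem_bx.1 (Finset.mem_inter.1 h).2; omega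
  set K := (β * (2 ^ ((d:ℝ) - α) * (C * (9 / (1 - α)))) * A * δ ^ (1 - α) + β * C * CB * 2 ^ α * δ ^ (-(d:ℝ) - α)) with hK
  have hK0 : 0 ≤ K := by positivity
  have hrow : ∀ b, ∑ a ∈ U, (nn x s a b : ℝ) * (tau J β U x a * (β * J a b)) ≤ s * (K * (s:ℝ) ^ (-(d:ℝ))) := by
    intro b
    by_cases hbs : di x b ≤ s
    · refine le_trans (Finset.sum_nonpos fun a _ => ?_) (by positivity)
      rw [nn_zero hbs]; simp
    rw [← sum_filter_add_sum_filter_not U (fun a => (di a b : ℝ) ≤ δ * s)]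
    have n1 : ∑ a ∈ U with (di a b : ℝ) ≤ δ * s, (nn x s a b : ℝ) * (tau J β U x a * (β * J a b)) ≤
        A * ((s:ℝ) / 2) ^ (α - d) * β * (C * (9 / (1 - α)) * (δ * s) ^ (1 - α)) := by
      calc ∑ a ∈ U with (di a b : ℝ) ≤ δ * s, (nn x s a b : ℝ) * (tau J β U x a * (β * J a b))
          ≤ ∑ a ∈ U with (di a b : ℝ) ≤ δ * s, A * ((s:ℝ) / 2) ^ (α - d) * β * (J a b * di a b) := by
            refine sum_le_sum fun a ha => ?_
            rw [mem_filter] at ha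
            have t2 := hJ.nonneg a b
            have t3 : tau J β U x a ≤ A * ((s:ℝ) / 2) ^ (α - d) := by
              refine (hA x hxU a ha.1).trans (mul_le_mul_of_nonneg_left ?_ hA0)
              refine Real.rpow_le_rpow_of_nonpos (by positivity) ?_ (by linarith)
              refine le_trans ?_ (le_max_right _ _)
              have h5 : ((di x b : ℕ):ℝ) ≤ di x a + di a b := by exact_mod_cast di_tri x a b
              have h6 : (s:ℝ) ≤ di x b := by exact_mod_cast (by omega : s ≤ di x b)
              have h7 : δ * s ≤ 1 / 2 * s := mul_le_mul_of_nonneg_right hδ1 hs0.le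
              linarith [ha.2]
            calc (nn x s a b : ℝ) * (tau J β U x a * (β * J a b))
                ≤ (di a b : ℝ) * ((A * ((s:ℝ) / 2) ^ (α - d)) * (β * J a b)) :=
                  mul_le_mul (by exact_mod_cast nn_le_di x s a b) (mul_le_mul_of_nonneg_right t3 (by positivity))
                    (mul_nonneg (tau_nn hJ hβ _ _ _) (by positivity)) (by positivity)
              _ = _ := by ring
        _ = A * ((s:ℝ) / 2) ^ (α - d) * β * ∑ a ∈ U with (di a b : ℝ) ≤ δ * s, (J a b * di a b) := (mul_sum _ _ _).symm
        _ ≤ _ := mul_le_mul_of_nonneg_left (near hd hα hJ b _ (by positivity) fun a ha => (Finset.mem_filter.1 ha).2) (by positivity)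
    have n2 : ∑ a ∈ U with ¬ (di a b : ℝ) ≤ δ * s, (nn x s a b : ℝ) * (tau J β U x a * (β * J a b)) ≤
        s * (β * (C * (δ * s) ^ (-(d:ℝ) - α))) * (CB * ((2 * s : ℕ):ℝ) ^ α) := by
      calc ∑ a ∈ U with ¬ (di a b : ℝ) ≤ δ * s, (nn x s a b : ℝ) * (tau J β U x a * (β * J a b))
          ≤ ∑ a ∈ U with ¬ (di a b : ℝ) ≤ δ * s, s * (β * (C * (δ * s) ^ (-(d:ℝ) - α))) * tau J β U x a := by
            refine sum_le_sum fun a ha => ?_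
            have ha := not_le.1 (Finset.mem_filter.1 ha).2
            have hab : a ≠ b := by
              rintro rfl; rw [di_self] at ha; push_cast at ha
              have : 0 < δ * s := by positivity
              linarith
            have t1 := tau_nn hJ hβ U x a
            have t2 := hJ.nonneg a b
            have t3 : J a b ≤ C * (δ * s) ^ (-(d:ℝ) - α) := by
              refine (J_le hJ hab).trans (mul_le_mul_of_nonneg_left ?_ hC)
              refine Real.rpow_le_rpow_of_nonpos (by positivity) ?_ (by linarith)
              rw [br_ne hab]; exact ha.le
            calc (nn x s a b : ℝ) * (tau J β U x a * (β * J a b))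
                ≤ (s:ℝ) * (tau J β U x a * (β * (C * (δ * s) ^ (-(d:ℝ) - α)))) :=
                  mul_le_mul (by exact_mod_cast nn_le_k x s a b) (mul_le_mul_of_nonneg_left (mul_le_mul_of_nonneg_left t3 hβ) t1)
                    (by positivity) hs0.le
              _ = _ := by ring
        _ ≤ ∑ a ∈ U, s * (β * (C * (δ * s) ^ (-(d:ℝ) - α))) * tau J β U x a :=
            sum_le_sum_of_subset_of_nonneg (filter_subset _ _) fun a _ _ =>
              mul_nonneg (by positivity) (tau_nn hJ hβ _ _ _)
        _ = s * (β * (C * (δ * s) ^ (-(d:ℝ) - α))) * ∑ a ∈ U, tau J β U x a := (mul_sum _ _ _).symm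
        _ ≤ _ := mul_le_mul_of_nonneg_left (hB (2 * s) (by omega) x U fun u hu => mem_bx.1 (Finset.mem_inter.1 hu).2) (by positivity)
    refine (add_le_add n1 n2).trans (le_of_eq ?_)
    have e1 : ((2 * s : ℕ):ℝ) ^ α = 2 ^ α * (s:ℝ) ^ α := by rw [Nat.cast_mul, Real.mul_rpow (by positivity) hs0.le]; norm_num
    have e2 : ((s:ℝ) / 2) ^ (α - d) = (s:ℝ) ^ (α - d) * 2 ^ ((d:ℝ) - α) := by
      rw [Real.div_rpow hs0.le (by norm_num), div_eq_mul_inv, ← Real.rpow_neg (by norm_num)]; congr 2; ring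
    have e3 : (s:ℝ) ^ (α - d) * (s:ℝ) ^ (1 - α) = s * (s:ℝ) ^ (-(d:ℝ)) := by
      rw [← Real.rpow_add hs0, mul_comm (s:ℝ), ← Real.rpow_add_one hs0.ne']; congr 1; ring
    have e4 : (s:ℝ) ^ (-(d:ℝ) - α) * (s:ℝ) ^ α = (s:ℝ) ^ (-(d:ℝ)) := by rw [← Real.rpow_add hs0]; congr 1; ring
    rw [e1, e2, Real.mul_rpow hδ.le hs0.le, Real.mul_rpow hδ.le hs0.le, hK]
    calc A * ((s:ℝ) ^ (α - d) * 2 ^ ((d:ℝ) - α)) * β * (C * (9 / (1 - α)) * (δ ^ (1 - α) * (s:ℝ) ^ (1 - α))) +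
          s * (β * (C * (δ ^ (-(d:ℝ) - α) * (s:ℝ) ^ (-(d:ℝ) - α)))) * (CB * (2 ^ α * (s:ℝ) ^ α))
        = A * 2 ^ ((d:ℝ) - α) * β * (C * (9 / (1 - α)) * δ ^ (1 - α)) * ((s:ℝ) ^ (α - d) * (s:ℝ) ^ (1 - α)) +
          s * (β * (C * δ ^ (-(d:ℝ) - α))) * (CB * 2 ^ α) * ((s:ℝ) ^ (-(d:ℝ) - α) * (s:ℝ) ^ α) := by ring
      _ = _ := by rw [e3, e4]; ring
  have h2 : ∑ b ∈ W, ∑ a ∈ U, (nn x s a b : ℝ) * (tau J β U x a * (β * J a b) * tau J β W b y) ≤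
      s * (K * (s:ℝ) ^ (-(d:ℝ)) * ∑ b ∈ W, tau J β W b y) := by
    rw [mul_sum, mul_sum]
    refine sum_le_sum fun b _ => ?_
    calc ∑ a ∈ U, (nn x s a b : ℝ) * (tau J β U x a * (β * J a b) * tau J β W b y)
        = (∑ a ∈ U, (nn x s a b : ℝ) * (tau J β U x a * (β * J a b))) * tau J β W b y := by
          rw [sum_mul]; exact sum_congr rfl fun a _ => by ring
      _ ≤ s * (K * (s:ℝ) ^ (-(d:ℝ))) * tau J β W b y := mul_le_mul_of_nonneg_right (hrow b) (tau_nn hJ hβ _ _ _)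
      _ = _ := by ring
  rw [mul_zero, zero_add] at h1
  exact le_of_mul_le_mul_left (h1.trans h2) hs0

end stepC

section stepC2
open Classical
variable {d : ℕ} {J : V d → V d → ℝ} {α c C : ℝ}

lemma small_pow (K : ℝ) {t : ℝ} (ht : 0 < t) : ∃ n : ℕ, 2 ≤ n ∧ K * (n:ℝ) ^ (-t) ≤ 1 / 4 := by
  have h : Filter.Tendsto (fun n : ℕ => K * (n:ℝ) ^ (-t)) Filter.atTop (nhds 0) := by
    have := ((tendsto_rpow_neg_atTop ht).comp tendsto_natCast_atTop_atTop).const_mul K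
    simpa using this
  obtain ⟨N, hN⟩ := Filter.eventually_atTop.1 (h.eventually (gt_mem_nhds (show (0:ℝ) < 1 / 4 by norm_num)))
  exact ⟨max N 2, le_max_right _ _, (hN _ (le_max_left _ _)).le⟩

lemma improve (hd : d = 1 ∨ d = 2) (hα : α < 1) (hJ : KernelHyp d J α c C) {β₁ CB : ℝ} (hβ₁ : 0 ≤ β₁) (hCB : 0 ≤ CB) :
    ∃ C0 : ℝ, 0 < C0 ∧ ∀ β, 0 ≤ β → β ≤ β₁ →
    (∀ (R : ℕ), 1 ≤ R → ∀ (x : V d) (W : Finset (V d)), (∀ u ∈ W, di x u ≤ R) → ∑ u ∈ W, tau J β W x u ≤ CB * (R:ℝ) ^ α) →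
    ∀ (W₀ : Finset (V d)) (A : ℝ), 0 ≤ A → (∀ W ⊆ W₀, ∀ x ∈ W, ∀ y ∈ W, tau J β W x y ≤ A * br x y ^ (α - d)) →
    ∀ W ⊆ W₀, ∀ x ∈ W, ∀ y ∈ W, tau J β W x y ≤ (A / 2 + C0) * br x y ^ (α - d) := by
  have hC : 0 ≤ C := hJ.c_pos.le.trans hJ.c_le_C
  have ha := hJ.alpha_pos
  have had := hJ.alpha_lt_d
  have h1a : 0 < 1 - α := by linarith
  set CR := C * (9 / (1 - α) + 8 / α) with hCR
  have hCR0 : 0 ≤ CR := by positivity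
  obtain ⟨L, hL2, hL⟩ := small_pow (β₁ * CB * CR * 2 ^ (d:ℝ)) (t := d - α) (by linarith)
  set G := (8:ℝ) ^ (d:ℝ) * (CB * ((4 * L : ℕ):ℝ) ^ α) with hG
  have hG0 : 0 ≤ G := by positivity
  obtain ⟨n, hn2, hn⟩ := small_pow (β₁ * (2 ^ ((d:ℝ) - α) * (C * (9 / (1 - α)))) * G) h1a
  set δ : ℝ := (n:ℝ)⁻¹ with hδ
  have hn0 : (2:ℝ) ≤ n := by exact_mod_cast hn2
  have hδ0 : 0 < δ := by positivity
  have hδ1 : δ ≤ 1 / 2 := by rw [hδ, one_div]; exact inv_anti₀ (by norm_num) hn0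
  have hδe : (n:ℝ) ^ (-(1 - α)) = δ ^ (1 - α) := by
    rw [hδ, Real.inv_rpow (by positivity), Real.rpow_neg (by positivity)]
  rw [hδe] at hn
  set K3 := β₁ * C * CB * 2 ^ α * δ ^ (-(d:ℝ) - α) with hK3
  have hK30 : 0 ≤ K3 := by positivity
  refine ⟨K3 * G + 4 ^ ((d:ℝ) - α), by positivity, ?_⟩
  intro β hβ hββ hB W₀ A hA0 hA W hW x hx y hy
  have hbr := br_rpow x y (α - d)
  by_cases hρ : di x y < 4
  · have h1 : (4:ℝ) ^ (α - d) ≤ br x y ^ (α - d) := by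
      refine Real.rpow_le_rpow_of_nonpos (br_pos _ _) ?_ (by linarith)
      unfold br; refine max_le (by norm_num) ?_
      exact_mod_cast hρ.le
    have h2 : (4:ℝ) ^ ((d:ℝ) - α) * 4 ^ (α - d) = 1 := by rw [← Real.rpow_add (by norm_num)]; simp
    calc tau J β W x y ≤ 1 := tau_le1 hJ hβ _ _ _
      _ = (4:ℝ) ^ ((d:ℝ) - α) * 4 ^ (α - d) := h2.symm
      _ ≤ 4 ^ ((d:ℝ) - α) * br x y ^ (α - d) := mul_le_mul_of_nonneg_left h1 (by positivity)
      _ ≤ _ := mul_le_mul_of_nonneg_right (by have := mul_nonneg hK30 hG0; linarith) hbr.le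
  push Not at hρ
  have hxy : x ≠ y := by rintro rfl; rw [di_self] at hρ; omega
  set ρ := di x y with hρd
  have hρ0 : (0:ℝ) < ρ := by exact_mod_cast (by omega : 0 < ρ)
  have hbrρ : br x y = ρ := br_ne hxy
  have hL0 : (0:ℝ) < L := by exact_mod_cast (by omega : 0 < L)
  have hk2 : 2 * ρ ≤ L * ρ := Nat.mul_le_mul_right _ hL2
  have p1 := part1 hd hα hJ hβ hCB hA0 hB (hA W hW) hx hy (k := L * ρ) (by omega) hk2
  set W' := W ∩ bx x (2 * (L * ρ)) with hW'
  have hW'0 : W' ⊆ W₀ := Finset.inter_subset_left.trans hW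
  have p2 := part2 hd hα hJ hβ hCB hA0 hB (W := W') (x := x) (y := y) (Finset.mem_inter.2 ⟨hx, bx_self _ _⟩) (s := ρ / 4)
    (by omega) (by omega) (hA _ (Finset.inter_subset_left.trans hW'0)) hδ0 hδ1
  have p3 : ∑ b ∈ W', tau J β W' b y ≤ CB * (((4 * L : ℕ):ℝ) ^ α * (ρ:ℝ) ^ α) := by
    have := hB (4 * (L * ρ)) (by omega) y W' fun u hu => by
      have h1 := mem_bx.1 (Finset.mem_inter.1 hu).2
      have h2 := di_tri y x u
      rw [di_comm y x] at h2; omega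
    rw [sum_congr rfl fun b _ => tau_comm β W' b y]
    refine this.trans (le_of_eq ?_)
    rw [← Real.mul_rpow (by positivity) (by positivity)]
    push_cast; rw [mul_assoc 4 (L:ℝ)]
  have p4 : ((ρ / 4 : ℕ):ℝ) ^ (-(d:ℝ)) ≤ 8 ^ (d:ℝ) * (ρ:ℝ) ^ (-(d:ℝ)) := by
    have h1 : (ρ:ℝ) / 8 ≤ ((ρ / 4 : ℕ):ℝ) := by
      rw [div_le_iff₀ (by norm_num)]; exact_mod_cast (by omega : ρ ≤ ρ / 4 * 8)
    refine (Real.rpow_le_rpow_of_nonpos (by positivity) h1 (by linarith)).trans (le_of_eq ?_)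
    rw [Real.div_rpow hρ0.le (by norm_num), Real.rpow_neg (by norm_num : (0:ℝ) ≤ 8), div_inv_eq_mul, mul_comm]
  have p5 : (ρ:ℝ) ^ (-(d:ℝ)) * (ρ:ℝ) ^ α = (ρ:ℝ) ^ (α - d) := by rw [← Real.rpow_add hρ0]; congr 1; ring
  have e1 : ((L * ρ : ℕ):ℝ) ^ (α - d) = (L:ℝ) ^ (-((d:ℝ) - α)) * (ρ:ℝ) ^ (α - d) := by
    rw [Nat.cast_mul, Real.mul_rpow hL0.le hρ0.le, neg_sub]
  rw [e1] at p1
  have q1 : β * CB * CR * 2 ^ (d:ℝ) * A * ((L:ℝ) ^ (-((d:ℝ) - α)) * (ρ:ℝ) ^ (α - d)) ≤ A / 4 * (ρ:ℝ) ^ (α - d) := by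
    calc β * CB * CR * 2 ^ (d:ℝ) * A * ((L:ℝ) ^ (-((d:ℝ) - α)) * (ρ:ℝ) ^ (α - d))
        ≤ β₁ * CB * CR * 2 ^ (d:ℝ) * A * ((L:ℝ) ^ (-((d:ℝ) - α)) * (ρ:ℝ) ^ (α - d)) := by gcongr
      _ = (β₁ * CB * CR * 2 ^ (d:ℝ) * (L:ℝ) ^ (-((d:ℝ) - α))) * (A * (ρ:ℝ) ^ (α - d)) := by ring
      _ ≤ 1 / 4 * (A * (ρ:ℝ) ^ (α - d)) := mul_le_mul_of_nonneg_right hL (by positivity)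
      _ = _ := by ring
  set K2 := 2 ^ ((d:ℝ) - α) * (C * (9 / (1 - α))) with hK2
  have hK20 : 0 ≤ K2 := by positivity
  have q2 : tau J β W' x y ≤ (A / 4 + K3 * G) * (ρ:ℝ) ^ (α - d) := by
    calc tau J β W' x y ≤ (β * K2 * A * δ ^ (1 - α) + β * C * CB * 2 ^ α * δ ^ (-(d:ℝ) - α)) *
          ((ρ / 4 : ℕ):ℝ) ^ (-(d:ℝ)) * ∑ b ∈ W', tau J β W' b y := p2
      _ ≤ (β₁ * K2 * A * δ ^ (1 - α) + K3) * (8 ^ (d:ℝ) * (ρ:ℝ) ^ (-(d:ℝ))) * (CB * (((4 * L : ℕ):ℝ) ^ α * (ρ:ℝ) ^ α)) := by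
          refine mul_le_mul (mul_le_mul ?_ p4 (by positivity) (by positivity)) p3
            (sum_nonneg fun b _ => tau_nn hJ hβ _ _ _) (by positivity)
          rw [hK3]; gcongr
      _ = (A * (β₁ * K2 * G * δ ^ (1 - α)) + K3 * G) * ((ρ:ℝ) ^ (-(d:ℝ)) * (ρ:ℝ) ^ α) := by rw [hG]; ring
      _ ≤ (A / 4 + K3 * G) * (ρ:ℝ) ^ (α - d) := by
          rw [p5]
          refine mul_le_mul_of_nonneg_right ?_ (by positivity)
          have := mul_le_mul_of_nonneg_left hn hA0
          linarith
  rw [hbrρ] at hbr ⊢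
  have : 0 ≤ (4:ℝ) ^ ((d:ℝ) - α) * (ρ:ℝ) ^ (α - d) := by positivity
  calc tau J β W x y ≤ (A / 4 + K3 * G) * (ρ:ℝ) ^ (α - d) + A / 4 * (ρ:ℝ) ^ (α - d) := p1.trans (add_le_add q2 q1)
    _ ≤ _ := by linarith

theorem stepC (hd : d = 1 ∨ d = 2) (hα : α = (d:ℝ) / 3) (hJ : KernelHyp d J α c C) {β₀ : ℝ} (h0 : 0 < β₀) (β₁ : ℝ) :
    ∃ CC : ℝ, 0 < CC ∧ ∀ β, β₀ ≤ β → β ≤ β₁ → (∃ M, Bdd J β M) → ∀ (W : Finset (V d)),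
      ∀ x ∈ W, ∀ y ∈ W, tau J β W x y ≤ CC * br x y ^ (α - d) := by
  have hα1 : α < 1 := by
    rw [hα]; rcases hd with rfl | rfl <;> norm_num
  obtain ⟨CB, hCB, hB⟩ := stepB hd hα hJ h0
  by_cases hβ₁ : 0 ≤ β₁
  swap
  · exact ⟨1, one_pos, fun β h1 h2 => by linarith⟩
  obtain ⟨C0, hC0, hI⟩ := improve hd hα1 hJ hβ₁ hCB.le
  refine ⟨2 * C0, by positivity, ?_⟩
  intro β h1 h2 hM W x hx y hy
  have hβ : 0 ≤ β := h0.le.trans h1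
  have hB' := hB β h1 hM
  set A := ∑ u ∈ W, ∑ v ∈ W, br u v ^ ((d:ℝ) - α) with hA
  have hnn : ∀ u v : V d, 0 ≤ br u v ^ ((d:ℝ) - α) := fun u v => (br_rpow _ _ _).le
  have hA0 : 0 ≤ A := sum_nonneg fun u _ => sum_nonneg fun v _ => hnn u v
  have key : ∀ n : ℕ, ∀ W' ⊆ W, ∀ x ∈ W', ∀ y ∈ W', tau J β W' x y ≤ (A * (1 / 2) ^ n + 2 * C0) * br x y ^ (α - d) := by
    intro n
    induction n with
    | zero =>
      intro W' hW' u hu v hv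
      have e1 : br u v ^ ((d:ℝ) - α) ≤ A :=
        (Finset.single_le_sum (f := fun v => br u v ^ ((d:ℝ) - α)) (fun v _ => hnn u v) (hW' hv)).trans
          (Finset.single_le_sum (f := fun u => ∑ v ∈ W, br u v ^ ((d:ℝ) - α)) (fun u _ => sum_nonneg fun v _ => hnn u v) (hW' hu))
      have e2 : br u v ^ ((d:ℝ) - α) * br u v ^ (α - d) = 1 := by rw [← Real.rpow_add (br_pos _ _)]; simp
      calc tau J β W' u v ≤ 1 := tau_le1 hJ hβ _ _ _
        _ = br u v ^ ((d:ℝ) - α) * br u v ^ (α - d) := e2.symm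
        _ ≤ _ := mul_le_mul_of_nonneg_right (by rw [pow_zero]; linarith) (br_rpow _ _ _).le
    | succ n ih =>
      intro W' hW' u hu v hv
      refine (hI β hβ h2 hB' W _ (by positivity) ih W' hW' u hu v hv).trans (le_of_eq ?_)
      rw [pow_succ]; ring
  have hlim : Filter.Tendsto (fun n : ℕ => (A * (1 / 2) ^ n + 2 * C0) * br x y ^ (α - d)) Filter.atTop
      (nhds ((A * 0 + 2 * C0) * br x y ^ (α - d))) :=
    (((_root_.tendsto_pow_atTop_nhds_zero_of_lt_one (by norm_num) (by norm_num)).const_mul A).add_const _).mul_const _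
  have := ge_of_tendsto' hlim fun n => key n W (Finset.Subset.refl _) x hx y hy
  simpa using this

end stepC2

section m6
open Classical
variable {X : Type*} [DecidableEq X] {p : Sym2 X → ℝ}

lemma ex_cs2 {ε : Type*} [DecidableEq ε] {p : ε → ℝ} (hp : IsP p) (E : Finset ε) {r f g : Finset ε → ℝ}
    (hf : ∀ S, 0 ≤ f S) (hg : ∀ S, 0 ≤ g S) (h : ∀ S, r S ^ 2 ≤ f S * g S) :
    (ex p E r) ^ 2 ≤ ex p E f * ex p E g := by
  unfold ex
  have hw : ∀ S, 0 ≤ (∏ e ∈ S, p e) * (∏ e ∈ E \ S, (1 - p e)) := fun S =>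
    mul_nonneg (prod_nonneg fun e _ => (hp e).1)
      (prod_nonneg fun e _ => by linarith [(hp e).2])
  refine Finset.sum_sq_le_sum_mul_sum_of_sq_le_mul _ (fun S _ => mul_nonneg (hw S) (hf S))
    (fun S _ => mul_nonneg (hw S) (hg S)) fun S _ => ?_
  have := mul_le_mul_of_nonneg_left (h S) (mul_nonneg (hw S) (hw S))
  nlinarith [this]

lemma pairs2 (W : Finset X) {F : Sym2 X → ℝ} (hF : ∀ e, 0 ≤ F e) :
    ∑ z ∈ W, ∑ c ∈ W, F s(z, c) ≤ 2 * ∑ e ∈ W.sym2, F e := by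
  rw [← Finset.sum_product' (f := fun z c => F s(z, c)),
    ← Finset.sum_fiberwise_of_maps_to (s := W ×ˢ W) (t := W.sym2) (g := fun q : X × X => s(q.1, q.2)), mul_sum]
  · refine sum_le_sum fun e he => ?_
    rw [sum_congr rfl (g := fun _ => F e) fun q hq => by rw [(Finset.mem_filter.1 hq).2]]
    rw [sum_const, nsmul_eq_mul]
    refine mul_le_mul_of_nonneg_right ?_ (hF e)
    induction e using Sym2.ind with
    | _ a b =>
      have : ((W ×ˢ W).filter fun q : X × X => s(q.1, q.2) = s(a, b)) ⊆ {(a, b), (b, a)} := by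
        rintro ⟨x, y⟩ hq
        have := (Finset.mem_filter.1 hq).2
        rcases Sym2.eq_iff.1 this with ⟨rfl, rfl⟩ | ⟨rfl, rfl⟩ <;> simp
      exact_mod_cast (card_le_card this).trans Finset.card_le_two
  · rintro ⟨x, y⟩ hq
    rw [mem_product] at hq
    exact Finset.mk_mem_sym2_iff.2 hq

noncomputable def kz (W : Finset X) (S : Finset (Sym2 X)) (z : X) : ℝ := ∑ y ∈ W, ind (cn S z y)
noncomputable def Sz (p : Sym2 X → ℝ) (W : Finset X) (S : Finset (Sym2 X)) (z : X) : ℝ :=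
  ∑ o ∈ W, ind (cn S z o) * ta p W o z
noncomputable def gU (p : Sym2 X → ℝ) (U : Finset X) (z : X) : ℝ :=
  ∑ c ∈ U, p s(z, c) * ∑ u ∈ U, ta p U c u
noncomputable def gz (p : Sym2 X → ℝ) (W : Finset X) (S : Finset (Sym2 X)) (z : X) : ℝ := gU p (nc W {z} S) z
noncomputable def fX (W : Finset X) (S : Finset (Sym2 X)) : ℝ := ∑ x ∈ W, ∑ y ∈ W, ind (cn S x y)

lemma kz_nn (W : Finset X) (S : Finset (Sym2 X)) (z : X) : 0 ≤ kz W S z := sum_nonneg fun _ _ => ind_nn _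
lemma gU_nn (hp : IsP p) (U : Finset X) (z : X) : 0 ≤ gU p U z :=
  sum_nonneg fun _ _ => mul_nonneg (hp _).1 (sum_nonneg fun _ _ => ta_nn hp _ _ _)

lemma nc_one {W : Finset X} {S : Finset (Sym2 X)} {x z : X} (h : cn S x z) : nc W {x} S = nc W {z} S := by
  ext v; simp only [mem_nc, Finset.mem_singleton, forall_eq]
  exact and_congr_right fun _ => not_congr ⟨fun k => cn_trans k h, fun k => cn_trans k (cn_symm h)⟩

lemma sum_nc (W : Finset X) (S : Finset (Sym2 X)) (x : X) (f : X → ℝ) :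
    ∑ z ∈ W \ nc W {x} S, f z = ∑ z ∈ W, ind (cn S x z) * f z := by
  rw [← Finset.sum_subset (s₁ := W \ nc W {x} S) (s₂ := W) Finset.sdiff_subset]
  · refine sum_congr rfl fun z hz => ?_
    rw [mem_sdiff, mem_nc] at hz
    have : cn S x z := by
      by_contra hc
      refine hz.2 ⟨hz.1, fun t ht k => hc ?_⟩
      rw [Finset.mem_singleton.1 ht] at k; exact cn_symm k
    rw [ind_t this, one_mul]
  · intro z hz hz'
    rw [mem_sdiff, not_and, not_not] at hz'
    have := (mem_nc.1 (hz' hz)).2 x (Finset.mem_singleton_self x)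
    rw [ind_f fun k => this (cn_symm k), zero_mul]

lemma chi_cut (hp : IsP p) {W : Finset X} {S : Finset (Sym2 X)} {x o : X} (ho : o ∈ W) (h : cn S x o) :
    ∑ u ∈ W, ta p W o u ≤ ∑ z ∈ W, ind (cn S x z) * (ta p W z o * (1 + gz p W S z)) := by
  set U := nc W {x} S with hU
  have hUW : U ⊆ W := fun z hz => (mem_nc.1 hz).1
  have hoU : o ∉ U := fun hc => (mem_nc.1 hc).2 x (Finset.mem_singleton_self x) (cn_symm h)
  have e1 : ∑ z ∈ W, ind (cn S x z) * (ta p W z o * (1 + gz p W S z)) =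
      ∑ z ∈ W \ U, ta p W z o * (1 + gU p U z) := by
    rw [sum_nc W S x]
    refine sum_congr rfl fun z _ => ?_
    by_cases hz : cn S x z
    · rw [gz, ← nc_one hz]
    · rw [ind_f hz]; ring
  rw [e1, ← Finset.sum_sdiff hUW]
  have e2 : ∑ u ∈ U, ta p W o u ≤ ∑ z ∈ W \ U, ta p W z o * gU p U z := by
    have k : ∀ u ∈ U, ta p W o u ≤ ∑ a ∈ U, ∑ b ∈ W \ U, ta p U u a * p s(a, b) * ta p W b o := fun u hu => by
      have := SL_in hp W U (x := u) (y := o) hu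
      rw [Finset.inter_eq_right.2 hUW, ta_comm U, ta_zero U hu hoU, zero_add] at this
      rw [ta_comm]; exact this
    refine (sum_le_sum k).trans (le_of_eq ?_)
    rw [sum_comm]
    simp only [gU, mul_sum]
    rw [sum_comm (s := W \ U)]
    refine sum_congr rfl fun a _ => ?_
    rw [sum_comm]
    refine sum_congr rfl fun b _ => sum_congr rfl fun u _ => ?_
    rw [ta_comm U a u, Sym2.eq_swap]; ring
  have e3 : ∑ z ∈ W \ U, ta p W z o * (1 + gU p U z) =
      ∑ u ∈ W \ U, ta p W o u + ∑ z ∈ W \ U, ta p W z o * gU p U z := by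
    rw [← sum_add_distrib]
    refine sum_congr rfl fun z _ => ?_
    rw [ta_comm W o z]; ring
  rw [e3]; linarith

lemma ta_ex (W : Finset X) (x y : X) : ta p W x y = ex p W.sym2 (fun S => ind (cn S x y)) := rfl

lemma Y_le (hp : IsP p) (W : Finset X) :
    ∑ o ∈ W, (∑ u ∈ W, ta p W o u) ^ 2 ≤
      ∑ z ∈ W, ex p W.sym2 (fun S => kz W S z * Sz p W S z * (1 + gz p W S z)) := by
  have h1 : ∑ o ∈ W, (∑ u ∈ W, ta p W o u) ^ 2 =
      ex p W.sym2 (fun S => ∑ o ∈ W, ∑ x ∈ W, (∑ u ∈ W, ta p W o u) * ind (cn S x o)) := by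
    rw [ex_sum]
    refine sum_congr rfl fun o _ => ?_
    rw [ex_sum, sq, mul_sum]
    refine sum_congr rfl fun x _ => ?_
    rw [ex_mul, ← ta_ex, ta_comm]
  rw [h1, ← ex_sum]
  refine ex_mono hp fun S hS => ?_
  have h2 : ∀ o ∈ W, ∀ x ∈ W, (∑ u ∈ W, ta p W o u) * ind (cn S x o) ≤
      ∑ z ∈ W, ind (cn S z x) * (ind (cn S z o) * ta p W o z) * (1 + gz p W S z) := by
    intro o ho x hx
    by_cases h : cn S x o
    · rw [ind_t h, mul_one]
      refine (chi_cut hp ho h).trans (le_of_eq (sum_congr rfl fun z _ => ?_))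
      by_cases hz : cn S x z
      · rw [ind_t hz, ind_t (cn_symm hz), ind_t (cn_trans (cn_symm hz) h), ta_comm]; ring
      · rw [ind_f hz, ind_f fun k => hz (cn_symm k)]; ring
    · rw [ind_f h, mul_zero]
      exact sum_nonneg fun z _ => mul_nonneg (mul_nonneg (ind_nn _) (mul_nonneg (ind_nn _) (ta_nn hp _ _ _)))
        (by have := gU_nn hp (nc W {z} S) z; unfold gz; linarith)
  refine (sum_le_sum fun o ho => sum_le_sum fun x hx => h2 o ho x hx).trans (le_of_eq ?_)
  rw [sum_congr rfl fun o _ => sum_comm, sum_comm]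
  refine sum_congr rfl fun z _ => ?_
  unfold kz Sz
  rw [sum_comm, Finset.sum_mul_sum, sum_mul]
  refine sum_congr rfl fun x _ => ?_
  rw [sum_mul]

lemma cond_nc (p : Sym2 X → ℝ) {W : Finset X} {z : X} (hz : z ∈ W) (h : Finset X → X → X → ℝ) :
    ex p W.sym2 (fun S => ∑ c ∈ nc W {z} S, ∑ u ∈ nc W {z} S, h (nc W {z} S) c u * ta p (nc W {z} S) c u) =
    ex p W.sym2 (fun S => ∑ c ∈ nc W {z} S, ∑ u ∈ nc W {z} S, h (nc W {z} S) c u * ind (cn S c u)) := by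
  have dec : ∀ F : Finset X → Finset (Sym2 X) → ℝ, ex p W.sym2 (fun S => F (nc W {z} S) S) =
      ∑ U ∈ W.powerset, ex p W.sym2 (fun S => ind (nc W {z} S = U) * F U S) := by
    intro F
    rw [← ex_sum]
    refine ex_congr fun S _ => ?_
    rw [Finset.sum_eq_single (nc W {z} S)]
    · rw [ind_t rfl, one_mul]
    · intro U _ hU; rw [ind_f fun k => hU k.symm, zero_mul]
    · intro hn; exact absurd (Finset.mem_powerset.2 fun v hv => (mem_nc.1 hv).1) hn
  rw [dec (fun U S => ∑ c ∈ U, ∑ u ∈ U, h U c u * ta p U c u),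
    dec (fun U S => ∑ c ∈ U, ∑ u ∈ U, h U c u * ind (cn S c u))]
  refine sum_congr rfl fun U hU => ?_
  rw [mem_powerset] at hU
  simp only [mul_sum]
  rw [ex_sum, ex_sum]
  refine sum_congr rfl fun c hc => ?_
  rw [ex_sum, ex_sum]
  refine sum_congr rfl fun u hu => ?_
  have := nc_prob p (T := {z}) (Finset.singleton_subset_iff.2 hz) hU hc u
  unfold Pr at this
  have e1 : ex p W.sym2 (fun S => ind (nc W {z} S = U) * (h U c u * ta p U c u)) =
      h U c u * (ex p W.sym2 (fun S => ind (nc W {z} S = U)) * ta p U c u) := by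
    rw [ex_mul']; ring
  have e2 : ex p W.sym2 (fun S => ind (nc W {z} S = U) * (h U c u * ind (cn S c u))) =
      h U c u * ex p W.sym2 (fun S => ind (nc W {z} S = U ∧ cn S c u)) := by
    rw [← ex_mul]
    refine ex_congr fun S _ => ?_
    rw [ind_and]; ring
  rw [e1, e2, this]

lemma kz_eq (W : Finset X) (S : Finset (Sym2 X)) (z : X) : kz W S z = (W \ nc W {z} S).card := by
  have := sum_nc W S z (fun _ => (1:ℝ))
  simp only [mul_one, sum_const, nsmul_eq_mul] at this
  rw [kz, ← this]

lemma pair_gain {W : Finset X} {S : Finset (Sym2 X)} {z c : X} (h : ¬ cn S z c) :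
    kz W S z * kz W S c ≤ fX W (insert s(z, c) S) - fX W S := by
  unfold kz fX
  rw [Finset.sum_mul_sum, ← Finset.sum_sub_distrib]
  refine sum_le_sum fun x _ => ?_
  rw [← Finset.sum_sub_distrib]
  refine sum_le_sum fun y _ => ?_
  have hm : ∀ {a b}, cn S a b → cn (insert s(z, c) S) a b := cn_mono (Finset.subset_insert _ _)
  rw [← ind_and]
  by_cases k : cn S z x ∧ cn S c y
  · rw [ind_t k, ind_t (cn_trans (hm (cn_symm k.1)) (cn_trans (cn_edge (Finset.mem_insert_self _ _)) (hm k.2))),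
      ind_f fun hc => h (cn_trans k.1 (cn_trans hc (cn_symm k.2)))]
    norm_num
  · rw [ind_f k]; exact sub_nonneg.2 (ind_mono hm)

lemma fX_mono (W : Finset X) {S S' : Finset (Sym2 X)} (h : S ⊆ S') : fX W S ≤ fX W S' :=
  sum_le_sum fun _ _ => sum_le_sum fun _ _ => ind_mono (cn_mono h)

lemma kg_le {J : Sym2 X → ℝ} (hJ : ∀ e, 0 ≤ J e) {β : ℝ} (hβ : 0 ≤ β) (W : Finset X) :
    ∑ z ∈ W, ex (pb J β) W.sym2 (fun S => kz W S z * gz (pb J β) W S z) ≤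
      2 * β * ∑ e ∈ W.sym2, J e * ex (pb J β) W.sym2 (fun S => fX W (insert e S) - fX W S) := by
  set p := pb J β with hpd
  have hp : IsP p := pb_isP hJ hβ
  have h1 : ∀ z ∈ W, ex p W.sym2 (fun S => kz W S z * gz p W S z) =
      ex p W.sym2 (fun S => ∑ c ∈ nc W {z} S, ∑ u ∈ nc W {z} S,
        (((W \ nc W {z} S).card : ℝ) * p s(z, c)) * ind (cn S c u)) := fun z hz => by
    rw [← cond_nc p hz (fun U c u => ((W \ U).card : ℝ) * p s(z, c))]
    refine ex_congr fun S _ => ?_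
    rw [kz_eq, gz, gU, mul_sum]
    refine sum_congr rfl fun c _ => ?_
    rw [← mul_assoc, mul_sum]
  rw [sum_congr rfl h1]
  simp only [← ex_mul]
  rw [← ex_sum, ← ex_sum, ← ex_mul]
  refine ex_mono hp fun S hS => ?_
  have hg : ∀ e, 0 ≤ fX W (insert e S) - fX W S := fun e => sub_nonneg.2 (fX_mono W (Finset.subset_insert _ _))
  have h2 := pairs2 W (F := fun e => J e * (fX W (insert e S) - fX W S)) fun e => mul_nonneg (hJ e) (hg e)
  have h3 : ∑ z ∈ W, ∑ c ∈ nc W {z} S, ∑ u ∈ nc W {z} S,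
        (((W \ nc W {z} S).card : ℝ) * p s(z, c)) * ind (cn S c u) ≤
      β * ∑ z ∈ W, ∑ c ∈ W, J s(z, c) * (fX W (insert s(z, c) S) - fX W S) := by
    rw [mul_sum]
    refine sum_le_sum fun z hz => ?_
    rw [mul_sum]
    have hs : nc W {z} S ⊆ W := fun v hv => (mem_nc.1 hv).1
    refine le_trans ?_ (sum_le_sum_of_subset_of_nonneg hs fun c _ _ =>
      mul_nonneg hβ (mul_nonneg (hJ _) (hg _)))
    refine sum_le_sum fun c hc => ?_
    rw [← mul_sum, ← kz_eq]
    have k1 : ∑ u ∈ nc W {z} S, ind (cn S c u) ≤ kz W S c :=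
      sum_le_sum_of_subset_of_nonneg hs fun _ _ _ => ind_nn _
    have k2 := pair_gain (W := W) (S := S) (z := z) (c := c) fun k =>
      (mem_nc.1 hc).2 z (Finset.mem_singleton_self z) (cn_symm k)
    have k3 := pb_le (J := J) (β := β) s(z, c)
    have k0 := kz_nn W S z
    have k4 := mul_nonneg hβ (hJ s(z, c))
    calc kz W S z * p s(z, c) * ∑ u ∈ nc W {z} S, ind (cn S c u)
        ≤ kz W S z * (β * J s(z, c)) * kz W S c := by
          refine mul_le_mul (mul_le_mul_of_nonneg_left k3 k0) k1 (sum_nonneg fun _ _ => ind_nn _) (by positivity)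
      _ = (β * J s(z, c)) * (kz W S z * kz W S c) := by ring
      _ ≤ (β * J s(z, c)) * (fX W (insert s(z, c) S) - fX W S) := mul_le_mul_of_nonneg_left k2 k4
      _ = _ := by ring
  refine h3.trans ((mul_le_mul_of_nonneg_left h2 hβ).trans (le_of_eq (by ring)))

noncomputable def t2 (p : Sym2 X → ℝ) (W : Finset X) (x y : X) : ℝ := ∑ v ∈ W, ta p W x v * ta p W v y

lemma t2_nn (hp : IsP p) (W : Finset X) (x y : X) : 0 ≤ t2 p W x y :=
  sum_nonneg fun _ _ => mul_nonneg (ta_nn hp _ _ _) (ta_nn hp _ _ _)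
lemma t2_comm (W : Finset X) (x y : X) : t2 p W x y = t2 p W y x := by
  unfold t2; refine sum_congr rfl fun v _ => ?_
  rw [ta_comm W x v, ta_comm W v y]; ring

lemma five (W : Finset X) (A : X → X → ℝ) (f g h : X → X → X → ℝ) :
    ∑ u ∈ W, ∑ o ∈ W, ∑ o' ∈ W, ∑ v ∈ W, ∑ w ∈ W, A v w * f v w u * g v w o * h v w o' =
      ∑ v ∈ W, ∑ w ∈ W, A v w * (∑ u ∈ W, f v w u) * (∑ o ∈ W, g v w o) * (∑ o' ∈ W, h v w o') := by
  have e : ∀ u o o', ∑ v ∈ W, ∑ w ∈ W, A v w * f v w u * g v w o * h v w o' =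
      ∑ q ∈ W ×ˢ W, A q.1 q.2 * f q.1 q.2 u * g q.1 q.2 o * h q.1 q.2 o' := fun u o o' => by
    rw [Finset.sum_product]
  simp only [e]
  rw [← Finset.sum_product' (f := fun v w => A v w * (∑ u ∈ W, f v w u) * (∑ o ∈ W, g v w o) * (∑ o' ∈ W, h v w o'))]
  rw [sum_congr rfl fun u _ => sum_congr rfl fun o _ => sum_comm]
  rw [sum_congr rfl fun u _ => sum_comm]
  rw [sum_comm]
  refine sum_congr rfl fun q _ => ?_
  simp only [← mul_sum, ← sum_mul]

lemma four_pt (hp : IsP p) {W : Finset X} {Xh G T : ℝ} (hX0 : 0 ≤ Xh) (hG0 : 0 ≤ G)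
    (hX : ∀ x, ∑ u ∈ W, ta p W x u ≤ Xh)
    (hG : ∀ a ∈ W, ∀ b ∈ W, ∑ v ∈ W, ta p W a v * t2 p W v b ≤ G)
    (hT : ∀ z ∈ W, ∑ w ∈ W, t2 p W w z ^ 3 ≤ T) {z : X} (hz : z ∈ W) :
    ex p W.sym2 (fun S => kz W S z * Sz p W S z ^ 2) ≤ Xh * (2 * G ^ 2 + T) := by
  set t := ta p W with ht
  have t0 : ∀ x y, 0 ≤ t x y := ta_nn hp W
  have s0 : ∀ x y, 0 ≤ t2 p W x y := t2_nn hp W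
  have h1 : ex p W.sym2 (fun S => kz W S z * Sz p W S z ^ 2) =
      ∑ u ∈ W, ∑ o ∈ W, ∑ o' ∈ W, (t o z * t o' z) *
        Pr p W.sym2 (fun S => cn S z u ∧ cn S z o ∧ cn S z o') := by
    simp only [Pr, ← ex_mul, ← ex_sum]
    refine ex_congr fun S _ => ?_
    unfold kz Sz
    rw [sq, Finset.sum_mul_sum, sum_mul]
    refine sum_congr rfl fun u _ => ?_
    rw [mul_sum]
    refine sum_congr rfl fun o _ => ?_
    rw [mul_sum]
    refine sum_congr rfl fun o' _ => ?_
    rw [ind_and, ind_and]; ring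
  have h2 : ∀ u o o', Pr p W.sym2 (fun S => cn S z u ∧ cn S z o ∧ cn S z o') ≤
      ∑ v ∈ W, ∑ w ∈ W, (t z w * t w v * t w o' * t v u * t v o + t z v * t v w * t w u * t w o' * t v o
        + t z v * t v u * t v w * t w o * t w o') := by
    intro u o o'
    have k1 : Pr p W.sym2 (fun S => cn S z u ∧ cn S z o ∧ cn S z o') ≤
        ∑ q ∈ W ×ˢ W, Pr p W.sym2 (fun S => DL [(z, q.2), (q.2, q.1), (q.2, o'), (q.1, u), (q.1, o)] S ∨
          DL [(z, q.1), (q.1, q.2), (q.2, u), (q.2, o'), (q.1, o)] S ∨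
          DL [(z, q.1), (q.1, u), (q.1, q.2), (q.2, o), (q.2, o')] S) := by
      refine Pr_union_le hp _ _ _ fun S hS ⟨a1, a2, a3⟩ => ?_
      obtain ⟨v, w, hv, hw, h⟩ := tree4 a1 a2 a3
      exact ⟨(v, w), Finset.mem_product.2 ⟨cn_mem hS hv hz, cn_mem hS hw hz⟩, h⟩
    refine k1.trans ?_
    rw [Finset.sum_product]
    refine sum_le_sum fun v _ => sum_le_sum fun w _ => ?_
    refine (Pr_or_le hp (B := fun S => DL [(z, w), (w, v), (w, o'), (v, u), (v, o)] S)
      (C := fun S => DL [(z, v), (v, w), (w, u), (w, o'), (v, o)] S ∨ DL [(z, v), (v, u), (v, w), (w, o), (w, o')] S)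
      fun S _ h => h).trans ?_
    have j1 := DL_bound hp W [(z, w), (w, v), (w, o'), (v, u), (v, o)]
    have j2 := DL_bound hp W [(z, v), (v, w), (w, u), (w, o'), (v, o)]
    have j3 := DL_bound hp W [(z, v), (v, u), (v, w), (w, o), (w, o')]
    have j4 := Pr_or_le hp (E := W.sym2) (B := fun S => DL [(z, v), (v, w), (w, u), (w, o'), (v, o)] S)
      (C := fun S => DL [(z, v), (v, u), (v, w), (w, o), (w, o')] S) fun S _ h => h
    simp only [List.map_cons, List.map_nil, List.prod_cons, List.prod_nil, mul_one] at j1 j2 j3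
    simp only [← mul_assoc] at j1 j2 j3
    linarith
  rw [h1]
  have h3 : ∑ u ∈ W, ∑ o ∈ W, ∑ o' ∈ W, (t o z * t o' z) *
        Pr p W.sym2 (fun S => cn S z u ∧ cn S z o ∧ cn S z o') ≤
      (∑ u ∈ W, ∑ o ∈ W, ∑ o' ∈ W, ∑ v ∈ W, ∑ w ∈ W, (t z w * t w v) * t v u * (t v o * t o z) * (t w o' * t o' z)) +
      (∑ u ∈ W, ∑ o ∈ W, ∑ o' ∈ W, ∑ v ∈ W, ∑ w ∈ W, (t z v * t v w) * t w u * (t v o * t o z) * (t w o' * t o' z)) +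
      (∑ u ∈ W, ∑ o ∈ W, ∑ o' ∈ W, ∑ v ∈ W, ∑ w ∈ W, (t z v * t v w) * t v u * (t w o * t o z) * (t w o' * t o' z)) := by
    simp only [← sum_add_distrib]
    refine sum_le_sum fun u _ => sum_le_sum fun o _ => sum_le_sum fun o' _ => ?_
    refine (mul_le_mul_of_nonneg_left (h2 u o o') (mul_nonneg (t0 _ _) (t0 _ _))).trans (le_of_eq ?_)
    rw [mul_sum]
    refine sum_congr rfl fun v _ => ?_
    rw [mul_sum]
    refine sum_congr rfl fun w _ => by ring
  refine h3.trans ?_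
  rw [five W (fun v w => t z w * t w v) (fun v w u => t v u) (fun v w o => t v o * t o z) (fun v w o' => t w o' * t o' z),
    five W (fun v w => t z v * t v w) (fun v w u => t w u) (fun v w o => t v o * t o z) (fun v w o' => t w o' * t o' z),
    five W (fun v w => t z v * t v w) (fun v w u => t v u) (fun v w o => t w o * t o z) (fun v w o' => t w o' * t o' z)]
  have d2 : ∀ a b, ∑ o ∈ W, t a o * t o b = t2 p W a b := fun a b => rfl
  simp only [d2]
  have GG : ∑ w ∈ W, (t z w * t2 p W w z) * ∑ v ∈ W, t w v * t2 p W v z ≤ G * G := by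
    refine (sum_le_sum fun w hw => mul_le_mul_of_nonneg_left (hG w hw z hz) (mul_nonneg (t0 _ _) (s0 _ _))).trans ?_
    rw [← sum_mul]
    exact mul_le_mul_of_nonneg_right (hG z hz z hz) hG0
  have b1 : ∑ v ∈ W, ∑ w ∈ W, t z w * t w v * (∑ u ∈ W, t v u) * t2 p W v z * t2 p W w z ≤ Xh * (G * G) := by
    rw [sum_comm]
    refine le_trans ?_ (mul_le_mul_of_nonneg_left GG hX0)
    rw [mul_sum]
    refine sum_le_sum fun w _ => ?_
    rw [mul_sum, mul_sum]
    refine sum_le_sum fun v _ => ?_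
    have := mul_le_mul_of_nonneg_left (hX v) (mul_nonneg (mul_nonneg (t0 z w) (t0 w v)) (mul_nonneg (s0 v z) (s0 w z)))
    nlinarith [this]
  have b2 : ∑ v ∈ W, ∑ w ∈ W, t z v * t v w * (∑ u ∈ W, t w u) * t2 p W v z * t2 p W w z ≤ Xh * (G * G) := by
    refine le_trans ?_ (mul_le_mul_of_nonneg_left GG hX0)
    rw [mul_sum]
    refine sum_le_sum fun w _ => ?_
    rw [mul_sum, mul_sum]
    refine sum_le_sum fun v _ => ?_
    have := mul_le_mul_of_nonneg_left (hX v) (mul_nonneg (mul_nonneg (t0 z w) (t0 w v)) (mul_nonneg (s0 v z) (s0 w z)))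
    nlinarith [this]
  have b3 : ∑ v ∈ W, ∑ w ∈ W, t z v * t v w * (∑ u ∈ W, t v u) * t2 p W w z * t2 p W w z ≤ Xh * T := by
    rw [sum_comm]
    refine le_trans ?_ (mul_le_mul_of_nonneg_left (hT z hz) hX0)
    rw [mul_sum]
    refine sum_le_sum fun w _ => ?_
    have e3 : t2 p W w z ^ 3 = ∑ v ∈ W, (t z v * t v w) * (t2 p W w z * t2 p W w z) := by
      rw [← sum_mul, d2, t2_comm W z w]; ring
    rw [e3, mul_sum]
    refine sum_le_sum fun v _ => ?_
    have := mul_le_mul_of_nonneg_left (hX v) (mul_nonneg (mul_nonneg (t0 z v) (t0 v w)) (mul_nonneg (s0 w z) (s0 w z)))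
    nlinarith [this]
  linarith

lemma Sz_nn (hp : IsP p) (W : Finset X) (S : Finset (Sym2 X)) (z : X) : 0 ≤ Sz p W S z :=
  sum_nonneg fun _ _ => mul_nonneg (ind_nn _) (ta_nn hp _ _ _)

lemma M6diff {J : Sym2 X → ℝ} (hJ : ∀ e, 0 ≤ J e) {β : ℝ} (hβ : 0 ≤ β) {W : Finset X} {Xh G T g : ℝ} (hX0 : 0 ≤ Xh) (hG0 : 0 ≤ G)
    (hg0 : 0 ≤ g) (hX : ∀ x, ∑ u ∈ W, ta (pb J β) W x u ≤ Xh)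
    (hG : ∀ a ∈ W, ∀ b ∈ W, ∑ v ∈ W, ta (pb J β) W a v * t2 (pb J β) W v b ≤ G)
    (hT : ∀ z ∈ W, ∑ w ∈ W, t2 (pb J β) W w z ^ 3 ≤ T)
    (hg : ∀ U ⊆ W, ∀ z ∈ W, gU (pb J β) U z ≤ g) :
    (∑ o ∈ W, (∑ u ∈ W, ta (pb J β) W o u) ^ 2) ^ 2 ≤
      (∑ x ∈ W, ∑ y ∈ W, ta (pb J β) W x y +
        2 * β * ∑ e ∈ W.sym2, J e * ex (pb J β) W.sym2 (fun S => fX W (insert e S) - fX W S)) *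
      ((1 + g) * (W.card * (Xh * (2 * G ^ 2 + T)))) := by
  set p := pb J β with hpd
  have hp : IsP p := pb_isP hJ hβ
  have hY := Y_le hp W
  have hg1 : ∀ S z, 0 ≤ 1 + gz p W S z := fun S z => by
    have := gU_nn hp (nc W {z} S) z; unfold gz; linarith
  have hY0 : 0 ≤ ∑ o ∈ W, (∑ u ∈ W, ta p W o u) ^ 2 := sum_nonneg fun _ _ => sq_nonneg _
  have c1 : (∑ z ∈ W, ex p W.sym2 (fun S => kz W S z * Sz p W S z * (1 + gz p W S z))) ^ 2 ≤
      (∑ z ∈ W, ex p W.sym2 (fun S => kz W S z * (1 + gz p W S z))) *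
      (∑ z ∈ W, ex p W.sym2 (fun S => kz W S z * Sz p W S z ^ 2 * (1 + gz p W S z))) := by
    refine Finset.sum_sq_le_sum_mul_sum_of_sq_le_mul _
      (fun z _ => ex_nn hp fun S _ => mul_nonneg (kz_nn _ _ _) (hg1 S z))
      (fun z _ => ex_nn hp fun S _ => mul_nonneg (mul_nonneg (kz_nn _ _ _) (sq_nonneg _)) (hg1 S z)) fun z _ => ?_
    refine ex_cs2 hp _ (fun S => mul_nonneg (kz_nn _ _ _) (hg1 S z))
      (fun S => mul_nonneg (mul_nonneg (kz_nn _ _ _) (sq_nonneg _)) (hg1 S z)) fun S => le_of_eq (by ring)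
  have c2 : ∑ z ∈ W, ex p W.sym2 (fun S => kz W S z * (1 + gz p W S z)) ≤
      ∑ x ∈ W, ∑ y ∈ W, ta p W x y +
        2 * β * ∑ e ∈ W.sym2, J e * ex p W.sym2 (fun S => fX W (insert e S) - fX W S) := by
    refine le_trans (le_of_eq ?_) (add_le_add_right (kg_le hJ hβ W) _)
    rw [← sum_add_distrib]
    refine sum_congr rfl fun z _ => ?_
    simp only [mul_add, mul_one]
    rw [ex_add]
    congr 1
    unfold kz; rw [ex_sum]; rfl
  have c3 : ∑ z ∈ W, ex p W.sym2 (fun S => kz W S z * Sz p W S z ^ 2 * (1 + gz p W S z)) ≤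
      (1 + g) * (W.card * (Xh * (2 * G ^ 2 + T))) := by
    have : ∀ z ∈ W, ex p W.sym2 (fun S => kz W S z * Sz p W S z ^ 2 * (1 + gz p W S z)) ≤
        (1 + g) * (Xh * (2 * G ^ 2 + T)) := fun z hz => by
      refine le_trans ?_ (mul_le_mul_of_nonneg_left (four_pt hp hX0 hG0 hX hG hT hz) (by linarith))
      rw [← ex_mul]
      refine ex_mono hp fun S _ => ?_
      rw [mul_comm]
      refine mul_le_mul_of_nonneg_right ?_ (mul_nonneg (kz_nn _ _ _) (sq_nonneg _))
      have := hg (nc W {z} S) (fun v hv => (mem_nc.1 hv).1) z hz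
      unfold gz; linarith
    refine (sum_le_sum this).trans (le_of_eq ?_)
    rw [sum_const, nsmul_eq_mul]; ring
  refine (pow_le_pow_left₀ hY0 hY 2).trans (c1.trans ?_)
  refine mul_le_mul c2 c3 (sum_nonneg fun z _ => ex_nn hp fun S _ => mul_nonneg (mul_nonneg (kz_nn _ _ _) (sq_nonneg _)) (hg1 S z)) ?_
  exact (sum_nonneg fun z _ => ex_nn hp fun S _ => mul_nonneg (kz_nn _ _ _) (hg1 S z)).trans c2

end m6


section m6b
open Classical
variable {d : ℕ} {J : V d → V d → ℝ} {α c C : ℝ}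

lemma cover3 {X : Type*} (W : Finset X) {f : X → ℝ} (hf : ∀ v ∈ W, 0 ≤ f v) (A B D : X → Prop)
    [DecidablePred A] [DecidablePred B] [DecidablePred D] (h : ∀ v ∈ W, A v ∨ B v ∨ D v) :
    ∑ v ∈ W, f v ≤ ∑ v ∈ W.filter A, f v + ∑ v ∈ W.filter B, f v + ∑ v ∈ W.filter D, f v := by
  rw [Finset.sum_filter, Finset.sum_filter, Finset.sum_filter, ← sum_add_distrib, ← sum_add_distrib]
  refine sum_le_sum fun v hv => ?_
  have h0 := hf v hv
  have h1 := h v hv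
  split_ifs <;> first | linarith | (exfalso; tauto)

lemma conv (hd : d = 1 ∨ d = 2) (hα : 0 < α) (hα1 : α ≤ 1) (hd3 : (d : ℝ) = 3 * α) (W : Finset (V d)) (x y : V d) :
    ∑ v ∈ W, br x v ^ (α - d) * br v y ^ (α - d) ≤ 176 / α * br x y ^ (-α) := by
  set D := br x y with hD
  have hD1 : 1 ≤ D := br_ge1 x y
  have hD0 : 0 < D := br_pos x y
  set r0 : ℕ := max 1 (di x y) with hr0
  have hr : (r0 : ℝ) = D := by rw [hr0, hD, br]; push_cast; rfl
  have hr1 : 1 ≤ 2 * r0 := by have : 1 ≤ r0 := le_max_left _ _; omega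
  have hcr : ((2 * r0 : ℕ) : ℝ) = 2 * D := by push_cast; rw [hr]
  have e2 : α - (d:ℝ) = -(2 * α) := by rw [hd3]; ring
  have two4 : (2:ℝ) ^ (2 * α) ≤ 4 := by
    calc (2:ℝ) ^ (2 * α) ≤ (2:ℝ) ^ (2:ℝ) := Real.rpow_le_rpow_of_exponent_le (by norm_num) (by linarith)
      _ = 4 := by norm_num
  have half : ∀ b : ℝ, 0 < b → ∀ a : ℝ, b / 2 ≤ a → a ^ (α - d) ≤ 4 * b ^ (-(2 * α)) := fun b hb a ha => by
    rw [e2]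
    calc a ^ (-(2 * α)) ≤ (b / 2) ^ (-(2 * α)) := Real.rpow_le_rpow_of_nonpos (by positivity) ha (by linarith)
      _ = 2 ^ (2 * α) * b ^ (-(2 * α)) := by
          rw [Real.div_rpow hb.le (by norm_num), Real.rpow_neg (by norm_num : (0:ℝ) ≤ 2), div_inv_eq_mul, mul_comm]
      _ ≤ _ := mul_le_mul_of_nonneg_right two4 (Real.rpow_nonneg hb.le _)
  have l1 : ∀ z : V d, ∀ W' : Finset (V d), (∀ v ∈ W', di z v ≤ 2 * r0) → ∑ v ∈ W', br z v ^ (α - d) ≤ 18 / α * D ^ α := by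
    intro z W' h
    refine (lat1 hd hα hα1 z hr1 W' h).trans ?_
    rw [hcr, Real.mul_rpow (by norm_num) hD0.le]
    have : (2:ℝ) ^ α ≤ 2 := by
      calc (2:ℝ) ^ α ≤ (2:ℝ) ^ (1:ℝ) := Real.rpow_le_rpow_of_exponent_le (by norm_num) hα1
        _ = 2 := by norm_num
    have k : 9 / α * (2 ^ α * D ^ α) ≤ 9 / α * (2 * D ^ α) := by gcongr
    refine k.trans (le_of_eq ?_); ring
  have hDD : D ^ (-(2 * α)) * D ^ α = D ^ (-α) := by rw [← Real.rpow_add hD0]; congr 1; ring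
  have cov := cover3 W (f := fun v => br x v ^ (α - d) * br v y ^ (α - d))
    (fun v _ => mul_nonneg (br_rpow _ _ _).le (br_rpow _ _ _).le)
    (fun v => di x v ≤ 2 * r0 ∧ D / 2 ≤ br v y) (fun v => di y v ≤ 2 * r0 ∧ D / 2 ≤ br x v) (fun v => 2 * r0 < di x v) (by
      intro v _
      by_cases h1 : di x v ≤ 2 * r0
      · by_cases h2 : D / 2 ≤ br v y
        · exact Or.inl ⟨h1, h2⟩
        · right; left
          push Not at h2
          have := br_tri x v y
          refine ⟨?_, by linarith⟩
          have h3 : (di y v : ℝ) ≤ br v y := by rw [di_comm]; exact le_max_right _ _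
          have : (di y v : ℝ) ≤ ((2 * r0 : ℕ) : ℝ) := by rw [hcr]; linarith
          exact_mod_cast this
      · right; right; omega)
  have s1 : ∑ v ∈ W.filter (fun v => di x v ≤ 2 * r0 ∧ D / 2 ≤ br v y), br x v ^ (α - d) * br v y ^ (α - d) ≤ 72 / α * D ^ (-α) := by
    calc _ ≤ ∑ v ∈ W.filter (fun v => di x v ≤ 2 * r0 ∧ D / 2 ≤ br v y), br x v ^ (α - d) * (4 * D ^ (-(2 * α))) :=
          sum_le_sum fun v hv => mul_le_mul_of_nonneg_left (half D hD0 _ (Finset.mem_filter.1 hv).2.2) (br_rpow _ _ _).le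
      _ ≤ (18 / α * D ^ α) * (4 * D ^ (-(2 * α))) := by
          rw [← sum_mul]
          exact mul_le_mul_of_nonneg_right (l1 x _ fun v hv => (Finset.mem_filter.1 hv).2.1) (by positivity)
      _ = 72 / α * (D ^ (-(2 * α)) * D ^ α) := by ring
      _ = _ := by rw [hDD]
  have s2 : ∑ v ∈ W.filter (fun v => di y v ≤ 2 * r0 ∧ D / 2 ≤ br x v), br x v ^ (α - d) * br v y ^ (α - d) ≤ 72 / α * D ^ (-α) := by
    calc _ ≤ ∑ v ∈ W.filter (fun v => di y v ≤ 2 * r0 ∧ D / 2 ≤ br x v), (4 * D ^ (-(2 * α))) * br y v ^ (α - d) :=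
          sum_le_sum fun v hv => by
            rw [br_comm v y]
            exact mul_le_mul_of_nonneg_right (half D hD0 _ (Finset.mem_filter.1 hv).2.2) (br_rpow _ _ _).le
      _ ≤ (4 * D ^ (-(2 * α))) * (18 / α * D ^ α) := by
          rw [← mul_sum]
          exact mul_le_mul_of_nonneg_left (l1 y _ fun v hv => (Finset.mem_filter.1 hv).2.1) (by positivity)
      _ = 72 / α * (D ^ (-(2 * α)) * D ^ α) := by ring
      _ = _ := by rw [hDD]
  have s3 : ∑ v ∈ W.filter (fun v => 2 * r0 < di x v), br x v ^ (α - d) * br v y ^ (α - d) ≤ 32 / α * D ^ (-α) := by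
    calc _ ≤ ∑ v ∈ W.filter (fun v => 2 * r0 < di x v), 4 * br x v ^ (-(d:ℝ) - α) :=
          sum_le_sum fun v hv => by
            have h1 := (Finset.mem_filter.1 hv).2
            have h2 : 2 * D < br x v := by
              rw [← hcr]; exact lt_of_lt_of_le (by exact_mod_cast h1) (le_max_right _ _)
            have h3 := br_tri x y v
            rw [br_comm y v] at h3
            have h4 := half (br x v) (br_pos _ _) (br v y) (by linarith)
            refine (mul_le_mul_of_nonneg_left h4 (br_rpow _ _ _).le).trans (le_of_eq ?_)
            rw [e2, mul_left_comm, ← Real.rpow_add (br_pos _ _), hd3]; congr 2; ring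
      _ ≤ 4 * (8 / α * ((2 * r0 : ℕ) : ℝ) ^ (-α)) := by
          rw [← mul_sum]
          exact mul_le_mul_of_nonneg_left (lat2 hd hα x hr1 _ fun v hv => (Finset.mem_filter.1 hv).2) (by norm_num)
      _ ≤ 4 * (8 / α * D ^ (-α)) := by
          have : ((2 * r0 : ℕ) : ℝ) ^ (-α) ≤ D ^ (-α) :=
            Real.rpow_le_rpow_of_nonpos hD0 (by rw [hcr]; linarith) (by linarith)
          gcongr
      _ = _ := by ring
  refine cov.trans ((add_le_add (add_le_add s1 s2) s3).trans (le_of_eq ?_)); ring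

lemma Gbound (hd : d = 1 ∨ d = 2) (hα : 0 < α) (hd3 : (d : ℝ) = 3 * α) (W : Finset (V d)) {t s : V d → V d → ℝ}
    (t0 : ∀ x y, 0 ≤ t x y) (s0 : ∀ x y, 0 ≤ s x y) {A B Xh : ℝ} (hA : 0 ≤ A) (hB : 0 ≤ B)
    (ht : ∀ x ∈ W, ∀ y ∈ W, t x y ≤ A * br x y ^ (α - d)) (hs : ∀ x ∈ W, ∀ y ∈ W, s x y ≤ B * br x y ^ (-α))
    {a b : V d} (ha : a ∈ W) (hb : b ∈ W) (h0 : 0 ≤ Xh) (h1 : ∑ v ∈ W, t a v ≤ Xh) (h2 : ∑ v ∈ W, s v b ≤ Xh * Xh)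
    {R : ℕ} (hR : 1 ≤ R) (hXR : Xh ≤ (R : ℝ) ^ α) :
    ∑ v ∈ W, t a v * s v b ≤ 18 * A * B * (1 + Real.log R) + A + B := by
  have hR0 : (0:ℝ) < R := by exact_mod_cast hR
  have e2 : α - (d:ℝ) = -(2 * α) := by rw [hd3]; ring
  have cov := cover3 W (f := fun v => t a v * s v b) (fun v _ => mul_nonneg (t0 _ _) (s0 _ _))
    (fun v => di a v ≤ R ∧ di b v ≤ R) (fun v => R < di b v) (fun v => R < di a v) (fun v _ => by omega)
  have brR : ∀ x v : V d, R < di x v → (R:ℝ) ≤ br x v := fun x v h =>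
    le_trans (by exact_mod_cast h.le) (le_max_right _ _)
  have pq : ∀ p q : ℝ, 0 < p → 0 < q → p ^ (α - d) * q ^ (-α) ≤ p ^ (-(d:ℝ)) + q ^ (-(d:ℝ)) := by
    intro p q hp hq
    rcases le_total p q with h | h
    · have : q ^ (-α) ≤ p ^ (-α) := Real.rpow_le_rpow_of_nonpos hp h (by linarith)
      have k := mul_le_mul_of_nonneg_left this (Real.rpow_nonneg hp.le (α - d))
      rw [← Real.rpow_add hp] at k
      have e : α - (d:ℝ) + -α = -(d:ℝ) := by ring
      rw [e] at k
      linarith [Real.rpow_nonneg hq.le (-(d:ℝ))]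
    · have : p ^ (α - d) ≤ q ^ (α - d) := Real.rpow_le_rpow_of_nonpos hq h (by rw [e2]; linarith)
      have k := mul_le_mul_of_nonneg_right this (Real.rpow_nonneg hq.le (-α))
      rw [← Real.rpow_add hq (α - d)] at k
      have e : α - (d:ℝ) + -α = -(d:ℝ) := by ring
      rw [e] at k
      linarith [Real.rpow_nonneg hp.le (-(d:ℝ))]
  have s1 : ∑ v ∈ W.filter (fun v => di a v ≤ R ∧ di b v ≤ R), t a v * s v b ≤ 18 * A * B * (1 + Real.log R) := by
    calc _ ≤ ∑ v ∈ W.filter (fun v => di a v ≤ R ∧ di b v ≤ R), (A * B) * (br a v ^ (-(d:ℝ)) + br b v ^ (-(d:ℝ))) :=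
          sum_le_sum fun v hv => by
            have hv := (Finset.mem_filter.1 hv).1
            refine (mul_le_mul (ht a ha v hv) (hs v hv b hb) (s0 _ _) (mul_nonneg hA (br_rpow _ _ _).le)).trans ?_
            have := mul_le_mul_of_nonneg_left (pq (br a v) (br v b) (br_pos _ _) (br_pos _ _)) (mul_nonneg hA hB)
            rw [br_comm b v]
            refine le_trans (le_of_eq ?_) this
            ring
      _ ≤ (A * B) * (9 * (1 + Real.log R) + 9 * (1 + Real.log R)) := by
          rw [← mul_sum, sum_add_distrib]
          refine mul_le_mul_of_nonneg_left (add_le_add ?_ ?_) (mul_nonneg hA hB)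
          · exact lat3 hd a hR _ fun v hv => (Finset.mem_filter.1 hv).2.1
          · exact lat3 hd b hR _ fun v hv => (Finset.mem_filter.1 hv).2.2
      _ = _ := by ring
  have s2 : ∑ v ∈ W.filter (fun v => R < di b v), t a v * s v b ≤ B := by
    calc _ ≤ ∑ v ∈ W.filter (fun v => R < di b v), t a v * (B * (R:ℝ) ^ (-α)) :=
          sum_le_sum fun v hv => by
            refine mul_le_mul_of_nonneg_left ((hs v (Finset.mem_filter.1 hv).1 b hb).trans ?_) (t0 _ _)
            refine mul_le_mul_of_nonneg_left ?_ hB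
            rw [br_comm]
            exact Real.rpow_le_rpow_of_nonpos hR0 (brR b v (Finset.mem_filter.1 hv).2) (by linarith)
      _ ≤ (R:ℝ) ^ α * (B * (R:ℝ) ^ (-α)) := by
          rw [← sum_mul]
          refine mul_le_mul_of_nonneg_right ?_ (by positivity)
          exact ((sum_le_sum_of_subset_of_nonneg (filter_subset _ _) fun v _ _ => t0 _ _).trans h1).trans hXR
      _ = B := by
          rw [mul_left_comm, ← Real.rpow_add hR0]; simp
  have s3 : ∑ v ∈ W.filter (fun v => R < di a v), t a v * s v b ≤ A := by
    calc _ ≤ ∑ v ∈ W.filter (fun v => R < di a v), (A * (R:ℝ) ^ (α - d)) * s v b :=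
          sum_le_sum fun v hv => by
            refine mul_le_mul_of_nonneg_right ((ht a ha v (Finset.mem_filter.1 hv).1).trans ?_) (s0 _ _)
            refine mul_le_mul_of_nonneg_left ?_ hA
            exact Real.rpow_le_rpow_of_nonpos hR0 (brR a v (Finset.mem_filter.1 hv).2) (by rw [e2]; linarith)
      _ ≤ (A * (R:ℝ) ^ (α - d)) * ((R:ℝ) ^ α * (R:ℝ) ^ α) := by
          rw [← mul_sum]
          refine mul_le_mul_of_nonneg_left ?_ (by positivity)
          exact ((sum_le_sum_of_subset_of_nonneg (filter_subset _ _) fun v _ _ => s0 _ _).trans h2).trans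
            (mul_le_mul hXR hXR h0 (by positivity))
      _ = A := by
          rw [mul_assoc, ← Real.rpow_add hR0, ← Real.rpow_add hR0, e2]
          have : -(2 * α) + (α + α) = 0 := by ring
          rw [this]; simp
  linarith

lemma Tbound (hd : d = 1 ∨ d = 2) (hα : 0 < α) (hd3 : (d : ℝ) = 3 * α) (W : Finset (V d)) {s : V d → V d → ℝ}
    (s0 : ∀ x y, 0 ≤ s x y) {B Xh : ℝ} (hB : 0 ≤ B)
    (hs : ∀ x ∈ W, ∀ y ∈ W, s x y ≤ B * br x y ^ (-α))
    {b : V d} (hb : b ∈ W) (h0 : 0 ≤ Xh) (h2 : ∑ v ∈ W, s v b ≤ Xh * Xh)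
    {R : ℕ} (hR : 1 ≤ R) (hXR : Xh ≤ (R : ℝ) ^ α) :
    ∑ v ∈ W, s v b ^ 3 ≤ 9 * B ^ 3 * (1 + Real.log R) + B ^ 2 := by
  have hR0 : (0:ℝ) < R := by exact_mod_cast hR
  rw [← sum_filter_add_sum_filter_not W (fun v => di b v ≤ R)]
  refine add_le_add ?_ ?_
  · calc _ ≤ ∑ v ∈ W.filter (fun v => di b v ≤ R), B ^ 3 * br b v ^ (-(d:ℝ)) :=
          sum_le_sum fun v hv => by
            refine (pow_le_pow_left₀ (s0 _ _) (hs v (Finset.mem_filter.1 hv).1 b hb) 3).trans (le_of_eq ?_)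
            rw [mul_pow, ← Real.rpow_natCast (br v b ^ (-α)), ← Real.rpow_mul (br_pos _ _).le, br_comm, hd3]
            congr 2; push_cast; ring
      _ ≤ B ^ 3 * (9 * (1 + Real.log R)) := by
          rw [← mul_sum]
          exact mul_le_mul_of_nonneg_left (lat3 hd b hR _ fun v hv => (Finset.mem_filter.1 hv).2) (by positivity)
      _ = _ := by ring
  · calc _ ≤ ∑ v ∈ W.filter (fun v => ¬ di b v ≤ R), (B * (R:ℝ) ^ (-α)) ^ 2 * s v b :=
          sum_le_sum fun v hv => by
            obtain ⟨hv, hv2⟩ := Finset.mem_filter.1 hv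
            rw [pow_succ]
            refine mul_le_mul_of_nonneg_right (pow_le_pow_left₀ (s0 _ _) ((hs v hv b hb).trans ?_) 2) (s0 _ _)
            refine mul_le_mul_of_nonneg_left ?_ hB
            rw [br_comm]
            exact Real.rpow_le_rpow_of_nonpos hR0 (le_trans (by exact_mod_cast (not_le.1 hv2).le) (le_max_right _ _)) (by linarith)
      _ ≤ (B * (R:ℝ) ^ (-α)) ^ 2 * ((R:ℝ) ^ α * (R:ℝ) ^ α) := by
          rw [← mul_sum]
          refine mul_le_mul_of_nonneg_left ?_ (by positivity)
          exact ((sum_le_sum_of_subset_of_nonneg (filter_subset _ _) fun v _ _ => s0 _ _).trans h2).trans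
            (mul_le_mul hXR hXR h0 (by positivity))
      _ = B ^ 2 * (((R:ℝ) ^ (-α) * (R:ℝ) ^ α) * ((R:ℝ) ^ (-α) * (R:ℝ) ^ α)) := by ring
      _ = B ^ 2 := by rw [← Real.rpow_add hR0]; simp

lemma volume (hJ : KernelHyp d J α c C) (hd : d = 1 ∨ d = 2) {β Xh : ℝ} (hβ : 0 ≤ β) (hX : 0 ≤ Xh) (hn : ¬ Bdd J β (Xh / 2)) :
    ∃ N, ((bx (0 : V d) N).card : ℝ) * (Xh / 4) ≤
      ∑ x ∈ bx (0 : V d) N, ∑ y ∈ bx (0 : V d) N, tau J β (bx 0 N) x y := by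
  unfold Bdd at hn
  push Not at hn
  obtain ⟨W, x, h⟩ := hn
  set r := W.sup (fun u => di x u) with hr
  have hru : ∀ u ∈ W, di x u ≤ r := fun u hu => Finset.le_sup (f := fun u => di x u) hu
  refine ⟨5 * r, ?_⟩
  have h1 : ∀ y ∈ bx (0 : V d) (4 * r), Xh / 2 ≤ ∑ u ∈ bx (0 : V d) (5 * r), tau J β (bx 0 (5 * r)) y u := by
    intro y hy
    have hsub : shS (y - x) W ⊆ bx 0 (5 * r) := fun v hv => by
      rw [mem_shS] at hv
      have k1 := hru _ hv
      have k2 := di_shift x (v - (y - x)) (y - x)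
      have e1 : x + (y - x) = y := by abel
      have e2 : v - (y - x) + (y - x) = v := by abel
      rw [e1, e2] at k2
      rw [mem_bx] at hy ⊢
      have := di_tri 0 y v
      omega
    calc Xh / 2 ≤ ∑ u ∈ W, tau J β W x u := h.le
      _ = ∑ u ∈ W, tau J β (shS (y - x) W) y (u + (y - x)) := sum_congr rfl fun u _ => by
          have := tau_shift hJ β (y - x) W x u
          have e1 : x + (y - x) = y := by abel
          rw [e1] at this; exact this.symm
      _ = ∑ u ∈ shS (y - x) W, tau J β (shS (y - x) W) y u := (sum_shS _ _ _).symm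
      _ ≤ ∑ u ∈ shS (y - x) W, tau J β (bx 0 (5 * r)) y u := sum_le_sum fun u _ => tau_mono hJ hβ hsub _ _
      _ ≤ _ := sum_le_sum_of_subset_of_nonneg hsub fun u _ _ => tau_nn hJ hβ _ _ _
  have h2 : bx (0 : V d) (4 * r) ⊆ bx 0 (5 * r) := bx_mono (by omega)
  refine le_trans ?_ (sum_le_sum_of_subset_of_nonneg h2 fun y _ _ => sum_nonneg fun u _ => tau_nn hJ hβ _ _ _)
  refine le_trans ?_ (sum_le_sum h1)
  rw [sum_const, nsmul_eq_mul, bx_card, bx_card]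
  have h3 : (((2 * (5 * r) + 1) ^ d : ℕ) : ℝ) ≤ 2 * (((2 * (4 * r) + 1) ^ d : ℕ) : ℝ) := by
    have : (2 * (5 * r) + 1) ^ d ≤ 2 * (2 * (4 * r) + 1) ^ d := by
      rcases hd with rfl | rfl
      · rw [pow_one, pow_one]; omega
      · nlinarith [Nat.zero_le r, Nat.zero_le (r * r)]
    exact_mod_cast this
  nlinarith [h3]

end m6b


section m6c
open Classical
variable {d : ℕ} {J : V d → V d → ℝ} {α c C : ℝ}

noncomputable def dX (J : V d → V d → ℝ) (W : Finset (V d)) (β : ℝ) : ℝ :=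
  ∑ e ∈ W.sym2, Jt J e * ex (pb (Jt J) β) W.sym2 (fun S => fX W (insert e S) - fX W S)

lemma X_deriv (W : Finset (V d)) (β : ℝ) :
    HasDerivAt (fun β => ∑ x ∈ W, ∑ y ∈ W, tau J β W x y) (dX J W β) β := by
  have := russo (Jt J) W.sym2 (fX W) β
  refine this.congr_of_eventuallyEq (Filter.Eventually.of_forall fun γ => ?_)
  unfold fX
  simp only [ex_sum]
  rfl

lemma cutR (hα : 0 < α) {Xh : ℝ} (hX : 1 ≤ Xh) : ∃ R : ℕ, 1 ≤ R ∧ Xh ≤ (R:ℝ) ^ α ∧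
    1 + Real.log R ≤ (2 + 1 / α) * (1 + Real.log Xh) := by
  have hl : 0 ≤ Real.log Xh := Real.log_nonneg hX
  have h1 : 1 ≤ Xh ^ (1 / α) := Real.one_le_rpow hX (by positivity)
  refine ⟨⌈Xh ^ (1 / α)⌉₊, Nat.one_le_ceil_iff.2 (by linarith), ?_, ?_⟩
  · calc Xh = (Xh ^ (1 / α)) ^ α := by rw [← Real.rpow_mul (by linarith), one_div_mul_cancel hα.ne', Real.rpow_one]
      _ ≤ _ := Real.rpow_le_rpow (by positivity) (Nat.le_ceil _) hα.le
  · have h2 : (⌈Xh ^ (1 / α)⌉₊ : ℝ) ≤ 2 * Xh ^ (1 / α) := by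
      have := (Nat.ceil_lt_add_one (a := Xh ^ (1 / α)) (by linarith)).le
      linarith
    have h3 : Real.log ⌈Xh ^ (1 / α)⌉₊ ≤ Real.log 2 + 1 / α * Real.log Xh := by
      refine (Real.log_le_log (by exact_mod_cast Nat.ceil_pos.2 (by linarith)) h2).trans (le_of_eq ?_)
      rw [Real.log_mul (by norm_num) (by linarith), Real.log_rpow (by linarith)]
    have h4 := Real.log_two_lt_d9
    have h5 : 0 ≤ 1 / α := by positivity
    nlinarith

lemma gU_le (hJ : KernelHyp d J α c C) {β Xh : ℝ} (hβ : 0 ≤ β) (hX : 0 ≤ Xh) (hB : Bdd J β Xh) (U : Finset (V d)) (z : V d) :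
    gU (pp J β) U z ≤ β * Jtot J * Xh := by
  unfold gU
  calc _ ≤ ∑ c ∈ U, (β * J z c) * Xh := sum_le_sum fun c _ =>
        mul_le_mul (pp_le hJ z c) (hB U c) (sum_nonneg fun u _ => tau_nn hJ hβ U c u) (mul_nonneg hβ (hJ.nonneg _ _))
    _ = β * Xh * ∑ c ∈ U, J z c := by rw [mul_sum]; refine sum_congr rfl fun c _ => by ring
    _ ≤ β * Xh * Jtot J := mul_le_mul_of_nonneg_left (row_sum hJ z U) (by positivity)
    _ = _ := by ring

set_option maxHeartbeats 1000000 in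
lemma M6core (hd : d = 1 ∨ d = 2) (hα : α = (d:ℝ) / 3) (hJ : KernelHyp d J α c C) {β₀ : ℝ} (h0 : 0 < β₀) (β₁ : ℝ) (h01 : β₀ ≤ β₁) :
    ∃ C1 : ℝ, 0 < C1 ∧ ∀ β Xh, β₀ ≤ β → β ≤ β₁ → 1 ≤ Xh → Bdd J β Xh → ∀ W : Finset (V d),
      (∑ o ∈ W, (∑ u ∈ W, tau J β W o u) ^ 2) ^ 2 ≤
      (∑ x ∈ W, ∑ y ∈ W, tau J β W x y + 2 * β * dX J W β) * (W.card * (C1 * Xh ^ 2 * (1 + Real.log Xh) ^ 2)) := by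
  have hα0 := hJ.alpha_pos
  have hd3 : (d:ℝ) = 3 * α := by rw [hα]; ring
  have hα1 : α ≤ 1 := by
    rw [hα]; rcases hd with rfl | rfl <;> norm_num
  obtain ⟨A, hA, hC⟩ := stepC hd hα hJ h0 β₁
  set B := A ^ 2 * (176 / α) with hBdef
  have hB : 0 < B := by positivity
  set CG := 18 * A * B * (2 + 1 / α) + A + B with hCG
  set CT := 9 * B ^ 3 * (2 + 1 / α) + B ^ 2 with hCT
  have hCG0 : 0 < CG := by positivity
  have hCT0 : 0 < CT := by positivity
  clear_value CG CT B
  have hJ0 := Jtot_nn hJ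
  have hb1 : 0 < β₁ := lt_of_lt_of_le h0 h01
  refine ⟨(1 + β₁ * Jtot J) * (2 * CG ^ 2 + CT), by positivity, ?_⟩
  intro β Xh hb hb' hX hBd W
  have hβ : 0 ≤ β := h0.le.trans hb
  have hp : IsP (pp J β) := pp_isP hJ hβ
  set L := 1 + Real.log Xh with hL
  have hL1 : 1 ≤ L := by have := Real.log_nonneg hX; linarith
  clear_value L
  have hX0 : 0 ≤ Xh := by linarith
  obtain ⟨R, hR, hXR, hRL⟩ := cutR hα0 hX
  have t0 : ∀ x y, 0 ≤ ta (pp J β) W x y := ta_nn hp W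
  have s0 : ∀ x y, 0 ≤ t2 (pp J β) W x y := t2_nn hp W
  have ht : ∀ x ∈ W, ∀ y ∈ W, ta (pp J β) W x y ≤ A * br x y ^ (α - d) := hC β hb hb' ⟨Xh, hBd⟩ W
  have hs : ∀ x ∈ W, ∀ y ∈ W, t2 (pp J β) W x y ≤ B * br x y ^ (-α) := by
    intro x hx y hy
    calc t2 (pp J β) W x y ≤ ∑ v ∈ W, (A * br x v ^ (α - d)) * (A * br v y ^ (α - d)) :=
          sum_le_sum fun v hv => mul_le_mul (ht x hx v hv) (ht v hv y hy) (t0 _ _) (mul_nonneg hA.le (br_rpow _ _ _).le)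
      _ = A ^ 2 * ∑ v ∈ W, br x v ^ (α - d) * br v y ^ (α - d) := by
          rw [mul_sum]; refine sum_congr rfl fun v _ => by ring
      _ ≤ A ^ 2 * (176 / α * br x y ^ (-α)) := mul_le_mul_of_nonneg_left (conv hd hα0 hα1 hd3 W x y) (by positivity)
      _ = _ := by rw [hBdef]; ring
  have hS : ∀ x, ∑ u ∈ W, ta (pp J β) W x u ≤ Xh := fun x => hBd W x
  have hS2 : ∀ b, ∑ v ∈ W, t2 (pp J β) W v b ≤ Xh * Xh := fun b => by
    calc ∑ v ∈ W, t2 (pp J β) W v b = ∑ w ∈ W, ta (pp J β) W b w * ∑ v ∈ W, ta (pp J β) W w v := by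
          unfold t2
          rw [sum_comm]
          refine sum_congr rfl fun w _ => ?_
          rw [mul_sum]
          refine sum_congr rfl fun v _ => ?_
          rw [ta_comm W v w, ta_comm W w b]; ring
      _ ≤ ∑ w ∈ W, ta (pp J β) W b w * Xh := sum_le_sum fun w _ => mul_le_mul_of_nonneg_left (hS w) (t0 _ _)
      _ ≤ Xh * Xh := by rw [← sum_mul]; exact mul_le_mul_of_nonneg_right (hS b) hX0
  have hG : ∀ a ∈ W, ∀ b ∈ W, ∑ v ∈ W, ta (pp J β) W a v * t2 (pp J β) W v b ≤ CG * L := fun a ha b hb2 => by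
    refine (Gbound hd hα0 hd3 W t0 s0 hA.le hB.le ht hs ha hb2 hX0 (hS a) (hS2 b) hR hXR).trans ?_
    have := mul_le_mul_of_nonneg_left hRL (show 0 ≤ 18 * A * B by positivity)
    rw [hCG]
    nlinarith [mul_le_mul_of_nonneg_left hL1 hA.le, mul_le_mul_of_nonneg_left hL1 hB.le]
  have hT : ∀ z ∈ W, ∑ w ∈ W, t2 (pp J β) W w z ^ 3 ≤ CT * L ^ 2 := fun z hz => by
    refine (Tbound hd hα0 hd3 W s0 hB.le hs hz hX0 (hS2 z) hR hXR).trans ?_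
    have := mul_le_mul_of_nonneg_left hRL (show 0 ≤ 9 * B ^ 3 by positivity)
    have h2 : 9 * B ^ 3 * (1 + Real.log R) + B ^ 2 ≤ CT * L := by
      rw [hCT]; nlinarith [mul_le_mul_of_nonneg_left hL1 (sq_nonneg B)]
    refine h2.trans (mul_le_mul_of_nonneg_left ?_ hCT0.le)
    nlinarith
  have key := M6diff (Jt_nn hJ) hβ (W := W) hX0 (by positivity : 0 ≤ CG * L) (show 0 ≤ β * Jtot J * Xh by positivity)
    hS hG hT fun U _ z _ => gU_le hJ hβ hX0 hBd U z
  refine key.trans (mul_le_mul_of_nonneg_left ?_ ?_)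
  · have e1 : 1 + β * Jtot J * Xh ≤ (1 + β₁ * Jtot J) * Xh := by
      have e2 := mul_le_mul_of_nonneg_right hb' (mul_nonneg hJ0 hX0)
      have e3 : (1 + β₁ * Jtot J) * Xh = Xh + β₁ * (Jtot J * Xh) := by ring
      rw [e3, mul_assoc]; linarith
    calc (1 + β * Jtot J * Xh) * (W.card * (Xh * (2 * (CG * L) ^ 2 + CT * L ^ 2)))
        ≤ ((1 + β₁ * Jtot J) * Xh) * (W.card * (Xh * (2 * (CG * L) ^ 2 + CT * L ^ 2))) :=
          mul_le_mul_of_nonneg_right e1 (mul_nonneg (Nat.cast_nonneg _) (mul_nonneg hX0 (add_nonneg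
            (mul_nonneg zero_le_two (sq_nonneg _)) (mul_nonneg hCT0.le (sq_nonneg _)))))
      _ = _ := by ring
  · refine add_nonneg (sum_nonneg fun x _ => sum_nonneg fun y _ => t0 _ _) (mul_nonneg (by positivity) ?_)
    refine sum_nonneg fun e _ => mul_nonneg (Jt_nn hJ e) (ex_nn hp fun S _ => sub_nonneg.2 (fX_mono W (Finset.subset_insert _ _)))

set_option maxHeartbeats 1000000 in
lemma M6a (hd : d = 1 ∨ d = 2) (hα : α = (d:ℝ) / 3) (hJ : KernelHyp d J α c C) {β₀ : ℝ} (h0 : 0 < β₀) (b : ℝ) (h01 : β₀ ≤ b) :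
    ∃ C2 : ℝ, 0 < C2 ∧ ∀ β₁ β₂ Xh, β₀ ≤ β₁ → β₁ ≤ β₂ → β₂ ≤ b → 1 ≤ Xh → C2 * (1 + Real.log Xh) ^ 2 ≤ Xh →
      Bdd J β₂ Xh → ¬ Bdd J β₁ (Xh / 2) → β₂ - β₁ ≤ C2 * (1 + Real.log Xh) ^ 2 / Xh := by
  obtain ⟨C1, hC1, hM⟩ := M6core hd hα hJ h0 b h01
  have hb0 : 0 < b := h0.trans_le h01
  refine ⟨1024 * b * C1 + 512 * C1, by positivity, ?_⟩
  intro β₁ β₂ Xh k0 k1 k2 hX hbig hB hn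
  have hβ1 : 0 ≤ β₁ := h0.le.trans k0
  have hX0 : 0 < Xh := by linarith
  set L2 := (1 + Real.log Xh) ^ 2 with hL2
  have hL20 : 0 < L2 := by have := Real.log_nonneg hX; positivity
  obtain ⟨N, hN⟩ := volume hJ hd hβ1 hX0.le hn
  set W := bx (0 : V d) N with hW
  set w : ℝ := (W.card : ℝ) with hw
  have hw0 : 0 < w := by
    rw [hw]; exact_mod_cast Finset.card_pos.2 ⟨0, bx_self 0 N⟩
  set F : ℝ → ℝ := fun β => ∑ x ∈ W, ∑ y ∈ W, tau J β W x y with hF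
  have hFu : ∀ β, β₁ ≤ β → β ≤ β₂ → F β ≤ w * Xh := fun β hb hb' => by
    have hBb := Bdd_beta hJ (hβ1.trans hb) hb' hB
    refine (sum_le_sum fun x _ => hBb W x).trans ?_
    rw [sum_const, nsmul_eq_mul]
  have hFl : ∀ β, β₁ ≤ β → w * (Xh / 4) ≤ F β := fun β hb =>
    hN.trans (sum_le_sum fun x _ => sum_le_sum fun y _ => tau_beta hJ hβ1 hb W x y)
  have hD : ∀ β, β₁ ≤ β → β ≤ β₂ → w * Xh ^ 2 / (1024 * b * C1 * L2) ≤ dX J W β := by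
    intro β hb hb'
    have hBb := Bdd_beta hJ (hβ1.trans hb) hb' hB
    have h1 := hM β Xh (k0.trans hb) (hb'.trans k2) hX hBb W
    have hu := hFu β hb hb'
    have hl := hFl β hb
    have hdx0 : 0 ≤ dX J W β := sum_nonneg fun e _ => mul_nonneg (Jt_nn hJ e)
      (ex_nn (pp_isP hJ (hβ1.trans hb)) fun S _ => sub_nonneg.2 (fX_mono W (Finset.subset_insert _ _)))
    have hcs : F β ^ 2 ≤ w * ∑ o ∈ W, (∑ u ∈ W, tau J β W o u) ^ 2 := sq_sum_le_card_mul_sum_sq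
    set Y := ∑ o ∈ W, (∑ u ∈ W, tau J β W o u) ^ 2 with hY
    have hl2 : (w * (Xh / 4)) ^ 2 ≤ F β ^ 2 := pow_le_pow_left₀ (by positivity) hl 2
    have hYl : w * Xh ^ 2 / 16 ≤ Y := by
      have : w * (w * Xh ^ 2 / 16) ≤ w * Y := by
        refine le_trans (le_of_eq ?_) (hl2.trans hcs); ring
      exact le_of_mul_le_mul_left this hw0
    have hY2 : (w * Xh ^ 2 / 16) ^ 2 ≤ Y ^ 2 := pow_le_pow_left₀ (by positivity) hYl 2
    have hbb : 2 * β * dX J W β ≤ 2 * b * dX J W β :=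
      mul_le_mul_of_nonneg_right (by linarith) hdx0
    have h2 : (w * Xh ^ 2 / 16) ^ 2 ≤ (w * Xh + 2 * b * dX J W β) * (w * (C1 * Xh ^ 2 * L2)) := by
      refine hY2.trans (h1.trans (mul_le_mul_of_nonneg_right ?_ (by positivity)))
      exact add_le_add hu hbb
    have h3 : w * Xh ^ 2 ≤ 256 * (w * Xh + 2 * b * dX J W β) * (C1 * L2) := by
      have hp : 0 < w * Xh ^ 2 := by positivity
      refine le_of_mul_le_mul_left ?_ hp
      nlinarith [h2]
    have h4 : 512 * C1 * L2 ≤ Xh := by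
      refine le_trans ?_ hbig
      have : 0 ≤ 1024 * b * C1 * L2 := by positivity
      nlinarith
    have h5 : 512 * C1 * L2 * (w * Xh) ≤ Xh * (w * Xh) := mul_le_mul_of_nonneg_right h4 (by positivity)
    rw [div_le_iff₀ (by positivity)]
    nlinarith [h3, h5]
  set m := w * Xh ^ 2 / (1024 * b * C1 * L2) with hm
  have hm0 : 0 < m := by positivity
  have hder : ∀ β, HasDerivAt F (dX J W β) β := fun β => X_deriv W β
  have mv := (convex_Icc β₁ β₂).mul_sub_le_image_sub_of_le_deriv (f := F) (C := m)
    (fun β _ => (hder β).continuousAt.continuousWithinAt) (fun β _ => (hder β).differentiableAt.differentiableWithinAt)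
    (fun β hβ => by
      rw [(hder β).deriv]
      have := interior_subset hβ
      exact hD β this.1 this.2) β₁ ⟨le_refl _, k1⟩ β₂ ⟨k1, le_refl _⟩ k1
  have hF2 := hFu β₂ k1 (le_refl _)
  have hF1 : 0 ≤ F β₁ := le_trans (by positivity) (hFl β₁ (le_refl _))
  have h6 : m * (β₂ - β₁) ≤ w * Xh := by linarith
  have h7 : β₂ - β₁ ≤ 1024 * b * C1 * L2 / Xh := by
    rw [le_div_iff₀ hX0]
    have h8 : m * (1024 * b * C1 * L2) = w * Xh ^ 2 := by rw [hm]; field_simp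
    have hp : 0 < w * Xh := by positivity
    refine le_of_mul_le_mul_left ?_ hp
    calc w * Xh * ((β₂ - β₁) * Xh) = (w * Xh ^ 2) * (β₂ - β₁) := by ring
      _ = (m * (β₂ - β₁)) * (1024 * b * C1 * L2) := by rw [← h8]; ring
      _ ≤ (w * Xh) * (1024 * b * C1 * L2) := mul_le_mul_of_nonneg_right h6 (by positivity)
  refine h7.trans (div_le_div_of_nonneg_right ?_ hX0.le)
  have : 0 ≤ 512 * C1 * L2 := by positivity
  nlinarith

end m6c


section fin8
open Classical
variable {d : ℕ} {J : V d → V d → ℝ} {α c C : ℝ} {P : ℝ → Measure (Config d)}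

lemma evt (C2 : ℝ) (hC : 0 < C2) : ∃ h0 : ℝ, 1 ≤ h0 ∧ ∀ h, h0 ≤ h → 4 ≤ 1 + Real.log h ∧ C2 * (1 + Real.log (2 * h)) ^ 2 ≤ 2 * h := by
  have h1 := (Real.isLittleO_pow_log_id_atTop (n := 2)).def (c := 1 / (4 * C2)) (by positivity)
  have h2 := h1.and (Filter.eventually_ge_atTop (Real.exp 3))
  obtain ⟨a, ha⟩ := Filter.eventually_atTop.1 h2
  refine ⟨max 1 (max a (Real.exp 3)), le_max_left _ _, fun h hh => ?_⟩
  have g1 : 1 ≤ h := (le_max_left _ _).trans hh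
  have g2 : a ≤ h := (le_max_left _ _).trans ((le_max_right _ _).trans hh)
  have g3 : Real.exp 3 ≤ h := (le_max_right _ _).trans ((le_max_right _ _).trans hh)
  have g4 : 3 ≤ Real.log h := by
    rw [Real.le_log_iff_exp_le (by linarith)]; exact g3
  refine ⟨by linarith, ?_⟩
  have g5 := (ha (2 * h) (by linarith)).1
  have g6 : Real.log h ≤ Real.log (2 * h) := Real.log_le_log (by linarith) (by linarith)
  rw [Real.norm_of_nonneg (by positivity), id, Real.norm_of_nonneg (by linarith)] at g5
  have g7 : (1 + Real.log (2 * h)) ^ 2 ≤ 4 * Real.log (2 * h) ^ 2 := by nlinarith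
  calc C2 * (1 + Real.log (2 * h)) ^ 2 ≤ C2 * (4 * (1 / (4 * C2) * (2 * h))) :=
        mul_le_mul_of_nonneg_left (g7.trans (by linarith)) hC.le
    _ = 2 * h := by field_simp

lemma log_dbl {h : ℝ} (h1 : 1 ≤ h) (h4 : 4 ≤ 1 + Real.log h) :
    (1 + Real.log (2 * h)) ^ 2 ≤ 1.4 * (1 + Real.log h) ^ 2 := by
  rw [Real.log_mul (by norm_num) (by linarith)]
  have := Real.log_two_lt_d9
  have h0 : 0 < Real.log 2 := Real.log_pos (by norm_num)
  set L := 1 + Real.log h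
  have e : 1 + (Real.log 2 + Real.log h) ≤ 1.175 * L := by
    have : 1 + (Real.log 2 + Real.log h) = L + Real.log 2 := by simp only [L]; ring
    rw [this]; linarith
  have e0 : 0 ≤ 1 + (Real.log 2 + Real.log h) := by
    have : 1 + (Real.log 2 + Real.log h) = L + Real.log 2 := by simp only [L]; ring
    rw [this]; linarith
  have := pow_le_pow_left₀ e0 e 2
  nlinarith [sq_nonneg L]

lemma dbl (hd : d = 1 ∨ d = 2) (hα : α = (d:ℝ) / 3) (hJ : KernelHyp d J α c C) :
    ∃ D h0 : ℝ, 0 < D ∧ 1 ≤ h0 ∧ ∀ β h, bst J / 2 ≤ β → β < bst J → h0 ≤ h → ¬ Bdd J β h →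
      bst J - β ≤ D * (1 + Real.log h) ^ 2 / h := by
  have hb := BS_bdd hd hα hJ
  have hp := bst_pos hJ hb
  obtain ⟨C2, hC2, hM⟩ := M6a hd hα hJ (β₀ := bst J / 2) (by linarith) (bst J) (by linarith)
  obtain ⟨h0, hh1, hh⟩ := evt C2 hC2
  have main : ∀ k : ℕ, ∀ β β' h, bst J / 2 ≤ β → β ≤ β' → β' < bst J → h0 ≤ h → ¬ Bdd J β h →
      Bdd J β' (2 ^ k * h) → β' - β ≤ 3 * C2 * (1 + Real.log h) ^ 2 / h := by
    intro k
    induction k with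
    | zero =>
      intro β β' h k1 k2 k3 k4 k5 k6
      exact absurd (Bdd_beta hJ (by linarith) k2 (by simpa using k6)) k5
    | succ k ih =>
      intro β β' h k1 k2 k3 k4 k5 k6
      have hh0 : 0 < h := by linarith
      obtain ⟨l1, l2⟩ := hh h k4
      have l3 := log_dbl (by linarith) l1
      set q := C2 * (1 + Real.log h) ^ 2 / h with hq
      have hq0 : 0 < q := by
        have : 0 < 1 + Real.log h := by linarith
        positivity
      have e3 : 3 * C2 * (1 + Real.log h) ^ 2 / h = 3 * q := by rw [hq]; ring
      have e2 : C2 * (1 + Real.log (2 * h)) ^ 2 / (2 * h) ≤ 0.7 * q := by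
        rw [hq, div_le_iff₀ (by positivity)]
        calc C2 * (1 + Real.log (2 * h)) ^ 2 ≤ C2 * (1.4 * (1 + Real.log h) ^ 2) := mul_le_mul_of_nonneg_left l3 hC2.le
          _ = _ := by field_simp; norm_num
      rw [e3]
      by_contra hc
      push Not at hc
      have n1 : ¬ Bdd J (β + 0.75 * q) (2 * h) := by
        intro hB
        have := hM β (β + 0.75 * q) (2 * h) k1 (by linarith) (by linarith) (by linarith) l2 hB
          (by rwa [mul_div_cancel_left₀ _ (two_ne_zero)])
        linarith
      have := ih (β + 0.75 * q) β' (2 * h) (by linarith) (by linarith) k3 (by linarith) n1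
        (by rw [← mul_assoc, ← pow_succ]; exact k6)
      have e4 : 3 * C2 * (1 + Real.log (2 * h)) ^ 2 / (2 * h) = 3 * (C2 * (1 + Real.log (2 * h)) ^ 2 / (2 * h)) := by ring
      rw [e4] at this
      linarith
  refine ⟨3 * C2, h0, by positivity, hh1, fun β h k1 k2 k3 k4 => ?_⟩
  refine le_of_forall_lt fun x hx => ?_
  by_contra hc
  push Not at hc
  set β' := max β ((x + β + bst J) / 2) with hβ'
  have hlt : β' < bst J := max_lt k2 (by linarith)
  obtain ⟨M, hB⟩ := bdd_lt hJ (by linarith [le_max_left β ((x + β + bst J) / 2)]) hlt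
  obtain ⟨k, hk⟩ := pow_unbounded_of_one_lt M (one_lt_two : (1:ℝ) < 2)
  have hk2 : M ≤ 2 ^ k * h := by
    have : (0:ℝ) < 2 ^ k := by positivity
    nlinarith
  have := main k β β' h k1 (le_max_left _ _) hlt k3 k4 (fun W x => (hB W x).trans hk2)
  have h5 := le_max_right β ((x + β + bst J) / 2)
  linarith

lemma sus (hd : d = 1 ∨ d = 2) (hα : α = (d:ℝ) / 3) (hJ : KernelHyp d J α c C) :
    ∃ A ε₀ : ℝ, 0 < A ∧ 0 < ε₀ ∧ ∀ ε, 0 < ε → ε < ε₀ → 1 ≤ Real.log (1 / ε) ∧ ε ≤ 1 ∧ ε ≤ bst J / 2 ∧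
      Bdd J (bst J - ε) (A * Real.log (1 / ε) ^ 2 / ε) := by
  have hb := BS_bdd hd hα hJ
  have hp := bst_pos hJ hb
  obtain ⟨D, h0, hD, hh0, hM⟩ := dbl hd hα hJ
  have hA : 1 ≤ 17 * D + 1 := by linarith
  set A := 17 * D + 1 with hAd
  have hlA : 0 ≤ Real.log A := Real.log_nonneg hA
  refine ⟨A, min (min (1 / h0) (Real.exp (-(1 + Real.log A)))) (bst J / 2), by linarith, by positivity, fun ε he hlt => ?_⟩
  have i1 : ε < 1 / h0 := hlt.trans_le ((min_le_left _ _).trans (min_le_left _ _))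
  have i2 : ε < Real.exp (-(1 + Real.log A)) := hlt.trans_le ((min_le_left _ _).trans (min_le_right _ _))
  have i3 : ε < bst J / 2 := hlt.trans_le (min_le_right _ _)
  have j1 : 1 + Real.log A ≤ Real.log (1 / ε) := by
    have := (Real.log_lt_iff_lt_exp he).2 i2
    rw [one_div, Real.log_inv]; linarith
  set l := Real.log (1 / ε) with hl
  have l1 : 1 ≤ l := by linarith
  have j2 : h0 ≤ 1 / ε := (le_one_div he (by linarith)).1 i1.le
  have j3 : ε ≤ 1 := i1.le.trans (by rw [div_le_one (by linarith)]; exact hh0)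
  refine ⟨l1, j3, i3.le, ?_⟩
  by_contra hc
  have hle : 1 / ε ≤ A * l ^ 2 / ε := by
    refine div_le_div_of_nonneg_right ?_ he.le
    nlinarith
  have := hM (bst J - ε) (A * l ^ 2 / ε) (by linarith) (by linarith) (j2.trans hle) hc
  have hLh : Real.log (A * l ^ 2 / ε) = Real.log A + 2 * Real.log l + l := by
    rw [div_eq_mul_one_div, Real.log_mul (by positivity) (by positivity), Real.log_mul (by positivity) (by positivity), Real.log_pow]
    push_cast; rfl
  have hll : Real.log l ≤ l - 1 := Real.log_le_sub_one_of_pos (by linarith)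
  have hl0 : 0 ≤ Real.log l := Real.log_nonneg l1
  have hL4 : 1 + Real.log (A * l ^ 2 / ε) ≤ 4 * l := by rw [hLh]; linarith
  have hL0 : 0 ≤ 1 + Real.log (A * l ^ 2 / ε) := by rw [hLh]; linarith
  have hsq := pow_le_pow_left₀ hL0 hL4 2
  have hl2 : 0 < l ^ 2 := by positivity
  have hApos : 0 < A := by linarith
  rw [le_div_iff₀ (by positivity), show (bst J - (bst J - ε)) * (A * l ^ 2 / ε) = A * l ^ 2 by field_simp; ring] at this
  have h2 := mul_le_mul_of_nonneg_left hsq hD.le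
  nlinarith

lemma kap (hJ : KernelHyp d J α c C) {β : ℝ} (hβ : 0 < β) (v : V d) (W : Finset (V d)) (F : Finset (Sym2 (V d)))
    (hF : F ⊆ W.sym2) (hv : ∀ e ∈ F, v ∈ e) : ∑ e ∈ F, Jt J e / β ≤ Jtot J / β := by
  rw [← Finset.sum_div]
  refine div_le_div_of_nonneg_right ?_ hβ.le
  have hs : F ⊆ W.image (fun b => s(v, b)) := by
    intro e he
    obtain ⟨b, rfl⟩ := hv e he
    have := hF he
    rw [mk_mem_sym2_iff] at this
    exact Finset.mem_image.2 ⟨b, this.2, rfl⟩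
  refine (sum_le_sum_of_subset_of_nonneg hs fun e _ _ => Jt_nn hJ e).trans ?_
  refine le_trans ?_ (row_sum hJ v W)
  rw [Finset.sum_image fun a _ b _ h => Sym2.congr_right.1 h]
  exact le_of_eq (sum_congr rfl fun b _ => Jt_mk hJ v b)

lemma Mn_le (hJ : KernelHyp d J α c C) {β M : ℝ} (hβ : 0 ≤ β) (hB : Bdd J β M) (W : Finset (V d)) (x : V d) (n : ℕ) :
    Mn (Jt J) W x n β ≤ M := by
  refine le_trans ?_ (hB W x)
  unfold tau ta Mn Pr
  rw [← ex_sum]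
  refine ex_mono (pp_isP hJ hβ) fun S _ => ?_
  rw [← cl_card]
  exact_mod_cast min_le_left _ _

lemma Pr_Mn (hJ : KernelHyp d J α c C) {β : ℝ} (hβ : 0 ≤ β) (W : Finset (V d)) (x : V d) {n : ℕ} (hn : 1 ≤ n) :
    Pr (pp J β) W.sym2 (fun S => n ≤ (cl S W x).card) ≤ Mn (Jt J) W x n β / n := by
  have hn0 : (0:ℝ) < n := by exact_mod_cast hn
  rw [le_div_iff₀ hn0]
  unfold Pr Mn
  rw [← ex_mul']
  refine ex_mono (pp_isP hJ hβ) fun S _ => ?_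
  by_cases h : n ≤ (cl S W x).card
  · rw [ind_t h, one_mul, min_eq_right h]
  · rw [ind_f h, zero_mul]; positivity

end fin8

/-- If `d ∈ {1, 2}` and `α = d/3` then the percolation probability is mean-field to
within a polylogarithmic factor near criticality. -/
theorem percolation_probability_polylog {d : ℕ} {J : V d → V d → ℝ} {α c C : ℝ}
    (hJ : KernelHyp d J α c C)
    (P : ℝ → Measure (Config d)) (hP : IsLRP J P)
    (hd : d = 1 ∨ d = 2) (hα : α = (d : ℝ) / 3) :
    ∃ C₁ ε₀ : ℝ, 0 < C₁ ∧ 0 < ε₀ ∧ ∀ ε : ℝ, 0 < ε → ε < ε₀ →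
      ENNReal.ofReal (C₁⁻¹ * (Real.log (1 / ε) ^ 2)⁻¹ * ε) ≤
        P (betaC P + ε) {ω | (cluster ω 0).Infinite} ∧
      P (betaC P + ε) {ω | (cluster ω 0).Infinite} ≤
        ENNReal.ofReal (C₁ * Real.log (1 / ε) ^ 2 * ε) := by
  have hb := BS_bdd hd hα hJ
  have hp := bst_pos hJ hb
  have hJ0 := Jtot_nn hJ
  obtain ⟨A, ε₀, hA, hε₀, hS⟩ := sus hd hα hJ
  rw [betaC_eq hJ hP hb]
  set κ := Jtot J / (bst J / 2) with hκ
  have hκ0 : 0 ≤ κ := by positivity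
  set Q := Real.exp (2 * √(2 * κ)) with hQ
  have hQ0 : 0 < Q := Real.exp_pos _
  refine ⟨Q * A + 2 + 8 * (bst J + 1), ε₀, by positivity, hε₀, fun ε he hlt => ?_⟩
  obtain ⟨l1, e1, e2, hB⟩ := hS ε he hlt
  set l := Real.log (1 / ε) with hl
  have hl1 : 1 ≤ l ^ 2 := by nlinarith
  set C₁ := Q * A + 2 + 8 * (bst J + 1) with hC1
  have hC10 : 0 < C₁ := by positivity
  have hQA : 0 < Q * A := by positivity
  constructor
  · refine le_trans (ENNReal.ofReal_le_ofReal ?_) (theta_lower hJ hP hb he)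
    have a1 : C₁⁻¹ * (l ^ 2)⁻¹ * ε ≤ C₁⁻¹ * ε := by
      have : (l ^ 2)⁻¹ ≤ 1 := inv_le_one_of_one_le₀ hl1
      have h3 : 0 < C₁⁻¹ * ε := by positivity
      nlinarith
    refine a1.trans (le_min ?_ ?_)
    · rw [inv_mul_le_iff₀ hC10]; linarith
    · rw [div_div, inv_mul_eq_div]
      refine div_le_div_of_nonneg_left he.le (by positivity) ?_
      linarith
  · set n := ⌈1 / ε ^ 2⌉₊ with hn
    have he2 : 1 ≤ 1 / ε ^ 2 := by
      rw [one_le_div (by positivity)]; nlinarith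
    have n1 : 1 ≤ n := Nat.one_le_ceil_iff.2 (by linarith)
    have n2 : 1 / ε ^ 2 ≤ n := Nat.le_ceil _
    have n3 : (n:ℝ) ≤ 2 / ε ^ 2 := by
      have := (Nat.ceil_lt_add_one (a := 1 / ε ^ 2) (by linarith)).le
      calc (n:ℝ) ≤ 1 / ε ^ 2 + 1 := this
        _ ≤ 1 / ε ^ 2 + 1 / ε ^ 2 := by linarith
        _ = _ := by ring
    have hn0 : (0:ℝ) < n := by exact_mod_cast n1
    refine theta_up hJ hP (by linarith) 0 n fun N => ?_
    refine (Pr_Mn hJ (by linarith) (bx 0 N) 0 n1).trans ?_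
    have hg := Mn_growth (Jt_nn hJ) (β₀ := bst J - ε) (β₁ := bst J + ε) (by linarith) (by linarith) (W := bx 0 N) (x := 0) n hκ0
      (fun v _ F hF hv => (kap hJ (by linarith) v _ F hF hv).trans
        (div_le_div_of_nonneg_left hJ0 (by linarith) (by linarith)))
    have hm := Mn_le hJ (by linarith) hB (bx 0 N) 0 n
    have hex : Real.exp (√(n * κ) * (bst J + ε - (bst J - ε))) ≤ Q := by
      rw [hQ]
      refine Real.exp_le_exp.2 ?_
      have s1 : √(n * κ) ≤ √(2 * κ) / ε := by
        rw [Real.sqrt_le_left (by positivity), div_pow, Real.sq_sqrt (by positivity)]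
        calc n * κ ≤ 2 / ε ^ 2 * κ := mul_le_mul_of_nonneg_right n3 hκ0
          _ = _ := by ring
      calc √(n * κ) * (bst J + ε - (bst J - ε)) = √(n * κ) * (2 * ε) := by ring
        _ ≤ √(2 * κ) / ε * (2 * ε) := mul_le_mul_of_nonneg_right s1 (by positivity)
        _ = _ := by field_simp
    have hm0 : 0 ≤ A * l ^ 2 / ε := by positivity
    have h3 : Mn (Jt J) (bx 0 N) 0 n (bst J + ε) ≤ Q * (A * l ^ 2 / ε) :=
      hg.trans (mul_le_mul hex hm (Mn_nn (Jt_nn hJ) (by linarith) _ _ _) hQ0.le)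
    rw [div_le_iff₀ hn0]
    refine h3.trans ?_
    calc Q * (A * l ^ 2 / ε) = (Q * A) * l ^ 2 * ε * (1 / ε ^ 2) := by field_simp
      _ ≤ (Q * A) * l ^ 2 * ε * n := mul_le_mul_of_nonneg_left n2 (by positivity)
      _ ≤ C₁ * l ^ 2 * ε * n := by
        have : Q * A ≤ C₁ := by rw [hC1]; linarith
        gcongr

end LRP
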